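/- Let a ∈ ℚ, let B ∈ ℚ with B > 0, and let c₁, c₂, c₃ ∈ ℚ be pairwise distinct. Then the set of pairs (x, y) ∈ ℚ × ℚ satisfying y² = ∏_{i=1}^{3} [ (x − (a + c_i)/2)² + B/4 ] is finite. -/

import Mathlib

section PartP1

/-! ### Abstract heights on abelian groups -/

lemma exists_canonical_height {G : Type*} [AddCommGroup G] (h : G → ℝ) (C : ℝ)
    (hC : ∀ P Q, |h (P + Q) + h (P - Q) - 2 * h P - 2 * h Q| ≤ C) :
    ∃ hh : G → ℝ, (∃ C', ∀ P, |hh P - h P| ≤ C') ∧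
      ∀ P Q, hh (P + Q) + hh (P - Q) = 2 * hh P + 2 * hh Q := by
  set C1 := C + |h 0| with hC1
  have hd : ∀ P, |h (2 • P) - 4 * h P| ≤ C1 := by
    intro P
    have h1 := hC P P
    rw [sub_self, ← two_nsmul] at h1
    have h2 : h (2 • P) - 4 * h P = (h (2 • P) + h 0 - 2 * h P - 2 * h P) - h 0 := by ring
    rw [h2]
    exact (abs_sub _ _).trans (add_le_add h1 le_rfl)
  have hs : ∀ P : G, ∀ n : ℕ, dist (h (2 ^ n • P) / 4 ^ n) (h (2 ^ (n + 1) • P) / 4 ^ (n + 1))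
      ≤ C1 / 4 * (1 / 4) ^ n := by
    intro P n
    have h1 := hd (2 ^ n • P)
    rw [← mul_nsmul', ← pow_succ'] at h1
    rw [dist_comm, Real.dist_eq]
    have h2 : h (2 ^ (n + 1) • P) / 4 ^ (n + 1) - h (2 ^ n • P) / 4 ^ n =
      (h (2 ^ (n + 1) • P) - 4 * h (2 ^ n • P)) * ((1 / 4) ^ (n + 1)) := by
      rw [one_div, inv_pow]; field_simp; ring
    rw [h2, abs_mul, abs_of_nonneg (by positivity : (0:ℝ) ≤ (1 / 4) ^ (n + 1))]
    calc _ ≤ C1 * (1 / 4) ^ (n + 1) := by gcongr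
      _ = _ := by ring
  have hlim : ∀ P : G, ∃ l, Filter.Tendsto (fun n : ℕ => h (2 ^ n • P) / 4 ^ n) Filter.atTop (nhds l) :=
    fun P => cauchySeq_tendsto_of_complete
      (cauchySeq_of_le_geometric (1 / 4) (C1 / 4) (by norm_num) (hs P))
  choose hh hhl using hlim
  refine ⟨hh, ⟨C1 / 4 / (1 - 1 / 4), fun P => ?_⟩, fun P Q => ?_⟩
  · have := dist_le_of_le_geometric_of_tendsto₀ (1 / 4) (C1 / 4) (by norm_num) (hs P) (hhl P)
    rw [dist_comm, Real.dist_eq] at this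
    simpa using this
  · have h1 := ((hhl (P + Q)).add (hhl (P - Q))).sub
      (((hhl P).const_mul 2).add ((hhl Q).const_mul 2))
    have h2 : Filter.Tendsto (fun n : ℕ => C * (1 / 4 : ℝ) ^ n) Filter.atTop (nhds 0) := by
      simpa using (tendsto_pow_atTop_nhds_zero_of_lt_one (by norm_num : (0:ℝ) ≤ 1 / 4)
        (by norm_num)).const_mul C
    have h3 := squeeze_zero_norm (f := fun n : ℕ => h (2 ^ n • (P + Q)) / 4 ^ n + h (2 ^ n • (P - Q)) / 4 ^ n -
          (2 * (h (2 ^ n • P) / 4 ^ n) + 2 * (h (2 ^ n • Q) / 4 ^ n))) (a := fun n : ℕ => C * (1 / 4 : ℝ) ^ n) (fun n => ?_) h2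
    · have := tendsto_nhds_unique h1 h3
      linarith
    · have h4 := hC (2 ^ n • P) (2 ^ n • Q)
      rw [← nsmul_add, ← nsmul_sub] at h4
      rw [Real.norm_eq_abs]
      have h5 : h (2 ^ n • (P + Q)) / 4 ^ n + h (2 ^ n • (P - Q)) / 4 ^ n -
          (2 * (h (2 ^ n • P) / 4 ^ n) + 2 * (h (2 ^ n • Q) / 4 ^ n)) =
          (h (2 ^ n • (P + Q)) + h (2 ^ n • (P - Q)) - 2 * h (2 ^ n • P) - 2 * h (2 ^ n • Q)) *
            (1 / 4) ^ n := by
        rw [one_div, inv_pow]; field_simp; ring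
      rw [h5, abs_mul, abs_of_nonneg (by positivity : (0:ℝ) ≤ (1 / 4) ^ n)]
      gcongr

lemma infinite_fiber {α β : Type*} {Z : Set α} (hZ : Z.Infinite) (f : α → β) (t : Set β)
    (ht : t.Finite) (h : ∀ z ∈ Z, f z ∈ t) : ∃ y ∈ t, (Z ∩ f ⁻¹' {y}).Infinite := by
  by_contra hcon
  push Not at hcon
  refine hZ ((ht.biUnion (t := fun y => Z ∩ f ⁻¹' {y}) fun y hy => ?_).subset ?_)
  · exact hcon y hy
  · intro z hz
    simp only [Set.mem_iUnion]
    exact ⟨f z, h z hz, hz, rfl⟩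

section descent

lemma par_zero {G : Type*} [AddCommGroup G] {hh : G → ℝ}
    (hpar : ∀ P Q, hh (P + Q) + hh (P - Q) = 2 * hh P + 2 * hh Q) : hh 0 = 0 := by
  have := hpar 0 0
  simp at this; linarith

lemma par_two {G : Type*} [AddCommGroup G] {hh : G → ℝ}
    (hpar : ∀ P Q, hh (P + Q) + hh (P - Q) = 2 * hh P + 2 * hh Q) (P : G) :
    hh (2 • P) = 4 * hh P := by
  have := hpar P P
  rw [sub_self, par_zero hpar, ← two_nsmul] at this; linarith

lemma par_two_pow {G : Type*} [AddCommGroup G] {hh : G → ℝ}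
    (hpar : ∀ P Q, hh (P + Q) + hh (P - Q) = 2 * hh P + 2 * hh Q) (k : ℕ) (P : G) :
    hh (2 ^ k • P) = 4 ^ k * hh P := by
  induction k with
  | zero => simp
  | succ k ih => rw [pow_succ', mul_nsmul', par_two hpar, ih]; ring

lemma par_neg {G : Type*} [AddCommGroup G] {hh : G → ℝ}
    (hpar : ∀ P Q, hh (P + Q) + hh (P - Q) = 2 * hh P + 2 * hh Q) (P : G) :
    hh (-P) = hh P := by
  have := hpar 0 P
  rw [par_zero hpar, zero_add, zero_sub] at this; linarith

lemma descent_pair {G : Type*} [AddCommGroup G] {hh : G → ℝ}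
    (hpar : ∀ P Q, hh (P + Q) + hh (P - Q) = 2 * hh P + 2 * hh Q)
    (hnn : ∀ P, 0 ≤ hh P) (hN : ∀ B : ℝ, {P | hh P ≤ B}.Finite)
    (R : Set G) (hRf : R.Finite) (hR : ∀ P, ∃ r ∈ R, ∃ z, P = r + 2 • z)
    (Z : Set G) (hZ : Z.Infinite) (τ : ℝ) (hτ : 0 < τ) (M : ℝ) (k0 : ℕ) :
    ∃ P ∈ Z, ∃ Q ∈ Z, ∃ k ≥ k0, M ≤ hh P ∧ hh (2 ^ k • P - Q) ≤ τ * 4 ^ k * hh P := by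
  obtain ⟨c0, hc0⟩ := (hRf.image hh).bddAbove
  set c := max c0 0
  have hc : ∀ r ∈ R, hh r ≤ c := fun r hr => (hc0 ⟨r, hr, rfl⟩).trans (le_max_left _ _)
  have hcn : 0 ≤ c := le_max_right _ _
  have hadd : ∀ P Q, hh (P + Q) ≤ 2 * hh P + 2 * hh Q := fun P Q => by
    linarith [hpar P Q, hnn (P - Q)]
  have hsub : ∀ P Q, hh (P - Q) ≤ 2 * hh P + 2 * hh Q := fun P Q => by
    linarith [hpar P Q, hnn (P + Q)]
  set B := 2 * c + 16 * (c + 4 * c / τ) + 2 with hB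
  have hcτ : 0 ≤ 4 * c / τ := by positivity
  have key : ∀ z, B < hh z → ∀ N : ℕ,
      (∃ J : ℕ, ∃ y, hh y ≤ B ∧ (B - 2 * c) ≤ 8 * hh y ∧ hh (z - 2 ^ J • y) ≤ c * 4 ^ J) ∨
      (∃ y, B < hh y ∧ hh y ≤ hh z - N ∧ hh (z - 2 ^ N • y) ≤ c * 4 ^ N) := by
    intro z hz N
    induction N with
    | zero => right; exact ⟨z, hz, by simp, by simp [par_zero hpar, hcn]⟩
    | succ N ih =>
      rcases ih with h | ⟨y, hy, hy2, hy3⟩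
      · left; exact h
      · obtain ⟨r, hr, y', rfl⟩ := hR y
        have h1 : 4 * hh y' ≤ 2 * hh (r + 2 • y') + 2 * c := by
          have := hsub (r + 2 • y') r
          rw [add_sub_cancel_left, par_two hpar] at this
          linarith [hc r hr]
        have h2 : hh (z - 2 ^ (N + 1) • y') ≤ c * 4 ^ (N + 1) := by
          have e : z - 2 ^ (N + 1) • y' = (z - 2 ^ N • (r + 2 • y')) + 2 ^ N • r := by
            rw [nsmul_add, ← mul_nsmul', ← pow_succ]; abel
          rw [e]
          have := hadd (z - 2 ^ N • (r + 2 • y')) (2 ^ N • r)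
          rw [par_two_pow hpar] at this
          have h5 : (4:ℝ) ^ N * hh r ≤ 4 ^ N * c := by gcongr; exact hc r hr
          rw [pow_succ]; linarith
        by_cases h3 : hh y' ≤ B
        · left
          refine ⟨N + 1, y', h3, ?_, h2⟩
          have := hadd r (2 • y')
          rw [par_two hpar] at this
          linarith [hc r hr]
        · right
          push Not at h3
          refine ⟨y', h3, ?_, h2⟩
          push_cast
          linarith
  have key2 : ∀ z, B < hh z → 
      ∃ J : ℕ, ∃ y, hh y ≤ B ∧ (B - 2 * c) ≤ 8 * hh y ∧ hh (z - 2 ^ J • y) ≤ c * 4 ^ J := by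
    intro z hz
    obtain ⟨N, hN'⟩ := exists_nat_gt (hh z)
    rcases key z hz N with h | ⟨y, hy, hy2, -⟩
    · exact h
    · linarith
  choose! J y hy1 hy2 hy3 using key2
  have hZ' : (Z \ {P | hh P ≤ B}).Infinite := hZ.sdiff (hN B)
  obtain ⟨y0, hy0, hinf⟩ := infinite_fiber hZ' y {P | hh P ≤ B} (hN B)
    (fun z hz => hy1 z (by simpa using hz.2))
  obtain ⟨P, ⟨hP, hPM⟩⟩ := (hinf.sdiff (hN M)).nonempty
  simp only [Set.mem_inter_iff, Set.mem_diff, Set.mem_setOf_eq, Set.mem_preimage, Set.mem_singleton_iff, not_le] at hP hPM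
  obtain ⟨⟨hPZ, hPB⟩, hPy⟩ := hP
  obtain ⟨Q, ⟨hQ, hQM⟩⟩ := (hinf.sdiff (hN ((2 * c + 2 * hh y0) * 4 ^ (J P + k0)))).nonempty
  simp only [Set.mem_inter_iff, Set.mem_diff, Set.mem_setOf_eq, Set.mem_preimage, Set.mem_singleton_iff, not_le] at hQ hQM
  obtain ⟨⟨hQZ, hQB⟩, hQy⟩ := hQ
  have hP3 := hy3 P hPB
  have hQ3 := hy3 Q hQB
  have hyB := hy2 P hPB
  rw [hPy] at hP3 hyB
  rw [hQy] at hQ3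
  have hJ : J P + k0 < J Q := by
    by_contra hcon
    push Not at hcon
    have h1 : hh Q ≤ 2 * (c * 4 ^ J Q) + 2 * (4 ^ J Q * hh y0) := by
      have := hadd (Q - 2 ^ J Q • y0) (2 ^ J Q • y0)
      rw [sub_add_cancel, par_two_pow hpar] at this
      linarith
    have h2 : (4:ℝ) ^ J Q ≤ 4 ^ (J P + k0) := pow_le_pow_right₀ (by norm_num) hcon
    have h3 : (2 * c + 2 * hh y0) * 4 ^ J Q ≤ (2 * c + 2 * hh y0) * 4 ^ (J P + k0) := by
      gcongr
      linarith [hnn y0]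
    linarith
  refine ⟨P, hPZ, Q, hQZ, J Q - J P, by omega, hPM.le, ?_⟩
  set k := J Q - J P with hk
  have hkJ : J Q = k + J P := by omega
  have e : 2 ^ k • P - Q = 2 ^ k • (P - 2 ^ J P • y0) - (Q - 2 ^ J Q • y0) := by
    rw [nsmul_sub, ← mul_nsmul', ← pow_add, hkJ]; abel
  have h1 : hh (2 ^ k • P - Q) ≤ 4 * c * 4 ^ J Q := by
    rw [e]
    have := hsub (2 ^ k • (P - 2 ^ J P • y0)) (Q - 2 ^ J Q • y0)
    rw [par_two_pow hpar] at this
    have h5 : (4:ℝ) ^ k * hh (P - 2 ^ J P • y0) ≤ 4 ^ k * (c * 4 ^ J P) := by gcongr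
    have h6 : (4:ℝ) ^ k * (c * 4 ^ J P) = c * 4 ^ J Q := by rw [hkJ, pow_add]; ring
    linarith
  have h2 : 4 ^ J P * (hh y0 / 2 - c) ≤ hh P := by
    have := hsub P (P - 2 ^ J P • y0)
    rw [sub_sub_cancel, par_two_pow hpar] at this
    linarith
  have h3 : 4 ^ J Q * (hh y0 / 2 - c) ≤ 4 ^ k * hh P := by
    rw [hkJ, pow_add, mul_assoc]; gcongr
  have h4 : 4 * c ≤ τ * (hh y0 / 2 - c) := by
    have h5 : 4 * c / τ ≤ hh y0 / 2 - c := by linarith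
    rw [div_le_iff₀ hτ] at h5
    linarith
  calc hh (2 ^ k • P - Q) ≤ 4 * c * 4 ^ J Q := h1
    _ ≤ (τ * (hh y0 / 2 - c)) * 4 ^ J Q := by gcongr
    _ = τ * (4 ^ J Q * (hh y0 / 2 - c)) := by ring
    _ ≤ τ * (4 ^ k * hh P) := by gcongr
    _ = _ := by ring

end descent

end PartP1

section PartP2

open Polynomial in
/-- weighted l1 norm on polynomials -/
noncomputable def pnorm {R : Type*} [CommRing R] (ν : RingSeminorm R) (ρ : NNReal) :
    RingSeminorm R[X] where
  toFun p := p.sum fun i c => ν c * (ρ : ℝ) ^ i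
  map_zero' := by simp
  add_le' p q := by
    set N := max p.natDegree q.natDegree + 1
    have h0 : ∀ i, ν 0 * (ρ : ℝ) ^ i = 0 := by simp
    have h1 : (p + q).natDegree < N := Nat.lt_succ_of_le (natDegree_add_le p q)
    rw [sum_over_range' _ h0 N h1, sum_over_range' p h0 N (by omega),
      sum_over_range' q h0 N (by omega), ← Finset.sum_add_distrib]
    refine Finset.sum_le_sum fun i _ => ?_
    rw [coeff_add, ← add_mul]
    gcongr
    exact map_add_le_add ν _ _
  neg' p := by
    simp [sum_def]
  mul_le' p q := by
    set S : R[X] → ℝ := fun p => p.sum fun i c => ν c * (ρ : ℝ) ^ i with hS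
    have hadd : ∀ p q, S (p + q) ≤ S p + S q := by
      intro p q
      set N := max p.natDegree q.natDegree + 1
      have h0 : ∀ i, ν 0 * (ρ : ℝ) ^ i = 0 := by simp
      have h1 : (p + q).natDegree < N := Nat.lt_succ_of_le (natDegree_add_le p q)
      simp only [hS]
      rw [sum_over_range' _ h0 N h1, sum_over_range' p h0 N (by omega),
        sum_over_range' q h0 N (by omega), ← Finset.sum_add_distrib]
      refine Finset.sum_le_sum fun i _ => ?_
      rw [coeff_add, ← add_mul]
      gcongr
      exact map_add_le_add ν _ _
    have hsum : ∀ (s : Finset ℕ) (f : ℕ → R[X]), S (∑ i ∈ s, f i) ≤ ∑ i ∈ s, S (f i) :=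
      fun s f => Finset.le_sum_of_subadditive S (by simp [hS]) hadd s f
    have hmon : ∀ i c, S (monomial i c) = ν c * (ρ : ℝ) ^ i := by
      intro i c
      simp only [hS]
      rw [sum_monomial_index]; simp
    change S (p * q) ≤ S p * S q
    rw [mul_eq_sum_sum]
    refine (hsum _ _).trans ?_
    have e : S p * S q = ∑ i ∈ p.support, ∑ j ∈ q.support,
        (ν (p.coeff i) * (ρ : ℝ) ^ i) * (ν (q.coeff j) * (ρ : ℝ) ^ j) := by
      simp only [hS, sum_def]
      rw [Finset.sum_mul_sum]
    rw [e]
    refine Finset.sum_le_sum fun i _ => ?_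
    rw [sum_def]
    refine (hsum _ _).trans (Finset.sum_le_sum fun j _ => ?_)
    rw [hmon]
    calc _ ≤ (ν (p.coeff i) * ν (q.coeff j)) * (ρ : ℝ) ^ (i + j) := by
          gcongr; exact map_mul_le_mul ν _ _
      _ = _ := by rw [pow_add]; ring

section pnorm
open Polynomial
variable {R : Type*} [CommRing R] (ν : RingSeminorm R) (ρ : NNReal)

lemma pnorm_def (p : R[X]) : pnorm ν ρ p = p.sum fun i c => ν c * (ρ : ℝ) ^ i := rfl

lemma pnorm_monomial (i : ℕ) (c : R) : pnorm ν ρ (monomial i c) = ν c * (ρ : ℝ) ^ i := by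
  rw [pnorm_def, sum_monomial_index]; simp

lemma pnorm_C (c : R) : pnorm ν ρ (C c) = ν c := by
  rw [← monomial_zero_left, pnorm_monomial]; simp

lemma pnorm_X_pow (i : ℕ) : pnorm ν ρ (X ^ i) = ν 1 * (ρ : ℝ) ^ i := by
  rw [X_pow_eq_monomial, pnorm_monomial]

lemma pnorm_X : pnorm ν ρ X = ν 1 * ρ := by
  simpa using pnorm_X_pow ν ρ 1

lemma coeff_le_pnorm (p : R[X]) (i : ℕ) : ν (p.coeff i) * (ρ : ℝ) ^ i ≤ pnorm ν ρ p := by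
  rw [pnorm_def, sum_def]
  by_cases h : i ∈ p.support
  · exact Finset.single_le_sum (f := fun i => ν (p.coeff i) * (ρ : ℝ) ^ i)
      (fun i _ => mul_nonneg (apply_nonneg ν _) (by positivity)) h
  · rw [notMem_support_iff.1 h, map_zero, zero_mul]
    exact Finset.sum_nonneg fun i _ => mul_nonneg (apply_nonneg ν _) (by positivity)

lemma pnorm_derivative (p : R[X]) (hn : ∀ (n : ℕ) (c : R), ν (c * n) ≤ n * ν c) :
    pnorm ν 1 (derivative p) ≤ p.natDegree * pnorm ν 1 p := by
  have h0 : ∀ i, ν 0 * ((1 : NNReal) : ℝ) ^ i = 0 := by simp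
  rw [pnorm_def, sum_over_range' _ h0 (p.natDegree + 1)
    (Nat.lt_succ_of_le ((natDegree_derivative_le p).trans (Nat.sub_le _ _))), Finset.sum_range_succ,
    pnorm_def, sum_over_range _ h0, Finset.sum_range_succ', mul_add, Finset.mul_sum]
  have h1 : (derivative p).coeff p.natDegree = 0 := by
    rw [coeff_derivative, coeff_eq_zero_of_natDegree_lt (Nat.lt_succ_self _)]; simp
  rw [h1]
  refine add_le_add (Finset.sum_le_sum fun i hi => ?_) ?_
  · simp only [NNReal.coe_one, one_pow, mul_one]
    rw [coeff_derivative]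
    have := hn (i + 1) (p.coeff (i + 1))
    push_cast at this ⊢
    refine this.trans ?_
    have hi' : (i : ℝ) + 1 ≤ p.natDegree := by
      have := Finset.mem_range.1 hi
      exact_mod_cast this
    exact mul_le_mul_of_nonneg_right hi' (apply_nonneg ν _)
  · simp only [map_zero, zero_mul, pow_zero, mul_one]
    exact mul_nonneg (Nat.cast_nonneg _) (apply_nonneg ν _)

end pnorm

lemma seminorm_sum_le {R ι : Type*} [CommRing R] (ν : RingSeminorm R) (s : Finset ι) (f : ι → R) :
    ν (∑ i ∈ s, f i) ≤ ∑ i ∈ s, ν (f i) :=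
  Finset.le_sum_of_subadditive ν (map_zero ν).le (map_add_le_add ν) s f

lemma seminorm_pow_le {R : Type*} [CommRing R] (ν : RingSeminorm R) (h1 : ν 1 ≤ 1) (x : R) (n : ℕ) :
    ν (x ^ n) ≤ ν x ^ n := by
  induction n with
  | zero => simpa using h1
  | succ n ih =>
    rw [pow_succ, pow_succ]
    exact (map_mul_le_mul ν _ _).trans (mul_le_mul_of_nonneg_right ih (apply_nonneg ν _))

lemma seminorm_prod_le {R ι : Type*} [CommRing R] (ν : RingSeminorm R) (h1 : ν 1 ≤ 1)
    (s : Finset ι) (f : ι → R) :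
    ν (∏ i ∈ s, f i) ≤ ∏ i ∈ s, ν (f i) := by
  classical
  induction s using Finset.induction_on with
  | empty => simpa using h1
  | insert a s ha ih =>
    rw [Finset.prod_insert ha, Finset.prod_insert ha]
    exact (map_mul_le_mul ν _ _).trans (mul_le_mul_of_nonneg_left ih (apply_nonneg ν _))

/-- absolute value on the integers -/
noncomputable def zν : RingSeminorm ℤ := normRingSeminorm ℤ

lemma zν_apply (n : ℤ) : zν n = |(n : ℝ)| := by
  rw [← Int.norm_eq_abs]; rfl

section wronskian
open Polynomial

lemma wronskian_ne_zero {r : ℕ} (g : Fin r → ℚ[X]) (hg : LinearIndependent ℚ g) :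
    (Matrix.of fun i s : Fin r => derivative^[i] (g s)).det ≠ 0 := by
  intro hdet
  obtain ⟨v, hv0, hv⟩ := Matrix.exists_vecMul_eq_zero_iff.2 hdet
  have hne : (Finset.univ.filter fun i => v i ≠ 0).Nonempty := by
    obtain ⟨i, hi⟩ := Function.ne_iff.1 hv0
    exact ⟨i, by simpa using hi⟩
  set m := (Finset.univ.filter fun i => v i ≠ 0).max' hne with hm
  have hvm : v m ≠ 0 := by
    have := Finset.max'_mem _ hne
    simpa using this
  have hgt : ∀ i, m < i → v i = 0 := by
    intro i hi
    by_contra h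
    exact absurd (Finset.le_max' _ i (by simpa using h)) (not_le.2 hi)
  obtain ⟨x0, hx0⟩ : ∃ x0, (v m).eval x0 ≠ 0 := by
    by_contra h
    push Not at h
    exact hvm (Polynomial.funext (by simpa using h))
  let L : (Fin r → ℚ) →ₗ[ℚ] (Fin m → ℚ) :=
    { toFun := fun c i => (derivative^[(i : ℕ)] (∑ s, c s • g s)).eval x0
      map_add' := by
        intro c d; ext i
        simp [add_smul, Finset.sum_add_distrib]
      map_smul' := by
        intro c d; ext i
        simp only [Pi.smul_apply, smul_eq_mul, RingHom.id_apply]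
        rw [← eval_C_mul, ← smul_eq_C_mul, ← iterate_derivative_smul, Finset.smul_sum]
        simp only [smul_smul] }
  have hker : LinearMap.ker L ≠ ⊥ := by
    apply LinearMap.ker_ne_bot_of_finrank_lt
    simp
  obtain ⟨c, hc, hc0⟩ := (Submodule.ne_bot_iff _).1 hker
  set G := ∑ s, c s • g s with hG
  have hG0 : G ≠ 0 := by
    intro h
    apply hc0
    ext s
    exact Fintype.linearIndependent_iff.1 hg c h s
  have hroot : ∀ i < (m : ℕ), (derivative^[i] G).IsRoot x0 := by
    intro i hi
    exact congrFun (LinearMap.mem_ker.1 hc) ⟨i, hi⟩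
  set e := G.rootMultiplicity x0 with he
  have hem : (m : ℕ) ≤ e := by
    by_contra hlt
    push Not at hlt
    exact absurd ((lt_rootMultiplicity_iff_isRoot_iterate_derivative (n := e) hG0).2
      (fun k hk => hroot k (by omega))) (lt_irrefl _)
  have hsum : ∑ i, v i * derivative^[(i : ℕ)] G = 0 := by
    have h1 : ∀ s, ∑ i, v i * derivative^[(i : ℕ)] (g s) = 0 := by
      intro s
      have := congrFun hv s
      simpa [Matrix.vecMul, dotProduct] using this
    have h2 : ∀ i : ℕ, derivative^[i] G = ∑ s, c s • derivative^[i] (g s) := by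
      intro i
      rw [hG, iterate_derivative_sum]
      simp
    simp_rw [h2, Finset.mul_sum]
    rw [Finset.sum_comm]
    apply Finset.sum_eq_zero
    intro s _
    simp_rw [mul_smul_comm]
    rw [← Finset.smul_sum, h1, smul_zero]
  have hdvd : (X - C x0) ^ e ∣ G := pow_rootMultiplicity_dvd G x0
  have hd2 : (X - C x0) ^ (e - m + 1) ∣ v m * derivative^[(m : ℕ)] G := by
    rw [← Finset.add_sum_erase _ _ (Finset.mem_univ m)] at hsum
    rw [eq_neg_of_add_eq_zero_left hsum, dvd_neg]
    apply Finset.dvd_sum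
    intro i hi
    rcases lt_or_gt_of_ne (Finset.ne_of_mem_erase hi) with h | h
    · refine Dvd.dvd.mul_left ?_ _
      refine (pow_dvd_pow _ ?_).trans (pow_sub_dvd_iterate_derivative_of_pow_dvd i hdvd)
      have : (i : ℕ) < m := h
      omega
    · simp [hgt i h]
  have hd3 : (X - C x0) ^ (e - m + 1) ∣ derivative^[(m : ℕ)] G := by
    refine IsCoprime.dvd_of_dvd_mul_left ?_ hd2
    apply IsCoprime.pow_left
    rw [Irreducible.coprime_iff_not_dvd (irreducible_X_sub_C x0), dvd_iff_isRoot]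
    exact hx0
  have hlast : (derivative^[e] G).IsRoot x0 := by
    have h1 := pow_sub_dvd_iterate_derivative_of_pow_dvd (e - m) hd3
    rw [← Function.iterate_add_apply, Nat.sub_add_cancel hem] at h1
    rw [← dvd_iff_isRoot]
    refine (dvd_pow_self _ ?_).trans h1
    omega
  exact absurd ((lt_rootMultiplicity_iff_isRoot_iterate_derivative (n := e) hG0).2 (fun k hk => by
    rcases Nat.lt_or_eq_of_le hk with h | h
    · rw [← dvd_iff_isRoot]
      exact (dvd_pow_self _ (by omega)).trans (pow_sub_dvd_iterate_derivative_of_pow_dvd k hdvd)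
    · rw [h]; exact hlast)) (lt_irrefl _)

/-- height bound for roots of integer polynomials with multiplicity -/
lemma root_height_pow_le (U : ℤ[X]) (hU : U ≠ 0) (ξ : ℚ) (e : ℕ)
    (h : (X - C ξ) ^ e ∣ U.map (Int.castRingHom ℚ)) :
    (max |(ξ.num : ℝ)| ξ.den) ^ e ≤ pnorm zν 1 U := by
  have hq : (ξ.den : ℤ) ≠ 0 := by exact_mod_cast ξ.den_nz
  set l : ℤ[X] := C (ξ.den : ℤ) * X - C ξ.num with hl
  have hl1 : l.coeff 1 = ξ.den := by
    rw [hl, coeff_sub, coeff_C_mul, coeff_X_one, coeff_C_ne_zero one_ne_zero]; simp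
  have hl0 : l.coeff 0 = - ξ.num := by simp [hl]
  have hlp : l.IsPrimitive := by
    rw [isPrimitive_iff_isUnit_of_C_dvd]
    intro c hc
    rw [C_dvd_iff_dvd_coeff] at hc
    have h0 := hc 0
    have h1 := hc 1
    rw [hl0, dvd_neg] at h0
    rw [hl1] at h1
    have : IsCoprime ξ.num (ξ.den : ℤ) := Int.isCoprime_iff_nat_coprime.2 (by simpa using ξ.reduced)
    exact this.isUnit_of_dvd' h0 h1
  have hlm : l.map (Int.castRingHom ℚ) = C (ξ.den : ℚ) * (X - C ξ) := by
    simp only [hl, Polynomial.map_sub, Polynomial.map_mul, map_C, map_X]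
    rw [mul_sub, ← C_mul]
    simp
  have hdvd : l ^ e ∣ U := by
    have hpe : (l ^ e).IsPrimitive := by
      induction e with
      | zero => simpa using isPrimitive_one
      | succ n ih => rw [pow_succ]; exact (ih ((pow_dvd_pow _ (Nat.le_succ n)).trans h)).mul hlp
    rw [IsPrimitive.Int.dvd_iff_map_cast_dvd_map_cast _ _ hpe, Polynomial.map_pow, hlm, mul_pow,
      ← C_pow, IsUnit.mul_left_dvd]
    · exact h
    · exact isUnit_C.2 (by simp)
  obtain ⟨K, rfl⟩ := hdvd
  have hK : K ≠ 0 := right_ne_zero_of_mul hU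
  have hco : ∀ i, |(((l ^ e * K).coeff i : ℤ) : ℝ)| ≤ pnorm zν 1 (l ^ e * K) := by
    intro i
    have := coeff_le_pnorm zν 1 (l ^ e * K) i
    simpa [zν_apply] using this
  have hlnd : l.natDegree = 1 := by
    apply natDegree_eq_of_le_of_coeff_ne_zero
    · rw [hl]
      refine (natDegree_sub_le _ _).trans ?_
      simpa using natDegree_C_mul_X_le (ξ.den : ℤ)
    · rw [hl1]; exact hq
  have hlead : |((l ^ e * K).leadingCoeff : ℝ)| ≤ pnorm zν 1 (l ^ e * K) := hco _
  have htrail : |((l ^ e * K).trailingCoeff : ℝ)| ≤ pnorm zν 1 (l ^ e * K) := hco _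
  have hone : ∀ z : ℤ, z ≠ 0 → (1:ℝ) ≤ |(z : ℝ)| := by
    intro z hz
    exact_mod_cast Int.one_le_abs hz
  have hB : (ξ.den : ℝ) ^ e ≤ pnorm zν 1 (l ^ e * K) := by
    refine le_trans ?_ hlead
    rw [leadingCoeff_mul, leadingCoeff_pow]
    have : l.leadingCoeff = ξ.den := by rw [leadingCoeff, hlnd, hl1]
    rw [this]
    push_cast
    rw [abs_mul, abs_pow, Nat.abs_cast]
    exact le_mul_of_one_le_right (by positivity) (hone _ (leadingCoeff_ne_zero.2 hK))
  have hA : |(ξ.num : ℝ)| ^ e ≤ pnorm zν 1 (l ^ e * K) := by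
    by_cases hp : ξ.num = 0
    · rw [hp]
      rcases Nat.eq_zero_or_pos e with rfl | he
      · simpa using (hone _ (leadingCoeff_ne_zero.2 hU)).trans hlead
      · rw [Int.cast_zero, abs_zero, zero_pow (by omega)]
        exact apply_nonneg _ _
    · refine le_trans ?_ htrail
      have htp : ∀ n : ℕ, (l ^ n).trailingCoeff = l.trailingCoeff ^ n := by
        intro n
        induction n with
        | zero => rw [pow_zero, pow_zero, ← C_1, ← monomial_zero_left, trailingCoeff, natTrailingDegree_monomial one_ne_zero]; simp
        | succ n ih => rw [pow_succ, trailingCoeff_mul, ih, pow_succ]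
      rw [trailingCoeff_mul, htp]
      have : l.trailingCoeff = - ξ.num := by
        rw [trailingCoeff, natTrailingDegree_eq_zero.2 (Or.inr (by rw [hl0]; simpa using hp)), hl0]
      rw [this]
      push_cast
      rw [abs_mul, abs_pow, abs_neg]
      exact le_mul_of_one_le_right (by positivity) (hone _ (by
        simpa using hK))
  rcases le_total |(ξ.num : ℝ)| ξ.den with h | h
  · rw [max_eq_right h]; exact hB
  · rw [max_eq_left h]; exact hA

lemma order_bound {m : ℕ} (g : Fin m → ℤ[X]) (t : Fin m → ℚ) (ξ : ℚ) (I d : ℕ) (L : ℝ)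
    (hd1 : 1 ≤ d) (hL1 : 1 ≤ L)
    (hd : ∀ j, (g j).natDegree ≤ d) (hL : ∀ j, pnorm zν 1 (g j) ≤ L)
    (hG : ∑ j, C (t j) * (g j).map (Int.castRingHom ℚ) ≠ 0)
    (hI : (X - C ξ) ^ I ∣ ∑ j, C (t j) * (g j).map (Int.castRingHom ℚ)) :
    (max |(ξ.num : ℝ)| ξ.den) ^ (I - m) ≤ m.factorial * ((d : ℝ) ^ m * L) ^ m := by
  set gq : Fin m → ℚ[X] := fun j => (g j).map (Int.castRingHom ℚ) with hgq
  set G := ∑ j, C (t j) * gq j with hGdef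
  obtain ⟨κ, a, ha, hspan, hli⟩ := exists_linearIndependent' ℚ gq
  have : Finite κ := Finite.of_injective a ha
  have := Fintype.ofFinite κ
  set r := Fintype.card κ with hr
  have hrm : r ≤ m := by simpa using Fintype.card_le_of_injective a ha
  let eqv := (Fintype.equivFin κ).symm
  set b : Fin r → Fin m := fun i => a (eqv i) with hb
  have hli' : LinearIndependent ℚ (fun i => gq (b i)) := hli.comp eqv eqv.injective
  have hGs : G ∈ Submodule.span ℚ (Set.range fun i => gq (b i)) := by
    have e : (Set.range fun i => gq (b i)) = Set.range (gq ∘ a) := by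
      have : (fun i => gq (b i)) = (gq ∘ a) ∘ eqv := rfl
      rw [this, Set.range_comp, eqv.surjective.range_eq, Set.image_univ]
    rw [e, hspan]
    apply Submodule.sum_mem
    intro j _
    rw [← smul_eq_C_mul]
    exact Submodule.smul_mem _ _ (Submodule.subset_span ⟨j, rfl⟩)
  obtain ⟨c, hc⟩ := (Submodule.mem_span_range_iff_exists_fun ℚ).1 hGs
  obtain ⟨s0, hs0⟩ : ∃ s, c s ≠ 0 := by
    by_contra h
    push Not at h
    apply hG
    rw [← hc]
    simp [h]
  set MZ : Matrix (Fin r) (Fin r) ℤ[X] := Matrix.of fun i s => derivative^[(i : ℕ)] (g (b s)) with hMZ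
  set MQ : Matrix (Fin r) (Fin r) ℚ[X] := Matrix.of fun i s => derivative^[(i : ℕ)] (gq (b s)) with hMQ
  have hmap : MZ.det.map (Int.castRingHom ℚ) = MQ.det := by
    rw [← Polynomial.coe_mapRingHom, RingHom.map_det]
    congr 1
    ext i s : 2
    simp [hMZ, hMQ, hgq, Polynomial.iterate_derivative_map]
  have hQ0 : MQ.det ≠ 0 := wronskian_ne_zero _ hli'
  have hZ0 : MZ.det ≠ 0 := by
    intro h
    rw [h, Polynomial.map_zero] at hmap
    exact hQ0 hmap.symm
  have hdv : (X - C ξ) ^ (I - m) ∣ MZ.det.map (Int.castRingHom ℚ) := by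
    rw [hmap]
    have h1 := Matrix.det_updateCol_sum MQ s0 (fun s => C (c s))
    have h2 : (X - C ξ) ^ (I - m) ∣ C (c s0) • MQ.det := by
      rw [← h1, Matrix.det_eq_sum_mul_adjugate_col _ s0]
      apply Finset.dvd_sum
      intro i _
      refine Dvd.dvd.mul_right ?_ _
      rw [Matrix.updateCol_self]
      have h3 : ∑ s, C (c s) • MQ i s = derivative^[(i : ℕ)] G := by
        rw [← hc, iterate_derivative_sum]
        simp [hMQ, smul_eq_C_mul]
      rw [h3]
      refine (pow_dvd_pow _ ?_).trans (pow_sub_dvd_iterate_derivative_of_pow_dvd i hI)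
      have := i.2
      omega
    rw [smul_eq_mul, IsUnit.dvd_mul_left (isUnit_C.2 (by simpa using hs0))] at h2
    exact h2
  refine (root_height_pow_le _ hZ0 ξ _ hdv).trans ?_
  have hone : pnorm zν 1 (1 : ℤ[X]) ≤ 1 := by
    rw [← C_1, pnorm_C, zν_apply]; simp
  have hdi : ∀ (i : ℕ) (j : Fin m), pnorm zν 1 (derivative^[i] (g j)) ≤ (d : ℝ) ^ i * L := by
    intro i j
    induction i with
    | zero => simpa using hL j
    | succ i ih =>
      rw [Function.iterate_succ_apply']
      refine (pnorm_derivative zν _ ?_).trans ?_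
      · intro n c
        rw [zν_apply, zν_apply]; push_cast
        rw [abs_mul, Nat.abs_cast, mul_comm]
      · have h1 : (derivative^[i] (g j)).natDegree ≤ d :=
          (natDegree_iterate_derivative _ _).trans ((Nat.sub_le _ _).trans (hd j))
        rw [pow_succ', mul_assoc]
        have h2 : ((derivative^[i] (g j)).natDegree : ℝ) ≤ d := by exact_mod_cast h1
        exact mul_le_mul h2 ih (apply_nonneg _ _) (by positivity)
  have hd1' : (1:ℝ) ≤ d := by exact_mod_cast hd1
  have hdL : 1 ≤ (d : ℝ) ^ m * L := one_le_mul_of_one_le_of_one_le (one_le_pow₀ hd1') hL1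
  rw [Matrix.det_apply]
  refine (seminorm_sum_le _ _ _).trans ?_
  calc ∑ σ : Equiv.Perm (Fin r), pnorm zν 1 (Equiv.Perm.sign σ • ∏ i, MZ (σ i) i)
      ≤ ∑ σ : Equiv.Perm (Fin r), ((d : ℝ) ^ m * L) ^ m := by
        refine Finset.sum_le_sum fun σ _ => ?_
        have h1 : pnorm zν 1 (Equiv.Perm.sign σ • ∏ i, MZ (σ i) i) = pnorm zν 1 (∏ i, MZ (σ i) i) := by
          rcases Int.units_eq_one_or (Equiv.Perm.sign σ) with h | h <;> rw [h] <;> simp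
        rw [h1]
        refine (seminorm_prod_le _ hone _ _).trans ?_
        calc _ ≤ ∏ i : Fin r, (d : ℝ) ^ m * L := by
              refine Finset.prod_le_prod (fun i _ => apply_nonneg _ _) fun i _ => ?_
              refine (hdi _ _).trans ?_
              gcongr
              · have := (σ i).2; omega
          _ = ((d : ℝ) ^ m * L) ^ r := by simp
          _ ≤ _ := pow_le_pow_right₀ hdL hrm
    _ = r.factorial * ((d : ℝ) ^ m * L) ^ m := by
        rw [Finset.sum_const, Finset.card_univ, Fintype.card_perm, Fintype.card_fin, nsmul_eq_mul]
    _ ≤ _ := by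
        gcongr

end wronskian

end PartP2

section PartP3

open WeierstrassCurve Height

/-- the curve y^2 = x^3 + a2 x^2 + a4 x -/
def EC (a2 a4 : ℚ) : WeierstrassCurve.Affine ℚ := ⟨0, a2, 0, a4, 0⟩

section EC
variable {a2 a4 : ℚ}

lemma EC_equation (x y : ℚ) : (EC a2 a4).Equation x y ↔ y ^ 2 = x ^ 3 + a2 * x ^ 2 + a4 * x := by
  rw [Affine.equation_iff]; simp [EC]

lemma EC_negY (x y : ℚ) : (EC a2 a4).negY x y = -y := by simp [Affine.negY, EC]

lemma EC_Δ : (EC a2 a4).Δ = 16 * a4 ^ 2 * (a2 ^ 2 - 4 * a4) := by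
  simp [WeierstrassCurve.Δ, WeierstrassCurve.b₂, WeierstrassCurve.b₄, WeierstrassCurve.b₆,
    WeierstrassCurve.b₈, EC]
  ring

lemma EC_elliptic (h4 : a4 ≠ 0) (hd : a2 ^ 2 - 4 * a4 ≠ 0) : (EC a2 a4).IsElliptic := by
  refine ⟨isUnit_iff_ne_zero.2 ?_⟩
  rw [EC_Δ]
  exact mul_ne_zero (mul_ne_zero (by norm_num) (pow_ne_zero 2 h4)) hd

lemma EC_nonsingular (h4 : a4 ≠ 0) (hd : a2 ^ 2 - 4 * a4 ≠ 0) {x y : ℚ}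
    (h : y ^ 2 = x ^ 3 + a2 * x ^ 2 + a4 * x) : (EC a2 a4).Nonsingular x y := by
  have := EC_elliptic h4 hd
  exact (Affine.equation_iff_nonsingular (W := EC a2 a4)).1 ((EC_equation x y).2 h)

lemma EC_eq {x y : ℚ} (h : (EC a2 a4).Nonsingular x y) : y ^ 2 = x ^ 3 + a2 * x ^ 2 + a4 * x :=
  (EC_equation x y).1 h.1

lemma some_congr {W : Affine ℚ} {x y x' y' : ℚ} (h : W.Nonsingular x y) (hx : x = x') (hy : y = y') :
    ∃ h' : W.Nonsingular x' y', Affine.Point.some x y h = Affine.Point.some x' y' h' := by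
  subst hx; subst hy; exact ⟨h, rfl⟩

lemma EC_add {x₁ y₁ x₂ y₂ : ℚ} (h₁ : (EC a2 a4).Nonsingular x₁ y₁) (h₂ : (EC a2 a4).Nonsingular x₂ y₂)
    (hx : x₁ ≠ x₂) : ∃ y₃ h₃, Affine.Point.some x₁ y₁ h₁ + Affine.Point.some x₂ y₂ h₂ =
      Affine.Point.some (((x₁ * x₂ + a4) * (x₁ + x₂) + 2 * a2 * x₁ * x₂ - 2 * y₁ * y₂) /
        (x₁ - x₂) ^ 2) y₃ h₃ := by
  rw [Affine.Point.add_of_X_ne hx]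
  have hx' : x₁ - x₂ ≠ 0 := sub_ne_zero.2 hx
  refine ⟨_, some_congr _ ?_ rfl⟩
  rw [Affine.slope_of_X_ne hx, Affine.addX]
  have e1 := EC_eq h₁
  have e2 := EC_eq h₂
  simp only [EC]
  field_simp
  linear_combination e1 + e2

lemma EC_sub {x₁ y₁ x₂ y₂ : ℚ} (h₁ : (EC a2 a4).Nonsingular x₁ y₁) (h₂ : (EC a2 a4).Nonsingular x₂ y₂)
    (hx : x₁ ≠ x₂) : ∃ y₃ h₃, Affine.Point.some x₁ y₁ h₁ - Affine.Point.some x₂ y₂ h₂ =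
      Affine.Point.some (((x₁ * x₂ + a4) * (x₁ + x₂) + 2 * a2 * x₁ * x₂ + 2 * y₁ * y₂) /
        (x₁ - x₂) ^ 2) y₃ h₃ := by
  rw [sub_eq_add_neg (Affine.Point.some x₁ y₁ h₁), Affine.Point.neg_some]
  obtain ⟨y3, h3, e⟩ := EC_add h₁ ((Affine.nonsingular_neg x₂ y₂).2 h₂) hx
  obtain ⟨h', e'⟩ := some_congr (x' := ((x₁ * x₂ + a4) * (x₁ + x₂) + 2 * a2 * x₁ * x₂ + 2 * y₁ * y₂) /
        (x₁ - x₂) ^ 2) h3 (by rw [EC_negY]; ring) rfl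
  exact ⟨_, h', e.trans e'⟩

lemma EC_dbl {x y : ℚ} (h : (EC a2 a4).Nonsingular x y) (hy : y ≠ 0) :
    ∃ h₃, Affine.Point.some x y h + Affine.Point.some x y h =
      Affine.Point.some ((x ^ 2 - a4) ^ 2 / (4 * y ^ 2))
        ((x ^ 2 - a4) * (x ^ 4 + 2 * a2 * x ^ 3 + 6 * a4 * x ^ 2 + 2 * a2 * a4 * x + a4 ^ 2) /
          (8 * y ^ 3)) h₃ := by
  have hy' : y ≠ (EC a2 a4).negY x y := by
    rw [EC_negY]; intro h; apply hy; linarith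
  rw [Affine.Point.add_self_of_Y_ne hy']
  have hX : (EC a2 a4).addX x x ((EC a2 a4).slope x x y y) = (x ^ 2 - a4) ^ 2 / (4 * y ^ 2) := by
    rw [Affine.slope_of_Y_ne rfl hy', Affine.addX, EC_negY]
    have e1 := EC_eq h
    simp only [EC]
    have : y - -y ≠ 0 := by rw [sub_neg_eq_add, ← two_mul]; exact mul_ne_zero two_ne_zero hy
    field_simp
    ring_nf
    linear_combination (-16 * a2 - 32 * x) * e1
  refine some_congr _ hX ?_
  rw [Affine.addY, Affine.negAddY, hX, EC_negY, Affine.slope_of_Y_ne rfl hy', EC_negY]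
  have e1 := EC_eq h
  simp only [EC]
  have : y - -y ≠ 0 := by rw [sub_neg_eq_add, ← two_mul]; exact mul_ne_zero two_ne_zero hy
  field_simp
  ring_nf
  have e4 : y ^ 4 = (x ^ 3 + a2 * x ^ 2 + a4 * x) ^ 2 := by rw [← e1]; ring
  rw [e4, e1]
  ring

lemma EC_dbl_zero {x : ℚ} (h : (EC a2 a4).Nonsingular x 0) :
    Affine.Point.some x 0 h + Affine.Point.some x 0 h = 0 := by
  apply Affine.Point.add_self_of_Y_eq
  rw [EC_negY]; simp

/-- the map of sym2x -/
lemma EC_addSub (h4 : a4 ≠ 0) (hd : a2 ^ 2 - 4 * a4 ≠ 0) (P Q : (EC a2 a4).Point) :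
    ∃ c : ℚ, c ≠ 0 ∧ (fun i ↦ (addSubMap (EC a2 a4) i).eval (P.sym2x Q)) =
      c • ((P + Q).sym2x (P - Q)) := by
  have hb2 : (EC a2 a4).b₂ = 4 * a2 := by simp [WeierstrassCurve.b₂, EC]
  have hb4 : (EC a2 a4).b₄ = 2 * a4 := by simp [WeierstrassCurve.b₄, EC]
  have hb6 : (EC a2 a4).b₆ = 0 := by simp [WeierstrassCurve.b₆, EC]
  have hb8 : (EC a2 a4).b₈ = - a4 ^ 2 := by simp [WeierstrassCurve.b₈, EC]
  -- doubling case
  have hdbl : ∀ {x y : ℚ} (h : (EC a2 a4).Nonsingular x y), ∃ c : ℚ, c ≠ 0 ∧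
      (fun i ↦ (addSubMap (EC a2 a4) i).eval ((Affine.Point.some x y h).sym2x (Affine.Point.some x y h))) =
      c • ((Affine.Point.some x y h + Affine.Point.some x y h).sym2x 0) := by
    intro x y h
    have e := EC_eq h
    by_cases hy : y = 0
    · subst hy
      rw [EC_dbl_zero h, Affine.Point.sym2x_zero_zero, Affine.Point.sym2x_some_some]
      refine ⟨(x ^ 2 - a4) ^ 2, ?_, ?_⟩
      · have h1 : x * (x ^ 2 + a2 * x + a4) = 0 := by linear_combination -e
        apply pow_ne_zero
        intro h2
        have hx2 : x ^ 2 = a4 := by linarith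
        rcases mul_eq_zero.1 h1 with h3 | h3
        · rw [h3] at hx2; apply h4; rw [← hx2]; ring
        · have h5 : a2 * x = - 2 * a4 := by linarith
          have h6 : a2 ^ 2 * a4 = 4 * a4 * a4 := by
            rw [← hx2]
            have : (a2 * x) ^ 2 = 4 * a4 ^ 2 := by rw [h5]; ring
            rw [← hx2] at this
            linear_combination this
          apply hd
          have := mul_right_cancel₀ h4 h6
          linarith
      · ext i
        fin_cases i <;> simp [addSubMap, hb2, hb4, hb6, hb8]
        · ring
        · linear_combination -4 * e
        · ring
    · obtain ⟨h3, e3⟩ := EC_dbl h hy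
      rw [e3, Affine.Point.sym2x_some_zero, Affine.Point.sym2x_some_some]
      refine ⟨4 * y ^ 2, by positivity, ?_⟩
      ext i
      fin_cases i <;> simp [addSubMap, hb2, hb4, hb6, hb8]
      · field_simp; ring
      · linear_combination -4 * e
      · ring
  rcases P with _ | ⟨x₁, y₁, h₁⟩
  · rw [← Affine.Point.zero_def, zero_add, zero_sub, Affine.Point.sym2x_neg_right]
    rcases Q with _ | ⟨x₂, y₂, h₂⟩
    · rw [← Affine.Point.zero_def, Affine.Point.sym2x_zero_zero]
      refine ⟨1, one_ne_zero, ?_⟩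
      ext i
      fin_cases i <;> simp [addSubMap]
    · rw [Affine.Point.sym2x_zero_some, Affine.Point.sym2x_some_some]
      refine ⟨1, one_ne_zero, ?_⟩
      ext i
      fin_cases i <;> simp [addSubMap] <;> ring
  · rcases Q with _ | ⟨x₂, y₂, h₂⟩
    · rw [← Affine.Point.zero_def, add_zero, sub_zero, Affine.Point.sym2x_some_zero,
        Affine.Point.sym2x_some_some]
      refine ⟨1, one_ne_zero, ?_⟩
      ext i
      fin_cases i <;> simp [addSubMap] <;> ring
    · by_cases hx : x₁ = x₂
      · rcases Affine.Point.X_eq_iff (h₁ := h₁) (h₂ := h₂) |>.1 hx with h | h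
        · rw [h, sub_self]
          exact hdbl h₂
        · rw [h, neg_add_cancel, Affine.Point.sym2x_neg_left, Affine.Point.sym2x_comm 0,
            ← neg_add', Affine.Point.sym2x_neg_left]
          exact hdbl h₂
      · obtain ⟨y3, h3, e3⟩ := EC_add h₁ h₂ hx
        obtain ⟨y4, h4', e4⟩ := EC_sub h₁ h₂ hx
        rw [e3, e4, Affine.Point.sym2x_some_some, Affine.Point.sym2x_some_some]
        have hx' : x₁ - x₂ ≠ 0 := sub_ne_zero.2 hx
        have e1 := EC_eq h₁
        have e2 := EC_eq h₂
        refine ⟨(x₁ - x₂) ^ 2, pow_ne_zero 2 hx', ?_⟩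
        ext i
        fin_cases i <;> simp [addSubMap, hb2, hb4, hb6, hb8]
        · field_simp
          have e12 : y₁ ^ 2 * y₂ ^ 2 = (x₁ ^ 3 + a2 * x₁ ^ 2 + a4 * x₁) *
            (x₂ ^ 3 + a2 * x₂ ^ 2 + a4 * x₂) := by rw [e1, e2]
          linear_combination 4 * e12
        · field_simp; ring
        · ring

/-- naive height -/
noncomputable def nh (P : (EC a2 a4).Point) : ℝ := logHeight P.xRep

lemma nh_some {x y : ℚ} (h : (EC a2 a4).Nonsingular x y) :
    nh (Affine.Point.some x y h) = logHeight₁ x := by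
  rw [nh, Affine.Point.xRep_some, logHeight₁_eq_logHeight]

lemma nh_par (h4 : a4 ≠ 0) (hd : a2 ^ 2 - 4 * a4 ≠ 0) : ∃ C, ∀ P Q : (EC a2 a4).Point,
    |nh (P + Q) + nh (P - Q) - 2 * nh P - 2 * nh Q| ≤ C := by
  have := EC_elliptic h4 hd
  obtain ⟨C1, hC1⟩ := abs_logHeight_addSubMap_sub_two_mul_logHeight_le (EC a2 a4)
  obtain ⟨C2, hC2⟩ := abs_logHeight_sym2_sub_le ℚ
  have hs : ∀ P Q : (EC a2 a4).Point, |logHeight (P.sym2x Q) - (nh P + nh Q)| ≤ C2 := by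
    intro P Q
    have e : ∀ v : Fin 2 → ℚ, v = ![v 0, v 1] := fun v => by ext i; fin_cases i <;> rfl
    have h1 := P.xRep_ne_zero
    have h2 := Q.xRep_ne_zero
    rw [e P.xRep] at h1
    rw [e Q.xRep] at h2
    have := hC2 h1 h2
    rw [← e, ← e] at this
    exact this
  refine ⟨C1 + 3 * C2, fun P Q => ?_⟩
  obtain ⟨c, hc, he⟩ := EC_addSub h4 hd P Q
  have h1 := hC1 (P.sym2x Q)
  rw [he, logHeight_smul_eq_logHeight _ hc] at h1
  have h2 := hs P Q
  have h3 := hs (P + Q) (P - Q)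
  rw [abs_le] at *
  constructor <;> linarith

lemma nh_nonneg (P : (EC a2 a4).Point) : 0 ≤ nh P := by
  unfold nh; exact logHeight_nonneg _

lemma nh_northcott (B : ℝ) : {P : (EC a2 a4).Point | nh P ≤ B}.Finite := by
  have h1 : {x : ℚ | logHeight₁ x ≤ B}.Finite := NumberField.finite_setOfPred_logHeight₁_le ℚ B
  have h2 : (insert ![(1:ℚ), 0] ((fun x : ℚ => ![x, 1]) '' {x : ℚ | logHeight₁ x ≤ B})).Finite :=
    (h1.image _).insert _
  refine Set.Finite.of_finite_fibers (Affine.Point.xRep) (h2.subset ?_) ?_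
  · rintro _ ⟨P, hP, rfl⟩
    rcases P with _ | ⟨x, y, h⟩
    · left; rfl
    · right
      refine ⟨x, ?_, rfl⟩
      rw [Set.mem_ofPred_eq, nh_some] at hP
      exact hP
  · intro v _
    by_cases hv : ∃ P0 : (EC a2 a4).Point, P0.xRep = v
    · obtain ⟨P0, rfl⟩ := hv
      refine (Set.toFinite {P0, -P0}).subset ?_
      rintro P ⟨-, hP⟩
      exact Affine.Point.eq_or_eq_neg_of_xRep_eq_xRep hP
    · convert Set.finite_empty
      ext P
      simp only [Set.mem_inter_iff, Set.mem_preimage, Set.mem_singleton_iff, Set.mem_empty_iff_false, iff_false]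
      rintro ⟨-, hP⟩
      exact hv ⟨P, hP⟩

/-- canonical height exists -/
lemma exists_hhat (h4 : a4 ≠ 0) (hd : a2 ^ 2 - 4 * a4 ≠ 0) : ∃ hh : (EC a2 a4).Point → ℝ,
    (∃ C, ∀ P, |hh P - nh P| ≤ C) ∧ (∀ P Q, hh (P + Q) + hh (P - Q) = 2 * hh P + 2 * hh Q) ∧
    (∀ P, 0 ≤ hh P) ∧ (∀ B : ℝ, {P | hh P ≤ B}.Finite) := by
  obtain ⟨C, hC⟩ := nh_par h4 hd
  obtain ⟨hh, ⟨C', hC'⟩, hpar⟩ := exists_canonical_height nh C hC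
  refine ⟨hh, ⟨C', hC'⟩, hpar, ?_, ?_⟩
  · intro P
    by_contra hneg
    push Not at hneg
    obtain ⟨k, hk⟩ := pow_unbounded_of_one_lt (C' / -hh P) (by norm_num : (1:ℝ) < 4)
    have h1 := par_two_pow hpar k P
    have h2 := abs_le.1 (hC' (2 ^ k • P))
    have h3 := nh_nonneg (2 ^ k • P)
    rw [div_lt_iff₀ (by linarith)] at hk
    linarith
  · intro B
    refine (nh_northcott (B + C')).subset ?_
    intro P hP
    have := abs_le.1 (hC' P)
    simp only [Set.mem_ofPred_eq] at hP ⊢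
    linarith

end EC

end PartP3

section PartP3b

open WeierstrassCurve Height

lemma int_mul_sq {u v z N : ℤ} (hu : u ≠ 0) (h : u * v = z ^ 2) (hg : (Int.gcd u v : ℤ) ∣ N) :
    ∃ s t : ℤ, s ∣ N ∧ u = s * t ^ 2 := by
  have hg0 : (Int.gcd u v) ≠ 0 := fun h0 => hu (Int.gcd_eq_zero_iff.1 h0).1
  have hpos : 0 < Int.gcd u v := Nat.pos_of_ne_zero hg0
  obtain ⟨u', v', hc, eu, ev⟩ := Int.exists_gcd_one hpos
  set g : ℤ := (Int.gcd u v : ℤ) with hgdef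
  have hg0' : g ≠ 0 := by rw [hgdef]; exact_mod_cast hg0
  have h1 : g ^ 2 ∣ z ^ 2 := ⟨u' * v', by rw [← h, eu, ev]; ring⟩
  have h2 : g ∣ z := (Int.pow_dvd_pow_iff two_ne_zero).1 h1
  obtain ⟨w, rfl⟩ := h2
  have h3 : u' * v' = w ^ 2 := by
    have : g ^ 2 * (u' * v') = g ^ 2 * w ^ 2 := by
      calc g ^ 2 * (u' * v') = (u' * g) * (v' * g) := by ring
        _ = u * v := by rw [← eu, ← ev]
        _ = _ := by rw [h]; ring
    exact mul_left_cancel₀ (pow_ne_zero 2 hg0') this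
  obtain ⟨t, ht | ht⟩ := Int.sq_of_gcd_eq_one hc h3
  · exact ⟨g, t, hg, by rw [eu, ht]; ring⟩
  · exact ⟨-g, t, (neg_dvd).2 hg, by rw [eu, ht]; ring⟩

lemma int_gcd_mul_dvd {u a b A B : ℤ} (ha : (Int.gcd u a : ℤ) ∣ A) (hb : (Int.gcd u b : ℤ) ∣ B) :
    (Int.gcd u (a * b) : ℤ) ∣ A * B := by
  have h1 : Int.gcd u (a * b) ∣ Int.gcd u a * Int.gcd u b := by
    simp only [Int.gcd_def, Int.natAbs_mul]
    exact Nat.gcd_mul_right_dvd_mul_gcd _ _ _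
  have h2 : ((Int.gcd u (a * b) : ℕ) : ℤ) ∣ ((Int.gcd u a * Int.gcd u b : ℕ) : ℤ) :=
    Int.natCast_dvd_natCast.2 h1
  push_cast at h2
  exact h2.trans (mul_dvd_mul ha hb)

/-- gcd of two integers divides any combination of them -/
lemma gcd_dvd_of_comb {u v N : ℤ} (x y : ℤ) (h : N = x * u + y * v) : (Int.gcd u v : ℤ) ∣ N := by
  rw [h]
  exact dvd_add ((Int.gcd_dvd_left ..).mul_left _) ((Int.gcd_dvd_right ..).mul_left _)

lemma gcd_dvd_of_two {u v N p d : ℤ} (hpd : IsCoprime p d) (h1 : (Int.gcd u v : ℤ) ∣ N * p)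
    (h2 : (Int.gcd u v : ℤ) ∣ N * d) : (Int.gcd u v : ℤ) ∣ N := by
  obtain ⟨x, y, h⟩ := hpd
  have : N = x * (N * p) + y * (N * d) := by linear_combination - N * h
  rw [this]
  exact dvd_add (h1.mul_left _) (h2.mul_left _)

lemma int_finite_dvd {N : ℤ} (hN : N ≠ 0) : {s : ℤ | s ∣ N}.Finite := by
  refine (Set.finite_Icc (-|N|) |N|).subset ?_
  intro s hs
  have := Int.le_of_dvd (abs_pos.2 hN) ((abs_dvd_abs _ _).2 hs)
  exact abs_le.1 this

section
variable {e2 e3 : ℤ}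

/-- class of x - e -/
lemma sqclass_finite (h2 : e2 ≠ 0) (h3 : e3 ≠ 0) (h23 : e2 ≠ e3) :
    ∃ T : Set ℚ, T.Finite ∧ ∀ x y : ℚ, y ≠ 0 → y ^ 2 = x * (x - e2) * (x - e3) →
      ∃ s1 ∈ T, ∃ s2 ∈ T, ∃ s3 ∈ T, ∃ r1 r2 r3 : ℚ, x = s1 * r1 ^ 2 ∧ x - e2 = s2 * r2 ^ 2 ∧
        x - e3 = s3 * r3 ^ 2 := by
  set N : ℤ := (e2 * e3 * (e2 - e3)) with hN
  have hN0 : N ≠ 0 := mul_ne_zero (mul_ne_zero h2 h3) (sub_ne_zero.2 h23)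
  have hD : {s : ℤ | s ∣ N * N * N}.Finite :=
    int_finite_dvd (mul_ne_zero (mul_ne_zero hN0 hN0) hN0)
  refine ⟨Set.image2 (fun a b : ℤ => (a : ℚ) / b) {s : ℤ | s ∣ N * N * N} {s : ℤ | s ∣ N * N * N},
    hD.image2 _ hD, ?_⟩
  intro x y hy hxy
  set p : ℤ := x.num with hp
  set d : ℤ := (x.den : ℤ) with hd
  have hd0 : d ≠ 0 := by rw [hd]; exact_mod_cast x.den_nz
  have hdq : (d : ℚ) ≠ 0 := by exact_mod_cast hd0
  have hxpd : x = p / d := by rw [hp, hd]; exact_mod_cast (Rat.num_div_den x).symm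
  have hcop : IsCoprime p d := by
    rw [Int.isCoprime_iff_gcd_eq_one]; exact x.reduced
  have hsq : ∃ z : ℤ, d * (p * (p - e2 * d) * (p - e3 * d)) = z ^ 2 := by
    have h1 : IsSquare ((d * (p * (p - e2 * d) * (p - e3 * d)) : ℤ) : ℚ) := by
      refine ⟨y * d ^ 2, ?_⟩
      push_cast
      have : y * d ^ 2 * (y * d ^ 2) = y ^ 2 * d ^ 4 := by ring
      rw [this, hxy, hxpd]
      field_simp
    rw [Rat.isSquare_intCast_iff] at h1
    obtain ⟨z, hz⟩ := h1
    exact ⟨z, by rw [hz]; ring⟩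
  obtain ⟨z, hz⟩ := hsq
  have hx0 : x ≠ 0 := by rintro rfl; apply hy; simpa using hxy
  have hx2 : x - e2 ≠ 0 := by intro h; apply hy; simpa [h] using hxy
  have hx3 : x - e3 ≠ 0 := by intro h; apply hy; simpa [h] using hxy
  have hu1 : p ≠ 0 := by intro h; apply hx0; rw [hxpd, h]; simp
  have hu2 : p - e2 * d ≠ 0 := by
    intro h; apply hx2; rw [hxpd]
    have : (p : ℚ) = e2 * d := by exact_mod_cast (sub_eq_zero.1 h)
    rw [this]; field_simp; ring
  have hu3 : p - e3 * d ≠ 0 := by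
    intro h; apply hx3; rw [hxpd]
    have : (p : ℚ) = e3 * d := by exact_mod_cast (sub_eq_zero.1 h)
    rw [this]; field_simp; ring
  -- gcds
  have g12 : (Int.gcd p (p - e2 * d) : ℤ) ∣ N := by
    refine (gcd_dvd_of_two (N := e2) hcop (gcd_dvd_of_comb e2 0 (by ring))
      (gcd_dvd_of_comb 1 (-1) (by ring))).trans ⟨e3 * (e2 - e3), by rw [hN]; ring⟩
  have g13 : (Int.gcd p (p - e3 * d) : ℤ) ∣ N := by
    refine (gcd_dvd_of_two (N := e3) hcop (gcd_dvd_of_comb e3 0 (by ring))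
      (gcd_dvd_of_comb 1 (-1) (by ring))).trans ⟨e2 * (e2 - e3), by rw [hN]; ring⟩
  have g23 : (Int.gcd (p - e2 * d) (p - e3 * d) : ℤ) ∣ N := by
    refine (gcd_dvd_of_two (N := e2 - e3) hcop (gcd_dvd_of_comb (-e3) (e2) (by ring))
      (gcd_dvd_of_comb (-1) (1) (by ring))).trans ⟨e2 * e3, by rw [hN]; ring⟩
  have gd1 : (Int.gcd p d : ℤ) ∣ N := by
    rw [Int.isCoprime_iff_gcd_eq_one.1 hcop]; exact one_dvd _
  have gd : ∀ e : ℤ, (Int.gcd (p - e * d) d : ℤ) ∣ N := by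
    intro e
    have : IsCoprime (p - e * d) d := by
      have := hcop.add_mul_right_left (-e)
      have e0 : p - e * d = p + -e * d := by ring
      rwa [e0]
    rw [Int.isCoprime_iff_gcd_eq_one.1 this]; exact one_dvd _
  have sw : ∀ {a b : ℤ}, (Int.gcd a b : ℤ) ∣ N → (Int.gcd b a : ℤ) ∣ N := by
    intro a b h; rwa [Int.gcd_comm]
  obtain ⟨sd, td, hsd, etd⟩ := int_mul_sq (u := d) (v := p * (p - e2 * d) * (p - e3 * d)) hd0 hz
    (int_gcd_mul_dvd (int_gcd_mul_dvd (sw gd1) (sw (gd e2))) (sw (gd e3)))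
  obtain ⟨s1, t1, hs1, et1⟩ := int_mul_sq (u := p) (v := d * (p - e2 * d) * (p - e3 * d)) hu1
    (by rw [← hz]; ring) (int_gcd_mul_dvd (int_gcd_mul_dvd gd1 g12) g13)
  obtain ⟨s2, t2, hs2, et2⟩ := int_mul_sq (u := p - e2 * d) (v := d * p * (p - e3 * d)) hu2
    (by rw [← hz]; ring) (int_gcd_mul_dvd (int_gcd_mul_dvd (gd e2) (sw g12)) g23)
  obtain ⟨s3, t3, hs3, et3⟩ := int_mul_sq (u := p - e3 * d) (v := d * p * (p - e2 * d)) hu3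
    (by rw [← hz]; ring) (int_gcd_mul_dvd (int_gcd_mul_dvd (gd e3) (sw g13)) (sw g23))
  have etd' : (d : ℚ) = sd * td ^ 2 := by exact_mod_cast etd
  have hne := hdq
  rw [etd'] at hne
  have hsd0 : (sd : ℚ) ≠ 0 := left_ne_zero_of_mul hne
  have htd0 : (td : ℚ) ≠ 0 := by
    have := right_ne_zero_of_mul hne; exact fun h => this (by rw [h]; simp)
  have key : ∀ (e u s t : ℤ), u = p - e * d → u = s * t ^ 2 → x - e = ((s:ℚ) / sd) * ((t : ℚ) / td) ^ 2 := by
    intro e u s t h1 h2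
    have h1' : (u : ℚ) = p - e * d := by exact_mod_cast h1
    have h2' : (u : ℚ) = s * t ^ 2 := by exact_mod_cast h2
    have : x - e = u / d := by rw [hxpd, h1']; field_simp
    rw [this, h2', etd']
    field_simp
  refine ⟨_, ⟨s1, hs1, sd, hsd, rfl⟩, _, ⟨s2, hs2, sd, hsd, rfl⟩, _, ⟨s3, hs3, sd, hsd, rfl⟩,
    t1 / td, t2 / td, t3 / td, ?_, key e2 _ _ _ rfl et2, key e3 _ _ _ rfl et3⟩
  have := key 0 p s1 t1 (by ring) et1
  simpa using this

/-- halving -/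
lemma EC_halve {a2 a4 : ℚ} (h4 : a4 ≠ 0) (hd : a2 ^ 2 - 4 * a4 ≠ 0) {f2 f3 : ℚ} (ha2 : a2 = -(f2 + f3)) (ha4 : a4 = f2 * f3)
    {x y : ℚ} (h : (EC a2 a4).Nonsingular x y) {t1 t2 t3 : ℚ} (h1 : x = t1 ^ 2) (h2 : x - f2 = t2 ^ 2)
    (h3 : x - f3 = t3 ^ 2) : ∃ R : (EC a2 a4).Point, Affine.Point.some x y h = 2 • R := by
  have hf2 : f2 = t1 ^ 2 - t2 ^ 2 := by linarith
  have hf3 : f3 = t1 ^ 2 - t3 ^ 2 := by linarith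
  have hy := EC_eq h
  have hy' : y ^ 2 = (t1 * t2 * t3) ^ 2 := by
    rw [hy, ha2, ha4, mul_pow, mul_pow, ← h1, ← h2, ← h3]; ring
  -- fix the sign of t1
  obtain ⟨t1, h1, hf2, hf3, hyt⟩ : ∃ t1', x = t1' ^ 2 ∧ f2 = t1' ^ 2 - t2 ^ 2 ∧ f3 = t1' ^ 2 - t3 ^ 2 ∧
      y = t1' * t2 * t3 := by
    rcases sq_eq_sq_iff_eq_or_eq_neg.1 hy' with e | e
    · exact ⟨t1, h1, hf2, hf3, e⟩
    · exact ⟨-t1, by rw [neg_sq, h1], by rw [neg_sq, hf2], by rw [neg_sq, hf3], by rw [e]; ring⟩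
  have n12 : f2 ≠ 0 := by rintro rfl; apply h4; rw [ha4]; ring
  have n13 : f3 ≠ 0 := by rintro rfl; apply h4; rw [ha4]; ring
  have n23 : f2 - f3 ≠ 0 := by
    intro hh; apply hd; rw [ha2, ha4]
    have : f2 = f3 := by linarith
    rw [this]; ring
  have m12 : t1 + t2 ≠ 0 := by
    intro hh; apply n12; rw [hf2]; linear_combination (t1 - t2) * hh
  have m13 : t1 + t3 ≠ 0 := by
    intro hh; apply n13; rw [hf3]; linear_combination (t1 - t3) * hh
  have m23 : t2 + t3 ≠ 0 := by
    intro hh; apply n23; rw [hf2, hf3]; linear_combination (t3 - t2) * hh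
  set xR := t1 ^ 2 + t1 * t2 + t1 * t3 + t2 * t3 with hxR
  set yR := -((t1 + t2) * (t1 + t3) * (t2 + t3)) with hyR
  have hyR0 : yR ≠ 0 := neg_ne_zero.2 (mul_ne_zero (mul_ne_zero m12 m13) m23)
  have hR : (EC a2 a4).Nonsingular xR yR := by
    apply EC_nonsingular h4 hd
    rw [hxR, hyR, ha2, ha4, hf2, hf3]; ring
  have hR' : (EC a2 a4).Nonsingular xR (-yR) := by
    apply EC_nonsingular h4 hd
    rw [hxR, hyR, ha2, ha4, hf2, hf3]; ring
  obtain ⟨h3', e3⟩ := EC_dbl hR hyR0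
  obtain ⟨h3'', e3'⟩ := EC_dbl hR' (neg_ne_zero.2 hyR0)
  have hxx : (xR ^ 2 - a4) ^ 2 / (4 * yR ^ 2) = x := by
    rw [div_eq_iff (mul_ne_zero (by norm_num) (pow_ne_zero 2 hyR0)), hxR, hyR, ha4, hf2, hf3, h1]; ring
  have := Affine.Point.X_eq_iff (h₁ := h) (h₂ := h3') |>.1 hxx.symm
  rcases this with e | e
  · exact ⟨_, by rw [two_smul, e3, e]⟩
  · exact ⟨-Affine.Point.some xR yR hR, by rw [two_smul, ← neg_add, e3, e]⟩

lemma EC_weakMW {a2 a4 : ℚ} (h2 : e2 ≠ 0) (h3 : e3 ≠ 0) (h23 : e2 ≠ e3)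
    (ha2 : a2 = -(e2 + e3)) (ha4 : a4 = e2 * e3) :
    ∃ R : Set (EC a2 a4).Point, R.Finite ∧ ∀ P, ∃ r ∈ R, ∃ z, P = r + 2 • z := by
  classical
  have h2' : (e2 : ℚ) ≠ 0 := by exact_mod_cast h2
  have h3' : (e3 : ℚ) ≠ 0 := by exact_mod_cast h3
  have h23' : (e2 : ℚ) - e3 ≠ 0 := by rw [sub_ne_zero]; exact_mod_cast h23
  have h4 : a4 ≠ 0 := by rw [ha4]; exact mul_ne_zero h2' h3'
  have hd : a2 ^ 2 - 4 * a4 ≠ 0 := by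
    rw [ha2, ha4]
    have : (-((e2 : ℚ) + e3)) ^ 2 - 4 * (e2 * e3) = (e2 - e3) ^ 2 := by ring
    rw [this]; exact pow_ne_zero 2 h23'
  have hfac : ∀ {x y : ℚ}, (EC a2 a4).Nonsingular x y → y ^ 2 = x * (x - e2) * (x - e3) := by
    intro x y h
    rw [EC_eq h, ha2, ha4]; ring
  obtain ⟨T, hT, hTc⟩ := sqclass_finite h2 h3 h23
  set good : (EC a2 a4).Point → ℚ × ℚ × ℚ → Prop := fun P s => ∃ x y h, P = Affine.Point.some x y h ∧ y ≠ 0 ∧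
    ∃ r1 r2 r3 : ℚ, x = s.1 * r1 ^ 2 ∧ x - e2 = s.2.1 * r2 ^ 2 ∧ x - e3 = s.2.2 * r3 ^ 2 with hgood
  set rep : ℚ × ℚ × ℚ → (EC a2 a4).Point := fun s => if h : ∃ P, good P s then h.choose else 0 with hrep
  have hreps : ∀ P s, good P s → good (rep s) s := by
    intro P s h
    have hex : ∃ P, good P s := ⟨P, h⟩
    simp only [hrep, dif_pos hex]
    exact hex.choose_spec
  set B : ℝ := logHeight₁ (0 : ℚ) + logHeight₁ (e2 : ℚ) + logHeight₁ (e3 : ℚ) with hB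
  have hTT : (T ×ˢ T ×ˢ T).Finite := hT.prod (hT.prod hT)
  refine ⟨{0} ∪ {P | nh P ≤ B} ∪ rep '' (T ×ˢ T ×ˢ T) ∪ (fun s => - rep s) '' (T ×ˢ T ×ˢ T),
    (((Set.finite_singleton _).union (nh_northcott B)).union (hTT.image _)).union (hTT.image _), ?_⟩
  intro P
  rcases P with _ | ⟨x, y, h⟩
  · exact ⟨0, by simp, 0, by rw [nsmul_zero, add_zero]; rfl⟩
  by_cases hy : y = 0
  · refine ⟨_, Or.inl (Or.inl (Or.inr ?_)), 0, by rw [nsmul_zero, add_zero]⟩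
    rw [Set.mem_ofPred_eq, nh_some]
    have := hfac h
    rw [hy, zero_pow two_ne_zero, eq_comm, mul_eq_zero, mul_eq_zero] at this
    have n1 := zero_le_logHeight₁ (0 : ℚ)
    have n2 := zero_le_logHeight₁ (e2 : ℚ)
    have n3 := zero_le_logHeight₁ (e3 : ℚ)
    rcases this with (e | e) | e
    · rw [e]; linarith
    · rw [sub_eq_zero.1 e]; linarith
    · rw [sub_eq_zero.1 e]; linarith
  obtain ⟨s1, hs1, s2, hs2, s3, hs3, r1, r2, r3, q1, q2, q3⟩ := hTc x y hy (hfac h)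
  have hs : (s1, s2, s3) ∈ T ×ˢ T ×ˢ T := ⟨hs1, hs2, hs3⟩
  obtain ⟨x', y', h', e', hy', r1', r2', r3', q1', q2', q3'⟩ := hreps _ (s1, s2, s3)
    ⟨x, y, h, rfl, hy, r1, r2, r3, q1, q2, q3⟩
  simp only at q1' q2' q3'
  by_cases hx : x = x'
  · rcases Affine.Point.X_eq_iff (h₁ := h) (h₂ := h') |>.1 hx with e | e
    · refine ⟨_, Or.inl (Or.inr ⟨_, hs, rfl⟩), 0, ?_⟩
      rw [nsmul_zero, add_zero, e', e]
    · refine ⟨_, Or.inr ⟨_, hs, rfl⟩, 0, ?_⟩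
      simp only
      rw [nsmul_zero, add_zero, e', e]
  · refine ⟨_, Or.inr ⟨_, hs, rfl⟩, ?_⟩
    obtain ⟨y₃, h₃', e₃'⟩ := EC_add h h' hx
    have hx' : x - x' ≠ 0 := sub_ne_zero.2 hx
    obtain ⟨X3, hX3⟩ : ∃ X3, X3 = ((x * x' + a4) * (x + x') + 2 * a2 * x * x' - 2 * y * y') / (x - x') ^ 2 := ⟨_, rfl⟩
    obtain ⟨h₃, e₃⟩ := some_congr h₃' hX3.symm rfl
    rw [← e₃'] at e₃
    have f1 := hfac h
    have f2 := hfac h'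
    have z1 : x ≠ 0 := by rintro rfl; apply hy; simpa using f1
    have z2 : x - e2 ≠ 0 := by intro h; apply hy; simpa [h] using f1
    have z3 : x - e3 ≠ 0 := by intro h; apply hy; simpa [h] using f1
    have z1' : x' ≠ 0 := by rintro rfl; apply hy'; simpa using f2
    have z2' : x' - e2 ≠ 0 := by intro h; apply hy'; simpa [h] using f2
    have z3' : x' - e3 ≠ 0 := by intro h; apply hy'; simpa [h] using f2
    have key : ∀ (e s r r' : ℚ), e = 0 ∨ e = e2 ∨ e = e3 → x - e ≠ 0 → x' - e ≠ 0 → x - e = s * r ^ 2 →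
        x' - e = s * r' ^ 2 →
        X3 - e = (((x - e) * y' - (x' - e) * y) / ((x - x') * (s * r * r'))) ^ 2 := by
      intro e s r r' he hxe hxe' hr hr'
      have hne := hxe
      have hne' := hxe'
      rw [hr] at hne
      rw [hr'] at hne'
      have hs0 : s ≠ 0 := left_ne_zero_of_mul hne
      have hr0 : r ≠ 0 := by have := right_ne_zero_of_mul hne; exact fun h => this (by rw [h]; simp)
      have hr0' : r' ≠ 0 := by have := right_ne_zero_of_mul hne'; exact fun h => this (by rw [h]; simp)
      have hprod : (s * r * r') ^ 2 = (x - e) * (x' - e) := by rw [hr, hr']; ring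
      rw [div_pow, mul_pow, hprod, hX3, eq_div_iff (mul_ne_zero (pow_ne_zero 2 hx') (mul_ne_zero hxe hxe')), ha2, ha4]
      field_simp
      rcases he with rfl | rfl | rfl
      · linear_combination (-(x' - 0)^2) * f1 - (x - 0)^2 * f2
      · linear_combination (-(x' - e2)^2) * f1 - (x - e2)^2 * f2
      · linear_combination (-(x' - e3)^2) * f1 - (x - e3)^2 * f2
    have k1 := key 0 s1 r1 r1' (by simp) (by simpa using z1) (by simpa using z1') (by simpa using q1) (by simpa using q1')
    have k2 := key e2 s2 r2 r2' (by simp) z2 z2' q2 q2'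
    have k3 := key e3 s3 r3 r3' (by simp) z3 z3' q3 q3'
    rw [sub_zero] at k1
    obtain ⟨R, hR⟩ := EC_halve h4 hd ha2 ha4 h₃ k1 k2 k3
    refine ⟨R, ?_⟩
    simp only
    rw [← hR, ← e₃, e']
    abel

end

end PartP3b

section PartP4

/-- parameters -/
structure Prm where
  t : ℤ
  t' : ℤ
  b : ℤ
  δ : ℤ

/-- doubling on triples -/
def dup {A : Type*} [CommRing A] (a2 a4 : A) (s : A × A × A) : A × A × A :=
  ((s.1 ^ 2 - a4 * s.2.1 ^ 2) ^ 2,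
   4 * s.1 * s.2.1 * (s.1 ^ 2 + a2 * s.1 * s.2.1 + a4 * s.2.1 ^ 2),
   2 * s.2.2 * (s.1 ^ 2 - a4 * s.2.1 ^ 2) * (s.1 ^ 4 + 2 * a2 * s.1 ^ 3 * s.2.1 +
    6 * a4 * s.1 ^ 2 * s.2.1 ^ 2 + 2 * a2 * a4 * s.1 * s.2.1 ^ 3 + a4 ^ 2 * s.2.1 ^ 4))

/-- cubic form -/
def cub {A : Type*} [CommRing A] (a2 a4 : A) (α β : A) : A :=
  α * β * (α ^ 2 + a2 * α * β + a4 * β ^ 2)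

def KB {A : Type*} [CommRing A] (α β α' β' : A) : A := (α * β' - α' * β) ^ 2
def KC {A : Type*} [CommRing A] (a4 α β α' β' : A) : A := (α * α' - a4 * β * β') ^ 2
def KS {A : Type*} [CommRing A] (a2 a4 α β α' β' : A) : A :=
  (α * α' + a4 * β * β') * (α * β' + α' * β) + 2 * a2 * α * α' * β * β'

lemma Kummer_rel {A : Type*} [CommRing A] (a2 a4 α β α' β' : A) :
    KS a2 a4 α β α' β' ^ 2 - 4 * (cub a2 a4 α β * cub a2 a4 α' β') =
      KB α β α' β' * KC a4 α β α' β' := by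
  unfold KS KB KC cub; ring

lemma dup_inv {A : Type*} [CommRing A] (a2 a4 F : A) (s : A × A × A)
    (h : F * s.2.2 ^ 2 = cub a2 a4 s.1 s.2.1) :
    F * (dup a2 a4 s).2.2 ^ 2 = cub a2 a4 (dup a2 a4 s).1 (dup a2 a4 s).2.1 := by
  obtain ⟨α, β, ρ⟩ := s
  simp only [dup, cub] at *
  linear_combination (4 * (α ^ 2 - a4 * β ^ 2) ^ 2 * (α ^ 4 + 2 * a2 * α ^ 3 * β +
    6 * a4 * α ^ 2 * β ^ 2 + 2 * a2 * a4 * α * β ^ 3 + a4 ^ 2 * β ^ 4) ^ 2) * h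

lemma dup_map {A B : Type*} [CommRing A] [CommRing B] (φ : A →+* B) (a2 a4 : A) (s : A × A × A) :
    Prod.map φ (Prod.map φ φ) (dup a2 a4 s) = dup (φ a2) (φ a4) (Prod.map φ (Prod.map φ φ) s) := by
  simp [dup, map_ofNat]

lemma dup_map_iter {A B : Type*} [CommRing A] [CommRing B] (φ : A →+* B) (a2 a4 : A) (s : A × A × A) (k : ℕ) :
    Prod.map φ (Prod.map φ φ) ((dup a2 a4)^[k] s) =
      (dup (φ a2) (φ a4))^[k] (Prod.map φ (Prod.map φ φ) s) := by
  induction k with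
  | zero => rfl
  | succ k ih => rw [Function.iterate_succ_apply', Function.iterate_succ_apply', dup_map, ih]

namespace Prm
variable (p : Prm) {A A' : Type*} [CommRing A] [CommRing A']

def T : ℤ := p.t - p.t'
def κ : ℤ := p.b + p.T ^ 2
def a2 : ℤ := -p.δ * (p.T ^ 2 + p.κ)
def a4 : ℤ := p.δ ^ 2 * p.T ^ 2 * p.κ
def m (x : A) : A := x - p.t - p.t'
def q1 (x : A) : A := (x - 2 * p.t) ^ 2 + p.b
def q2 (x : A) : A := (x - 2 * p.t') ^ 2 + p.b
def F (x : A) : A := p.δ * p.q1 x * p.q2 x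
def s0 (x : A) : A × A × A :=
  (p.δ * p.T ^ 2 * (p.m x ^ 2 - p.κ) ^ 2, p.q1 x * p.q2 x,
    2 * p.b * p.δ * p.T ^ 2 * p.m x * (p.m x ^ 4 - p.κ ^ 2))
def sk (k : ℕ) (x : A) : A × A × A := (dup (p.a2 : A) (p.a4 : A))^[k] (p.s0 x)

lemma s0_inv (x : A) : p.F x * (p.s0 x).2.2 ^ 2 = cub (p.a2 : A) (p.a4 : A) (p.s0 x).1 (p.s0 x).2.1 := by
  simp only [F, s0, cub, a2, a4, κ, T, m, q1, q2]
  push_cast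
  ring

lemma sk_inv (k : ℕ) (x : A) :
    p.F x * (p.sk k x).2.2 ^ 2 = cub (p.a2 : A) (p.a4 : A) (p.sk k x).1 (p.sk k x).2.1 := by
  induction k with
  | zero => exact p.s0_inv x
  | succ k ih =>
    simp only [sk] at *
    rw [Function.iterate_succ_apply']
    exact dup_inv _ _ _ _ ih

lemma map_F (φ : A →+* A') (x : A) : φ (p.F x) = p.F (φ x) := by
  simp [F, q1, q2, map_ofNat]

lemma map_s0 (φ : A →+* A') (x : A) : Prod.map φ (Prod.map φ φ) (p.s0 x) = p.s0 (φ x) := by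
  simp [s0, q1, q2, m, map_ofNat]

lemma map_sk (φ : A →+* A') (k : ℕ) (x : A) : Prod.map φ (Prod.map φ φ) (p.sk k x) = p.sk k (φ x) := by
  rw [sk, dup_map_iter, map_s0, map_intCast, map_intCast, sk]

lemma map_sk1 (φ : A →+* A') (k : ℕ) (x : A) : φ (p.sk k x).1 = (p.sk k (φ x)).1 := by
  rw [← map_sk]; rfl
lemma map_sk2 (φ : A →+* A') (k : ℕ) (x : A) : φ (p.sk k x).2.1 = (p.sk k (φ x)).2.1 := by
  rw [← map_sk]; rfl
lemma map_sk3 (φ : A →+* A') (k : ℕ) (x : A) : φ (p.sk k x).2.2 = (p.sk k (φ x)).2.2 := by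
  rw [← map_sk]; rfl

/-- Kummer forms for (2^k P, Q), P ↔ x, Q ↔ y, W ↔ ω(x)ω(y) -/
def B (k : ℕ) (x y : A) : A := KB (p.sk k x).1 (p.sk k x).2.1 (p.sk 0 y).1 (p.sk 0 y).2.1
def C (k : ℕ) (x y : A) : A := KC (p.a4 : A) (p.sk k x).1 (p.sk k x).2.1 (p.sk 0 y).1 (p.sk 0 y).2.1
def S (k : ℕ) (x y : A) : A :=
  KS (p.a2 : A) (p.a4 : A) (p.sk k x).1 (p.sk k x).2.1 (p.sk 0 y).1 (p.sk 0 y).2.1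
/-- `2 η η'` without W -/
def R (k : ℕ) (x y : A) : A := 2 * (p.sk k x).2.2 * (p.sk 0 y).2.2

lemma map_B (φ : A →+* A') (k : ℕ) (x y : A) : φ (p.B k x y) = p.B k (φ x) (φ y) := by
  simp only [Prm.B, KB, map_pow, map_sub, map_mul, map_sk1, map_sk2]
lemma map_C (φ : A →+* A') (k : ℕ) (x y : A) : φ (p.C k x y) = p.C k (φ x) (φ y) := by
  simp only [Prm.C, KC, map_pow, map_sub, map_mul, map_sk1, map_sk2, map_intCast]
lemma map_S (φ : A →+* A') (k : ℕ) (x y : A) : φ (p.S k x y) = p.S k (φ x) (φ y) := by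
  simp only [Prm.S, KS, map_add, map_mul, map_sk1, map_sk2, map_intCast, map_ofNat]
lemma map_R (φ : A →+* A') (k : ℕ) (x y : A) : φ (p.R k x y) = p.R k (φ x) (φ y) := by
  simp only [Prm.R, map_mul, map_sk3, map_ofNat]

/-- (S + R W)(S - R W) = B C -/
lemma APM (k : ℕ) (x y W : A) (hW : W * W = p.F x * p.F y) :
    (p.S k x y + p.R k x y * W) * (p.S k x y - p.R k x y * W) = p.B k x y * p.C k x y := by
  have h1 := p.sk_inv k x
  have h2 := p.sk_inv 0 y
  have h3 := Kummer_rel (p.a2 : A) (p.a4 : A) (p.sk k x).1 (p.sk k x).2.1 (p.sk 0 y).1 (p.sk 0 y).2.1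
  rw [← h1, ← h2] at h3
  simp only [Prm.S, Prm.R, Prm.B, Prm.C]
  linear_combination h3 - 4 * (p.sk k x).2.2 ^ 2 * (p.sk 0 y).2.2 ^ 2 * hW

end Prm

end PartP4

section PartP4b

section snb
variable {A : Type*} [CommRing A] {ν : RingSeminorm A}

lemma sn_add {a b : A} {x y : ℝ} (ha : ν a ≤ x) (hb : ν b ≤ y) : ν (a + b) ≤ x + y :=
  (map_add_le_add ν a b).trans (add_le_add ha hb)
lemma sn_sub {a b : A} {x y : ℝ} (ha : ν a ≤ x) (hb : ν b ≤ y) : ν (a - b) ≤ x + y :=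
  (map_sub_le_add ν a b).trans (add_le_add ha hb)
lemma sn_mul {a b : A} {x y : ℝ} (ha : ν a ≤ x) (hb : ν b ≤ y) : ν (a * b) ≤ x * y :=
  (map_mul_le_mul ν a b).trans (mul_le_mul ha hb (apply_nonneg ν _) ((apply_nonneg ν _).trans ha))
lemma sn_pow (h1 : ν 1 ≤ 1) {a : A} {x : ℝ} (ha : ν a ≤ x) (n : ℕ) : ν (a ^ n) ≤ x ^ n :=
  (seminorm_pow_le ν h1 a n).trans (pow_le_pow_left₀ (apply_nonneg ν _) ha n)
lemma sn_nat (h1 : ν 1 ≤ 1) (n : ℕ) : ν (n : A) ≤ n := by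
  induction n with
  | zero => simp
  | succ n ih => push_cast; exact sn_add ih h1
lemma sn_int (h1 : ν 1 ≤ 1) (n : ℤ) : ν (n : A) ≤ |(n : ℝ)| := by
  obtain ⟨k, rfl | rfl⟩ := n.eq_nat_or_neg
  · simpa using sn_nat h1 k
  · simpa using sn_nat h1 k
end snb

namespace Prm

lemma s0_bound (p : Prm) : ∃ C0 : ℝ, 1 ≤ C0 ∧ ∀ (A : Type) [CommRing A] (ν : RingSeminorm A) (x : A) (r : ℝ),
    ν 1 ≤ 1 → 1 ≤ r → ν x ≤ r → ν (p.s0 x).1 ≤ C0 * r ^ 4 ∧ ν (p.s0 x).2.1 ≤ C0 * r ^ 4 ∧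
      ν (p.s0 x).2.2 ≤ C0 * r ^ 6 ∧ ν (p.F x) ≤ C0 * r ^ 4 := by
  obtain ⟨D, hD⟩ : ∃ D : ℝ, D = 1 + 2 * |(p.t : ℝ)| + 2 * |(p.t' : ℝ)| + |(p.b : ℝ)| + |(p.κ : ℝ)| := ⟨_, rfl⟩
  obtain ⟨E, hE⟩ : ∃ E : ℝ, E = 1 + |(p.δ : ℝ)| + |(p.δ : ℝ)| * |(p.T : ℝ)| ^ 2 +
    2 * |(p.b : ℝ)| * |(p.δ : ℝ)| * |(p.T : ℝ)| ^ 2 := ⟨_, rfl⟩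
  have n1 := abs_nonneg (p.t : ℝ)
  have n2 := abs_nonneg (p.t' : ℝ)
  have n3 := abs_nonneg (p.b : ℝ)
  have n4 := abs_nonneg (p.κ : ℝ)
  have n5 := abs_nonneg (p.δ : ℝ)
  have n6 : 0 ≤ |(p.δ : ℝ)| * |(p.T : ℝ)| ^ 2 := by positivity
  have n7 : 0 ≤ 2 * |(p.b : ℝ)| * |(p.δ : ℝ)| * |(p.T : ℝ)| ^ 2 := by positivity
  have hD1 : 1 ≤ D := by linarith
  have hE1 : 1 ≤ E := by linarith
  have hD6 : 1 ≤ D ^ 6 := one_le_pow₀ hD1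
  refine ⟨E * (4 * D ^ 6), ?_, ?_⟩
  · exact one_le_mul_of_one_le_of_one_le hE1 (by linarith)
  intro A _ ν x r h1 hr hx
  have e2 : ν (2 : A) ≤ 2 := by simpa using sn_nat (ν := ν) h1 2
  have hDr : D ≤ D * r := by nlinarith
  have hD0 : 0 < D := by linarith
  have hr0 : 0 < r := by linarith
  have rr : ∀ (z : ℝ), 0 ≤ z → r + z ≤ (1 + z) * r := by intro z hz; nlinarith
  have hDr1 : 1 ≤ D * r := by nlinarith
  have b1 : ν (x - 2 * p.t) ≤ D * r := by
    refine (sn_sub hx (sn_mul e2 (sn_int h1 _))).trans ((rr _ (by positivity)).trans ?_)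
    apply mul_le_mul_of_nonneg_right _ hr0.le; linarith
  have b2 : ν (x - 2 * p.t') ≤ D * r := by
    refine (sn_sub hx (sn_mul e2 (sn_int h1 _))).trans ((rr _ (by positivity)).trans ?_)
    apply mul_le_mul_of_nonneg_right _ hr0.le; linarith
  have bm : ν (p.m x) ≤ D * r := by
    refine (sn_sub (sn_sub hx (sn_int h1 _)) (sn_int h1 _)).trans ?_
    rw [add_assoc]
    refine ((rr _ (by positivity)).trans ?_)
    apply mul_le_mul_of_nonneg_right _ hr0.le; linarith
  have hsq : D ≤ (D * r) ^ 2 := by nlinarith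
  have q1b : ν (p.q1 x) ≤ 2 * (D * r) ^ 2 := by
    refine (sn_add (sn_pow h1 b1 2) (sn_int h1 _)).trans ?_; linarith
  have q2b : ν (p.q2 x) ≤ 2 * (D * r) ^ 2 := by
    refine (sn_add (sn_pow h1 b2 2) (sn_int h1 _)).trans ?_; linarith
  have mb : ν (p.m x ^ 2 - p.κ) ≤ 2 * (D * r) ^ 2 := by
    refine (sn_sub (sn_pow h1 bm 2) (sn_int h1 _)).trans ?_; linarith
  have kb : |(p.κ : ℝ)| ^ 2 ≤ (D * r) ^ 4 := by
    have : |(p.κ : ℝ)| ≤ (D * r) ^ 2 := by linarith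
    calc |(p.κ : ℝ)| ^ 2 ≤ ((D * r) ^ 2) ^ 2 := by gcongr
      _ = _ := by ring
  have mb4 : ν (p.m x ^ 4 - p.κ ^ 2) ≤ 2 * (D * r) ^ 4 := by
    refine (sn_sub (sn_pow h1 bm 4) (sn_pow h1 (sn_int h1 _) 2)).trans ?_; linarith
  have hD46 : D ^ 4 ≤ D ^ 6 := pow_le_pow_right₀ hD1 (by norm_num)
  have hD56 : D ^ 5 ≤ D ^ 6 := pow_le_pow_right₀ hD1 (by norm_num)
  have hr56 : r ^ 5 ≤ r ^ 6 := pow_le_pow_right₀ hr (by norm_num)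
  refine ⟨?_, ?_, ?_, ?_⟩
  · refine (sn_mul (sn_mul (sn_int h1 _) (sn_pow h1 (sn_int h1 _) 2)) (sn_pow h1 mb 2)).trans ?_
    calc |(p.δ : ℝ)| * |(p.T : ℝ)| ^ 2 * (2 * (D * r) ^ 2) ^ 2
        = |(p.δ : ℝ)| * |(p.T : ℝ)| ^ 2 * (4 * D ^ 4) * r ^ 4 := by ring
      _ ≤ E * (4 * D ^ 6) * r ^ 4 := by gcongr; linarith
  · refine (sn_mul q1b q2b).trans ?_
    calc 2 * (D * r) ^ 2 * (2 * (D * r) ^ 2)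
        = 1 * (4 * D ^ 4) * r ^ 4 := by ring
      _ ≤ E * (4 * D ^ 6) * r ^ 4 := by gcongr
  · refine (sn_mul (sn_mul (sn_mul (sn_mul (sn_mul e2 (sn_int h1 _)) (sn_int h1 _))
      (sn_pow h1 (sn_int h1 _) 2)) bm) mb4).trans ?_
    calc 2 * |(p.b : ℝ)| * |(p.δ : ℝ)| * |(p.T : ℝ)| ^ 2 * (D * r) * (2 * (D * r) ^ 4)
        = 2 * |(p.b : ℝ)| * |(p.δ : ℝ)| * |(p.T : ℝ)| ^ 2 * (2 * D ^ 5) * r ^ 5 := by ring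
      _ ≤ E * (4 * D ^ 6) * r ^ 6 := by gcongr <;> linarith
  · refine (sn_mul (sn_mul (sn_int h1 _) q1b) q2b).trans ?_
    calc |(p.δ : ℝ)| * (2 * (D * r) ^ 2) * (2 * (D * r) ^ 2)
        = |(p.δ : ℝ)| * (4 * D ^ 4) * r ^ 4 := by ring
      _ ≤ E * (4 * D ^ 6) * r ^ 4 := by gcongr; linarith

lemma sk_bound (p : Prm) : ∃ L : ℝ, 1 ≤ L ∧ ∀ (A : Type) [CommRing A] (ν : RingSeminorm A) (x : A) (r : ℝ),
    ν 1 ≤ 1 → 1 ≤ r → ν x ≤ r → (∀ k : ℕ, ν (p.sk k x).1 ≤ (L * r ^ 4) ^ 4 ^ k ∧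
      ν (p.sk k x).2.1 ≤ (L * r ^ 4) ^ 4 ^ k ∧
      r ^ 2 * ν (p.sk k x).2.2 ≤ ((L * r ^ 4) ^ 4 ^ k) ^ 2) ∧ ν (p.F x) ≤ L * r ^ 4 := by
  obtain ⟨C0, hC0, hb⟩ := p.s0_bound
  obtain ⟨s, hs⟩ : ∃ s : ℝ, s = 1 + |(p.a2 : ℝ)| + |(p.a4 : ℝ)| := ⟨_, rfl⟩
  obtain ⟨K, hK⟩ : ∃ K : ℝ, K = 4 * s ^ 2 := ⟨_, rfl⟩
  have n2 := abs_nonneg (p.a2 : ℝ)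
  have n4 := abs_nonneg (p.a4 : ℝ)
  have hs1 : 1 ≤ s := by linarith
  have hs2 : s ≤ s ^ 2 := by nlinarith
  have hK1 : 1 ≤ K := by nlinarith
  have hK0 : 0 < K := by linarith
  refine ⟨K * C0, by nlinarith, ?_⟩
  intro A _ ν x r h1 hr hx
  obtain ⟨g1, g2, g3, g4⟩ := hb A ν x r h1 hr hx
  have hr0 : 0 < r := by linarith
  have e2 : ν (2 : A) ≤ 2 := by simpa using sn_nat (ν := ν) h1 2
  have e4 : ν (4 : A) ≤ 4 := by simpa using sn_nat (ν := ν) h1 4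
  have e6 : ν (6 : A) ≤ 6 := by simpa using sn_nat (ν := ν) h1 6
  have ha2 : ν (p.a2 : A) ≤ s := (sn_int h1 _).trans (by linarith)
  have ha4 : ν (p.a4 : A) ≤ s := (sn_int h1 _).trans (by linarith)
  have hCr : C0 * r ^ 4 ≤ K * C0 * r ^ 4 := by
    have : 0 ≤ C0 * r ^ 4 := by positivity
    nlinarith
  constructor
  swap
  · exact g4.trans hCr
  suffices h : ∀ k : ℕ, ν (p.sk k x).1 ≤ (K * C0 * r ^ 4) ^ 4 ^ k / K ∧
      ν (p.sk k x).2.1 ≤ (K * C0 * r ^ 4) ^ 4 ^ k / K ∧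
      r ^ 2 * ν (p.sk k x).2.2 ≤ ((K * C0 * r ^ 4) ^ 4 ^ k) ^ 2 by
    intro k
    obtain ⟨f1, f2, f3⟩ := h k
    have : (K * C0 * r ^ 4) ^ 4 ^ k / K ≤ (K * C0 * r ^ 4) ^ 4 ^ k :=
      div_le_self (by positivity) hK1
    exact ⟨f1.trans this, f2.trans this, f3⟩
  intro k
  induction k with
  | zero =>
    have e : (K * C0 * r ^ 4) ^ 4 ^ 0 / K = C0 * r ^ 4 := by
      rw [pow_zero, pow_one]; field_simp
    refine ⟨by rw [e]; exact g1, by rw [e]; exact g2, ?_⟩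
    calc r ^ 2 * ν (p.sk 0 x).2.2 ≤ r ^ 2 * (C0 * r ^ 6) := by
          apply mul_le_mul_of_nonneg_left g3; positivity
      _ = 1 * 1 * C0 * r ^ 8 := by ring
      _ ≤ K ^ 2 * C0 * C0 * r ^ 8 := by
          have : (1:ℝ) ≤ K ^ 2 := one_le_pow₀ hK1
          have : C0 ≤ C0 * C0 := by nlinarith
          calc 1 * 1 * C0 * r ^ 8 = 1 * C0 * r ^ 8 := by ring
            _ ≤ K ^ 2 * (C0 * C0) * r ^ 8 := by gcongr
            _ = _ := by ring
      _ = _ := by ring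
  | succ k ih =>
    obtain ⟨f1, f2, f3⟩ := ih
    have hst : p.sk (k + 1) x = dup (p.a2 : A) (p.a4 : A) (p.sk k x) := by
      simp only [sk]; rw [Function.iterate_succ_apply']
    rw [hst, pow_succ 4 k, pow_mul]
    have hM0 : 0 ≤ (K * C0 * r ^ 4) ^ 4 ^ k := by positivity
    generalize (K * C0 * r ^ 4) ^ 4 ^ k = M at *
    set α := (p.sk k x).1
    set β := (p.sk k x).2.1
    set ρ := (p.sk k x).2.2
    obtain ⟨m, hm⟩ : ∃ m, m = M / K := ⟨_, rfl⟩
    rw [← hm] at f1 f2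
    have hm0 : 0 ≤ m := by rw [hm]; positivity
    have hMm : M = K * m := by rw [hm]; field_simp
    have c1 : ν (α ^ 2 - p.a4 * β ^ 2) ≤ 2 * s * m ^ 2 := by
      refine (sn_sub (sn_pow h1 f1 2) (sn_mul ha4 (sn_pow h1 f2 2))).trans ?_
      have : 0 ≤ m ^ 2 := by positivity
      nlinarith
    have hs4 : s ^ 2 ≤ s ^ 4 := pow_le_pow_right₀ hs1 (by norm_num)
    have hs6 : s ^ 2 ≤ s ^ 6 := pow_le_pow_right₀ hs1 (by norm_num)
    have hs12 : s ^ 3 ≤ s ^ 12 := pow_le_pow_right₀ hs1 (by norm_num)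
    have hs61 : s ≤ s ^ 6 := le_self_pow₀ hs1 (by norm_num)
    have hs16 : (1:ℝ) ≤ s ^ 6 := one_le_pow₀ hs1
    refine ⟨?_, ?_, ?_⟩
    · refine (sn_pow h1 c1 2).trans ?_
      rw [hMm, le_div_iff₀ hK0]
      calc (2 * s * m ^ 2) ^ 2 * K = (16 * s ^ 4) * m ^ 4 := by rw [hK]; ring
        _ ≤ (256 * s ^ 8) * m ^ 4 := by
            gcongr
            · norm_num
            · norm_num
        _ = (K * m) ^ 4 := by rw [hK]; ring
    · refine (sn_mul (sn_mul (sn_mul e4 f1) f2) (sn_add (sn_add (sn_pow h1 f1 2) (sn_mul (sn_mul ha2 f1) f2))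
        (sn_mul ha4 (sn_pow h1 f2 2)))).trans ?_
      rw [hMm, le_div_iff₀ hK0]
      calc 4 * m * m * (m ^ 2 + s * m * m + s * m ^ 2) * K = ((16 * s ^ 2) * (1 + s + s)) * m ^ 4 := by rw [hK]; ring
        _ ≤ ((16 * s ^ 2) * (s ^ 6 + s ^ 6 + s ^ 6)) * m ^ 4 := by gcongr
        _ ≤ (256 * s ^ 8) * m ^ 4 := by
            have : 0 ≤ s ^ 8 * m ^ 4 := by positivity
            nlinarith
        _ = (K * m) ^ 4 := by rw [hK]; ring
    · have c2 : ν (α ^ 4 + 2 * p.a2 * α ^ 3 * β + 6 * p.a4 * α ^ 2 * β ^ 2 + 2 * p.a2 * p.a4 * α * β ^ 3 +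
          p.a4 ^ 2 * β ^ 4) ≤ 12 * s ^ 2 * m ^ 4 := by
        refine (sn_add (sn_add (sn_add (sn_add (sn_pow h1 f1 4)
          (sn_mul (sn_mul (sn_mul e2 ha2) (sn_pow h1 f1 3)) f2))
          (sn_mul (sn_mul (sn_mul e6 ha4) (sn_pow h1 f1 2)) (sn_pow h1 f2 2)))
          (sn_mul (sn_mul (sn_mul (sn_mul e2 ha2) ha4) f1) (sn_pow h1 f2 3)))
          (sn_mul (sn_pow h1 ha4 2) (sn_pow h1 f2 4))).trans ?_
        calc _ = (1 + 2 * s + 6 * s + 2 * s ^ 2 + s ^ 2) * m ^ 4 := by ring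
          _ ≤ 12 * s ^ 2 * m ^ 4 := by
            apply mul_le_mul_of_nonneg_right _ (by positivity)
            nlinarith
      have c3 : ν (dup (p.a2 : A) (p.a4 : A) (p.sk k x)).2.2 ≤ 2 * ν ρ * (2 * s * m ^ 2) * (12 * s ^ 2 * m ^ 4) :=
        sn_mul (sn_mul (sn_mul e2 le_rfl) c1) c2
      calc r ^ 2 * ν (dup (p.a2 : A) (p.a4 : A) (p.sk k x)).2.2
          ≤ r ^ 2 * (2 * ν ρ * (2 * s * m ^ 2) * (12 * s ^ 2 * m ^ 4)) := by gcongr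
        _ = (r ^ 2 * ν ρ) * (48 * s ^ 3 * m ^ 6) := by ring
        _ ≤ M ^ 2 * (48 * s ^ 12 * m ^ 6) := by gcongr
        _ ≤ M ^ 2 * (4096 * s ^ 12 * m ^ 6) := by gcongr; norm_num
        _ = (M ^ 4) ^ 2 := by rw [hMm, hK]; ring

end Prm

end PartP4b

section PartP4c

namespace Prm

lemma kum_bound (p : Prm) : ∃ L : ℝ, 1 ≤ L ∧ ∀ (A : Type) [CommRing A] (ν : RingSeminorm A) (x y : A) (r r' : ℝ),
    ν 1 ≤ 1 → 1 ≤ r → ν x ≤ r → 1 ≤ r' → ν y ≤ r' → ∀ k : ℕ,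
      ν (p.B k x y) ≤ (L * r ^ 8) ^ 4 ^ k * r' ^ 8 ∧
      ν (p.C k x y) ≤ (L * r ^ 8) ^ 4 ^ k * r' ^ 8 ∧
      ν (p.S k x y) ≤ (L * r ^ 8) ^ 4 ^ k * r' ^ 8 ∧
      r ^ 2 * r' ^ 2 * ν (p.R k x y) ≤ (L * r ^ 8) ^ 4 ^ k * r' ^ 8 ∧
      ν (p.F x) ≤ L * r ^ 4 ∧ ν (p.F y) ≤ L * r' ^ 4 := by
  obtain ⟨L, hL, hb⟩ := p.sk_bound
  obtain ⟨s, hs⟩ : ∃ s : ℝ, s = 1 + |(p.a2 : ℝ)| + |(p.a4 : ℝ)| := ⟨_, rfl⟩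
  have n2 := abs_nonneg (p.a2 : ℝ)
  have n4 := abs_nonneg (p.a4 : ℝ)
  have hs1 : 1 ≤ s := by linarith
  have hs2 : s ≤ s ^ 2 := by nlinarith
  have hL4 : L ≤ L ^ 4 := le_self_pow₀ hL (by norm_num)
  have hs20 : 1 ≤ 6 * s ^ 2 := by nlinarith
  have hLL : L ≤ 6 * s ^ 2 * L ^ 4 := by
    have : 0 ≤ L ^ 4 := by positivity
    nlinarith
  refine ⟨6 * s ^ 2 * L ^ 4, hL.trans hLL, ?_⟩
  intro A _ ν x y r r' h1 hr hx hr' hy k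
  obtain ⟨hk, hF⟩ := hb A ν x r h1 hr hx
  obtain ⟨h0, hF'⟩ := hb A ν y r' h1 hr' hy
  obtain ⟨f1, f2, f3⟩ := hk k
  obtain ⟨g1, g2, g3⟩ := h0 0
  have hr0 : 0 < r := by linarith
  have hr0' : 0 < r' := by linarith
  have e2 : ν (2 : A) ≤ 2 := by simpa using sn_nat (ν := ν) h1 2
  have ha2 : ν (p.a2 : A) ≤ s := (sn_int h1 _).trans (by linarith)
  have ha4 : ν (p.a4 : A) ≤ s := (sn_int h1 _).trans (by linarith)
  rw [pow_zero, pow_one] at g1 g2 g3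
  have key : 6 * s ^ 2 * ((L * r ^ 4) ^ 4 ^ k) ^ 2 * (L * r' ^ 4) ^ 2 ≤
      (6 * s ^ 2 * L ^ 4 * r ^ 8) ^ 4 ^ k * r' ^ 8 := by
    have h4 : 4 ^ k ≠ 0 := by positivity
    have i1 : 6 * s ^ 2 * L ^ 2 ≤ (6 * s ^ 2 * L ^ 2) ^ 4 ^ k :=
      le_self_pow₀ (one_le_mul_of_one_le_of_one_le hs20 (one_le_pow₀ hL)) h4
    calc 6 * s ^ 2 * ((L * r ^ 4) ^ 4 ^ k) ^ 2 * (L * r' ^ 4) ^ 2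
        = (6 * s ^ 2 * L ^ 2) * (L ^ 2 * r ^ 8) ^ 4 ^ k * r' ^ 8 := by
          rw [← pow_mul, mul_comm (4 ^ k) 2, pow_mul]; ring
      _ ≤ (6 * s ^ 2 * L ^ 2) ^ 4 ^ k * (L ^ 2 * r ^ 8) ^ 4 ^ k * r' ^ 8 := by gcongr
      _ = _ := by rw [← mul_pow]; ring
  have hm0 : 0 ≤ (L * r ^ 4) ^ 4 ^ k := by positivity
  have hm0' : 0 ≤ L * r' ^ 4 := by positivity
  generalize (6 * s ^ 2 * L ^ 4 * r ^ 8) ^ 4 ^ k * r' ^ 8 = RHS at *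
  generalize (L * r ^ 4) ^ 4 ^ k = m at *
  have hFa : L * r ^ 4 ≤ 6 * s ^ 2 * L ^ 4 * r ^ 4 := by gcongr
  have hFb : L * r' ^ 4 ≤ 6 * s ^ 2 * L ^ 4 * r' ^ 4 := by gcongr
  generalize L * r' ^ 4 = m' at *
  have hmm : 0 ≤ m ^ 2 * m' ^ 2 := by positivity
  refine ⟨?_, ?_, ?_, ?_, hF.trans hFa, hF'.trans hFb⟩
  · refine (sn_pow h1 (sn_sub (sn_mul f1 g2) (sn_mul g1 f2)) 2).trans (le_trans ?_ key)
    nlinarith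
  · refine (sn_pow h1 (sn_sub (sn_mul f1 g1) (sn_mul (sn_mul ha4 f2) g2)) 2).trans (le_trans ?_ key)
    have : (m * m' + s * m * m') ^ 2 = (1 + s) ^ 2 * (m ^ 2 * m' ^ 2) := by ring
    rw [this, mul_assoc]
    nlinarith
  · refine (sn_add (sn_mul (sn_add (sn_mul f1 g1) (sn_mul (sn_mul ha4 f2) g2)) (sn_add (sn_mul f1 g2) (sn_mul g1 f2)))
      (sn_mul (sn_mul (sn_mul (sn_mul (sn_mul e2 ha2) f1) g1) f2) g2)).trans (le_trans ?_ key)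
    nlinarith
  · have h3 : ν (p.R k x y) ≤ 2 * ν (p.sk k x).2.2 * ν (p.sk 0 y).2.2 :=
      sn_mul (sn_mul e2 le_rfl) le_rfl
    refine le_trans ?_ key
    calc r ^ 2 * r' ^ 2 * ν (p.R k x y) ≤ r ^ 2 * r' ^ 2 * (2 * ν (p.sk k x).2.2 * ν (p.sk 0 y).2.2) := by gcongr
      _ = 2 * (r ^ 2 * ν (p.sk k x).2.2) * (r' ^ 2 * ν (p.sk 0 y).2.2) := by ring
      _ ≤ 2 * m ^ 2 * m' ^ 2 := by gcongr
      _ ≤ _ := by nlinarith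

end Prm

end PartP4c

section PartP5a

section QA
variable {R A : Type*} [CommRing R] [CommRing A] {f : R}

/-- evaluation hom -/
def evQ (φ : R →+* A) (w : A) (hw : w * w = φ f) : QuadraticAlgebra R f 0 →+* A where
  toFun z := φ z.re + φ z.im * w
  map_one' := by simp [QuadraticAlgebra.re_one, QuadraticAlgebra.im_one]
  map_zero' := by simp
  map_add' x y := by simp; ring
  map_mul' x y := by
    simp
    linear_combination (-φ x.im * φ y.im) * hw

lemma evQ_apply (φ : R →+* A) (w : A) (hw : w * w = φ f) (z) : evQ φ w hw z = φ z.re + φ z.im * w := rfl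

lemma evQ_alg (φ : R →+* A) (w : A) (hw : w * w = φ f) (r : R) :
    evQ φ w hw (algebraMap R _ r) = φ r := by
  simp [evQ_apply]

lemma evQ_omega (φ : R →+* A) (w : A) (hw : w * w = φ f) :
    evQ φ w hw QuadraticAlgebra.omega = w := by
  simp [evQ_apply]

/-- seminorm on quadratic algebra -/
def qnorm (ν : RingSeminorm R) (κ : NNReal) (h : ν f ≤ (κ : ℝ) ^ 2) :
    RingSeminorm (QuadraticAlgebra R f 0) where
  toFun z := ν z.re + κ * ν z.im
  map_zero' := by simp
  neg' z := by simp [map_neg_eq_map]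
  add_le' x y := by
    have h1 := map_add_le_add ν x.re y.re
    have h2 := map_add_le_add ν x.im y.im
    have h3 := κ.2
    simp only [QuadraticAlgebra.re_add, QuadraticAlgebra.im_add]
    nlinarith
  mul_le' x y := by
    have h1 := map_add_le_add ν (x.re * y.re) (f * x.im * y.im)
    have h2 := map_add_le_add ν (x.re * y.im) (x.im * y.re)
    have m1 := map_mul_le_mul ν x.re y.re
    have m2 := map_mul_le_mul ν x.re y.im
    have m3 := map_mul_le_mul ν x.im y.re
    have m4 : ν (f * x.im * y.im) ≤ (κ : ℝ) ^ 2 * ν x.im * ν y.im :=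
      (map_mul_le_mul ν _ _).trans (mul_le_mul_of_nonneg_right ((map_mul_le_mul ν _ _).trans
        (mul_le_mul_of_nonneg_right h (apply_nonneg ν _))) (apply_nonneg ν _))
    have e1 : ν (x * y).re ≤ ν x.re * ν y.re + (κ : ℝ) ^ 2 * ν x.im * ν y.im := by
      have : (x * y).re = x.re * y.re + f * x.im * y.im := by simp [mul_assoc]
      rw [this]; linarith
    have e2 : ν (x * y).im ≤ ν x.re * ν y.im + ν x.im * ν y.re := by
      have : (x * y).im = x.re * y.im + x.im * y.re := by simp
      rw [this]; linarith
    have h3 : (κ : ℝ) * ν (x * y).im ≤ κ * (ν x.re * ν y.im + ν x.im * ν y.re) :=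
      mul_le_mul_of_nonneg_left e2 κ.2
    nlinarith

lemma qnorm_apply (ν : RingSeminorm R) (κ : NNReal) (h : ν f ≤ (κ : ℝ) ^ 2) (z) :
    qnorm ν κ h z = ν z.re + κ * ν z.im := rfl

lemma qnorm_alg (ν : RingSeminorm R) (κ : NNReal) (h : ν f ≤ (κ : ℝ) ^ 2) (r : R) :
    qnorm ν κ h (algebraMap R _ r) = ν r := by simp [qnorm_apply]

lemma qnorm_star (ν : RingSeminorm R) (κ : NNReal) (h : ν f ≤ (κ : ℝ) ^ 2) (z : QuadraticAlgebra R f 0) :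
    qnorm ν κ h (star z) = qnorm ν κ h z := by simp [qnorm_apply, map_neg_eq_map]

lemma qnorm_norm (ν : RingSeminorm R) (κ : NNReal) (h : ν f ≤ (κ : ℝ) ^ 2) (z : QuadraticAlgebra R f 0) :
    ν (QuadraticAlgebra.norm z) ≤ qnorm ν κ h z ^ 2 := by
  rw [← qnorm_alg ν κ h, QuadraticAlgebra.algebraMap_norm_eq_mul_star, sq]
  refine (map_mul_le_mul _ _ _).trans (by rw [qnorm_star])

lemma qnorm_omega (ν : RingSeminorm R) (κ : NNReal) (h : ν f ≤ (κ : ℝ) ^ 2) (h1 : ν 1 ≤ 1) :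
    qnorm ν κ h QuadraticAlgebra.omega ≤ κ := by
  simp only [qnorm_apply, QuadraticAlgebra.omega_re, QuadraticAlgebra.omega_im, map_zero, zero_add]
  have := κ.2
  nlinarith

/-- `f` is not a square of the fraction field -/
def NonSq (f : R) : Prop := ∀ d n : R, f * d ^ 2 = n ^ 2 → d = 0

lemma QA_norm_eq_zero [IsDomain R] (hf : NonSq f) (z : QuadraticAlgebra R f 0)
    (h : QuadraticAlgebra.norm z = 0) : z = 0 := by
  rw [QuadraticAlgebra.norm_def] at h
  have h1 : z.im = 0 := hf z.im z.re (by linear_combination -h)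
  have h2 : z.re = 0 := by
    rw [h1] at h
    simpa using h
  ext <;> simp [h1, h2]

lemma QA_isDomain [IsDomain R] (hf : NonSq f) : IsDomain (QuadraticAlgebra R f 0) := by
  have : NoZeroDivisors (QuadraticAlgebra R f 0) := by
    refine ⟨fun {a b} h => ?_⟩
    have := congrArg QuadraticAlgebra.norm h
    rw [map_mul, QuadraticAlgebra.norm_zero] at this
    rcases mul_eq_zero.1 this with h | h
    · exact Or.inl (QA_norm_eq_zero hf _ h)
    · exact Or.inr (QA_norm_eq_zero hf _ h)
  exact NoZeroDivisors.to_isDomain _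

lemma NonSq_ext [IsDomain R] [CharZero R] {g : R} (hf : NonSq f) (hg : NonSq g) (hfg : NonSq (f * g)) :
    NonSq (algebraMap R (QuadraticAlgebra R f 0) g) := by
  intro B A h
  by_contra hB
  have hd : QuadraticAlgebra.norm B ≠ 0 := fun h => hB (QA_norm_eq_zero hf _ h)
  have h2 : algebraMap R (QuadraticAlgebra R f 0) (g * (QuadraticAlgebra.norm B) ^ 2) = (A * star B) ^ 2 := by
    rw [map_mul, map_pow, QuadraticAlgebra.algebraMap_norm_eq_mul_star]
    linear_combination (star B) ^ 2 * h
  obtain ⟨z, hz⟩ : ∃ z, z = A * star B := ⟨_, rfl⟩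
  rw [← hz] at h2
  have hre := congrArg QuadraticAlgebra.re h2
  have him := congrArg QuadraticAlgebra.im h2
  rw [sq] at hre him
  simp only [QuadraticAlgebra.algebraMap_re, QuadraticAlgebra.algebraMap_im, QuadraticAlgebra.re_mul,
    QuadraticAlgebra.im_mul, sq z] at hre him
  have him' : (2 * z.re) * z.im = 0 := by linear_combination -him
  rcases mul_eq_zero.1 him' with h0 | h0
  · have h0' : z.re = 0 := by simpa using h0
    refine hd (hfg _ (f * z.im) ?_)
    rw [h0'] at hre
    linear_combination f * hre
  · rw [h0] at hre
    refine hd (hg _ z.re ?_)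
    linear_combination hre
end QA

section nonsq
open Polynomial

lemma nonsq_of_root (P : ℤ[X]) (r : ℂ) (Q : ℂ[X]) (hP : P.map (Int.castRingHom ℂ) = (X - C r) * Q)
    (hQ : Q.eval r ≠ 0) : NonSq ((C P) * (P.map C) : ℤ[X][X]) := by
  intro d n h
  by_contra hd
  have hQ0 : Q ≠ 0 := by rintro rfl; simp at hQ
  have hP0 : P ≠ 0 := by
    rintro rfl
    rw [Polynomial.map_zero] at hP
    exact mul_ne_zero (X_sub_C_ne_zero r) hQ0 hP.symm
  have hfin : ((d * (P.map C)).roots.toFinset : Set ℤ[X]).Finite := Finset.finite_toSet _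
  have hdP : d * (P.map C : ℤ[X][X]) ≠ 0 := mul_ne_zero hd (by
    rw [Ne, Polynomial.map_eq_zero_iff C_injective]; exact hP0)
  obtain ⟨c, hc⟩ : ∃ c : ℤ, (d * (P.map C)).eval (C c) ≠ 0 := by
    by_contra hcon
    push Not at hcon
    have : Set.range (fun c : ℤ => (C c : ℤ[X])) ⊆ ((d * (P.map C)).roots.toFinset : Set ℤ[X]) := by
      rintro _ ⟨c, rfl⟩
      simp only [Finset.mem_coe, Multiset.mem_toFinset]
      rw [mem_roots hdP]; exact hcon c
    exact Set.infinite_range_of_injective C_injective (hfin.subset this)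
  have h2 := congrArg (eval (C c)) h
  rw [eval_mul, eval_mul, eval_pow, eval_pow, eval_C, eval_map] at h2
  rw [eval_mul, eval_map] at hc
  have e1 : eval₂ C (C c) P = C (eval c P) := by
    exact eval₂_hom C c
  rw [e1] at h2 hc
  have hd' := left_ne_zero_of_mul hc
  have hc' := right_ne_zero_of_mul hc
  have h3 := congrArg (Polynomial.map (Int.castRingHom ℂ)) h2
  simp only [Polynomial.map_mul, Polynomial.map_pow, hP, map_C] at h3
  have inj : Function.Injective (Int.castRingHom ℂ) := Int.cast_injective
  obtain ⟨e, he⟩ : ∃ e, e = (eval (C c) d).map (Int.castRingHom ℂ) := ⟨_, rfl⟩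
  obtain ⟨v, hv⟩ : ∃ v, v = (eval (C c) n).map (Int.castRingHom ℂ) := ⟨_, rfl⟩
  have he0 : e ≠ 0 := by
    rw [he, Ne, Polynomial.map_eq_zero_iff inj]; exact hd'
  obtain ⟨k, hk⟩ : ∃ k, k = (Int.castRingHom ℂ) (eval c P) := ⟨_, rfl⟩
  have hk0 : k ≠ 0 := by
    intro h0
    rw [hk] at h0
    apply hc'
    rw [inj (h0.trans (map_zero _).symm), C_0]
  rw [← he, ← hv, ← hk] at h3
  have n1 : (X - C r) * Q ≠ 0 := mul_ne_zero (X_sub_C_ne_zero r) hQ0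
  have n2 : (X - C r) * Q * C k ≠ 0 := mul_ne_zero n1 (by simpa using hk0)
  have n3 : e * e ≠ 0 := mul_ne_zero he0 he0
  have n4 : (X - C r) * Q * C k * (e * e) ≠ 0 := mul_ne_zero n2 n3
  rw [sq, sq] at h3
  have h4 := congrArg (rootMultiplicity r) h3
  rw [rootMultiplicity_mul n4, rootMultiplicity_mul n3, rootMultiplicity_mul n2, rootMultiplicity_mul n1,
    rootMultiplicity_mul (h3 ▸ n4), rootMultiplicity_X_sub_C_self, rootMultiplicity_C,
    rootMultiplicity_eq_zero hQ] at h4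
  omega

lemma nonsq_aux (D b : ℤ) (s : ℂ) (hs : s ^ 2 = -(b : ℂ)) (hre : s.re = 0) (hD : D ≠ 0) (T : ℤ) :
    ((2 * (T + D : ℤ) + s) - 2 * T) ^ 2 + (b : ℂ) ≠ 0 := by
  intro h
  have h1 : (4 * (D : ℂ)) * (D + s) = 0 := by
    push_cast at h
    linear_combination h - hs
  have hD' : (D : ℂ) ≠ 0 := by exact_mod_cast hD
  rcases mul_eq_zero.1 h1 with h2 | h2
  · exact hD' (by simpa using h2)
  · have := congrArg Complex.re h2
    simp [hre] at this
    exact hD (by exact_mod_cast this)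

lemma exists_s (b : ℤ) (hb : 0 < b) : ∃ s : ℂ, s ^ 2 = -(b : ℂ) ∧ s ≠ 0 ∧ s.re = 0 := by
  have hb' : (0 : ℝ) ≤ b := by exact_mod_cast hb.le
  have h : (Complex.I * (Real.sqrt b : ℝ)) ^ 2 = -(b : ℂ) := by
    rw [mul_pow, Complex.I_sq, ← Complex.ofReal_pow, Real.sq_sqrt hb']
    push_cast; ring
  refine ⟨Complex.I * (Real.sqrt b : ℝ), h, ?_, by simp⟩
  intro h0
  rw [h0, zero_pow two_ne_zero] at h
  have : (b : ℂ) = 0 := by linear_combination h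
  exact hb.ne' (by exact_mod_cast this)

end nonsq

section prm
open Polynomial

/-- radicand in two variables; inner variable is the first -/
noncomputable def fS (p : Prm) : ℤ[X][X] := p.F (C X : ℤ[X][X]) * p.F (X : ℤ[X][X])

lemma fS_eq (p : Prm) : fS p = C (p.F (X : ℤ[X])) * (p.F X : ℤ[X]).map C := by
  have h1 := p.map_F (C : ℤ[X] →+* ℤ[X][X]) X
  have h2 := p.map_F (mapRingHom (C : ℤ →+* ℤ[X])) X
  simp only [coe_mapRingHom, map_X] at h2
  rw [h1, h2, fS]

lemma q2_fac (p : Prm) (s : ℂ) (hs : s ^ 2 = -(p.b : ℂ)) :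
    (p.q2 X : ℂ[X]) = (X - C (2 * p.t' + s)) * (X - C (2 * p.t' - s)) := by
  have : (C s) ^ 2 = -(p.b : ℂ[X]) := by rw [← C_pow, hs]; simp
  simp only [Prm.q2, map_add, map_sub, map_mul, map_intCast, map_ofNat]
  linear_combination this

lemma nonsq_fS (p : Prm) (hb : 0 < p.b) (hδ : p.δ ≠ 0) (hT : p.t ≠ p.t') : NonSq (fS p) := by
  obtain ⟨s, hs, hs0, hre⟩ := exists_s p.b hb
  rw [fS_eq]
  refine nonsq_of_root _ (2 * p.t' + s) (C (p.δ : ℂ) * p.q1 X * (X - C (2 * p.t' - s))) ?_ ?_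
  · have := p.map_F (mapRingHom (Int.castRingHom ℂ)) X
    simp only [coe_mapRingHom, map_X] at this
    rw [this, Prm.F, q2_fac p s hs]
    simp
    ring
  · have h1 := nonsq_aux (p.t' - p.t) p.b s hs hre (sub_ne_zero.2 hT.symm) p.t
    have hδ' : (p.δ : ℂ) ≠ 0 := by exact_mod_cast hδ
    simp only [eval_mul, eval_sub, eval_X, eval_C, Prm.q1, eval_add, eval_pow, eval_intCast, eval_ofNat]
    refine mul_ne_zero (mul_ne_zero hδ' ?_) ?_
    · simpa using h1
    · intro h; apply hs0; linear_combination h / 2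

lemma nonsq_fS_mul (p p' : Prm) (hb : 0 < p.b) (hb' : p'.b = p.b) (ht : p'.t = p.t) (hδ : p.δ ≠ 0) (hδ' : p'.δ ≠ 0)
    (hT : p.t ≠ p.t') (hT' : p.t' ≠ p'.t') : NonSq (fS p * fS p') := by
  obtain ⟨s, hs, hs0, hre⟩ := exists_s p.b hb
  have e : fS p * fS p' = C (p.F X * p'.F X) * (p.F X * p'.F X : ℤ[X]).map C := by
    rw [fS_eq, fS_eq, C_mul, Polynomial.map_mul]; ring
  rw [e]
  refine nonsq_of_root _ (2 * p.t' + s) (C (p.δ : ℂ) * C (p'.δ : ℂ) * p.q1 X * p'.q1 X * p'.q2 X * (X - C (2 * p.t' - s))) ?_ ?_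
  · have h1 := p.map_F (mapRingHom (Int.castRingHom ℂ)) X
    have h2 := p'.map_F (mapRingHom (Int.castRingHom ℂ)) X
    simp only [coe_mapRingHom, map_X] at h1 h2
    rw [Polynomial.map_mul, h1, h2, Prm.F, Prm.F, q2_fac p s hs]
    simp
    ring
  · have h1 := nonsq_aux (p.t' - p.t) p.b s hs hre (sub_ne_zero.2 hT.symm) p.t
    have h2 := nonsq_aux (p.t' - p'.t') p.b s hs hre (sub_ne_zero.2 hT') p'.t'
    have d1 : (p.δ : ℂ) ≠ 0 := by exact_mod_cast hδ
    have d2 : (p'.δ : ℂ) ≠ 0 := by exact_mod_cast hδ'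
    simp only [eval_mul, eval_sub, eval_X, eval_C, Prm.q1, Prm.q2, eval_add, eval_pow, eval_intCast, eval_ofNat, hb', ht]
    refine mul_ne_zero (mul_ne_zero (mul_ne_zero (mul_ne_zero (mul_ne_zero d1 d2) ?_) ?_) ?_) ?_
    · simpa using h1
    · simpa using h1
    · simpa using h2
    · intro h; apply hs0; linear_combination h / 2

end prm

end PartP5a

section PartP5b

section forms
variable {A A' : Type*} [CommRing A] [CommRing A']

def Am (p : Prm) (k : ℕ) (x y W : A) : A := p.S k x y + p.R k x y * W
def Ap (p : Prm) (k : ℕ) (x y W : A) : A := p.S k x y - p.R k x y * W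

lemma map_Am (p : Prm) (φ : A →+* A') (k : ℕ) (x y W : A) : φ (Am p k x y W) = Am p k (φ x) (φ y) (φ W) := by
  simp [Am, p.map_S, p.map_R]
lemma map_Ap (p : Prm) (φ : A →+* A') (k : ℕ) (x y W : A) : φ (Ap p k x y W) = Ap p k (φ x) (φ y) (φ W) := by
  simp [Ap, p.map_S, p.map_R]

/-- basis forms -/
def Uf (p : Prm) (k n : ℕ) (e : Bool) (x y W : A) (j : ℕ) : A :=
  match e with
  | false => Am p k x y W ^ j * p.B k x y ^ (n - j)
  | true => p.C k x y ^ j * Ap p k x y W ^ (n - j)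

lemma map_Uf (p : Prm) (φ : A →+* A') (k n : ℕ) (e : Bool) (x y W : A) (j : ℕ) :
    φ (Uf p k n e x y W j) = Uf p k n e (φ x) (φ y) (φ W) j := by
  cases e <;> simp [Uf, map_Am, map_Ap, p.map_B, p.map_C]

lemma Uf_B (p : Prm) (k n : ℕ) (x y W : A) (hW : W * W = p.F x * p.F y) (j : ℕ) (hj : j ≤ n) :
    Uf p k n true x y W j * p.B k x y ^ n = Uf p k n false x y W j * Ap p k x y W ^ n := by
  have h : (Am p k x y W * Ap p k x y W) ^ j = (p.B k x y * p.C k x y) ^ j := by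
    rw [Am, Ap, p.APM k x y W hW]
  obtain ⟨i, rfl⟩ := Nat.exists_eq_add_of_le hj
  simp only [Uf, Nat.add_sub_cancel_left, mul_pow, pow_add] at *
  linear_combination (- Ap p k x y W ^ i * p.B k x y ^ i) * h

lemma Uf_C (p : Prm) (k n : ℕ) (x y W : A) (hW : W * W = p.F x * p.F y) (j : ℕ) (hj : j ≤ n) :
    Uf p k n true x y W j * Am p k x y W ^ n = Uf p k n false x y W j * p.C k x y ^ n := by
  obtain ⟨i, rfl⟩ := Nat.exists_eq_add_of_le hj
  have h : (Am p k x y W * Ap p k x y W) ^ i = (p.B k x y * p.C k x y) ^ i := by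
    rw [Am, Ap, p.APM k x y W hW]
  simp only [Uf, Nat.add_sub_cancel_left, mul_pow, pow_add] at *
  linear_combination (p.C k x y ^ j * Am p k x y W ^ j) * h

abbrev Idx (k n : ℕ) := Fin (4 ^ k) × Fin (n + 1) × Fin (n + 1)

/-- the auxiliary form -/
def pol (p p' : Prm) (k n : ℕ) (c : Idx k n → ℤ) (e e' : Bool) (x y W V : A) : A :=
  ∑ q : Idx k n, (c q : A) * x ^ (q.1 : ℕ) * Uf p k n e x y W q.2.1 * Uf p' k n e' x y V q.2.2

lemma map_pol (p p' : Prm) (φ : A →+* A') (k n : ℕ) (c : Idx k n → ℤ) (e e' : Bool) (x y W V : A) :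
    φ (pol p p' k n c e e' x y W V) = pol p p' k n c e e' (φ x) (φ y) (φ W) (φ V) := by
  simp [pol, map_sum, map_Uf]

variable {p p' : Prm} {k n : ℕ} {c : Idx k n → ℤ} {x y W V : A}

lemma pol_B1 (hW : W * W = p.F x * p.F y) (e : Bool) :
    pol p p' k n c true e x y W V * p.B k x y ^ n = pol p p' k n c false e x y W V * Ap p k x y W ^ n := by
  simp only [pol, Finset.sum_mul]
  refine Finset.sum_congr rfl fun q _ => ?_
  have := Uf_B p k n x y W hW q.2.1 (Nat.lt_succ_iff.1 q.2.1.2)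
  linear_combination ((c q : A) * x ^ (q.1 : ℕ) * Uf p' k n e x y V q.2.2) * this

lemma pol_C1 (hW : W * W = p.F x * p.F y) (e : Bool) :
    pol p p' k n c true e x y W V * Am p k x y W ^ n = pol p p' k n c false e x y W V * p.C k x y ^ n := by
  simp only [pol, Finset.sum_mul]
  refine Finset.sum_congr rfl fun q _ => ?_
  have := Uf_C p k n x y W hW q.2.1 (Nat.lt_succ_iff.1 q.2.1.2)
  linear_combination ((c q : A) * x ^ (q.1 : ℕ) * Uf p' k n e x y V q.2.2) * this

lemma pol_B2 (hV : V * V = p'.F x * p'.F y) (e : Bool) :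
    pol p p' k n c e true x y W V * p'.B k x y ^ n = pol p p' k n c e false x y W V * Ap p' k x y V ^ n := by
  simp only [pol, Finset.sum_mul]
  refine Finset.sum_congr rfl fun q _ => ?_
  have := Uf_B p' k n x y V hV q.2.2 (Nat.lt_succ_iff.1 q.2.2.2)
  linear_combination ((c q : A) * x ^ (q.1 : ℕ) * Uf p k n e x y W q.2.1) * this

lemma pol_C2 (hV : V * V = p'.F x * p'.F y) (e : Bool) :
    pol p p' k n c e true x y W V * Am p' k x y V ^ n = pol p p' k n c e false x y W V * p'.C k x y ^ n := by
  simp only [pol, Finset.sum_mul]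
  refine Finset.sum_congr rfl fun q _ => ?_
  have := Uf_C p' k n x y V hV q.2.2 (Nat.lt_succ_iff.1 q.2.2.2)
  linear_combination ((c q : A) * x ^ (q.1 : ℕ) * Uf p k n e x y W q.2.1) * this

end forms

section bounds

lemma Uf_bound (p : Prm) : ∃ L0 : ℝ, 1 ≤ L0 ∧ ∀ L : ℝ, L0 ≤ L → ∀ (A : Type) [CommRing A] (ν : RingSeminorm A) (x y W : A) (r r' : ℝ),
    ν 1 ≤ 1 → 1 ≤ r → ν x ≤ r → 1 ≤ r' → ν y ≤ r' →
      (ν (p.F x * p.F y) ≤ (L * r ^ 2 * r' ^ 2) ^ 2) ∧ (ν W ≤ L * r ^ 2 * r' ^ 2 → ∀ k n j : ℕ, j ≤ n → ∀ e,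
      ν (Uf p k n e x y W j) ≤ ((L ^ 2 * 2 * r ^ 8) ^ 4 ^ k * r' ^ 8) ^ n) := by
  obtain ⟨L0, hL0, hb0⟩ := p.kum_bound
  refine ⟨L0, hL0, fun L hLL A _ ν x y W r r' h1 hr hx hr' hy => ?_⟩
  have hL : 1 ≤ L := hL0.trans hLL
  have hb : ∀ k, ν (p.B k x y) ≤ (L * r ^ 8) ^ 4 ^ k * r' ^ 8 ∧
      ν (p.C k x y) ≤ (L * r ^ 8) ^ 4 ^ k * r' ^ 8 ∧
      ν (p.S k x y) ≤ (L * r ^ 8) ^ 4 ^ k * r' ^ 8 ∧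
      r ^ 2 * r' ^ 2 * ν (p.R k x y) ≤ (L * r ^ 8) ^ 4 ^ k * r' ^ 8 ∧
      ν (p.F x) ≤ L * r ^ 4 ∧ ν (p.F y) ≤ L * r' ^ 4 := by
    intro k
    obtain ⟨h1, h2, h3, h4, h5, h6⟩ := hb0 A ν x y r r' h1 hr hx hr' hy k
    have i1 : (L0 * r ^ 8) ^ 4 ^ k * r' ^ 8 ≤ (L * r ^ 8) ^ 4 ^ k * r' ^ 8 := by gcongr
    refine ⟨h1.trans i1, h2.trans i1, h3.trans i1, h4.trans i1, h5.trans ?_, h6.trans ?_⟩ <;> gcongr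
  constructor
  · obtain ⟨-, -, -, -, h5, h6⟩ := hb 0
    refine (sn_mul h5 h6).trans (le_of_eq (by ring))
  intro hW k n j hj e
  obtain ⟨hB, hC, hS, hR, -, -⟩ := hb k
  have h4 : 4 ^ k ≠ 0 := by positivity
  have hm : (L * 2) * ((L * r ^ 8) ^ 4 ^ k * r' ^ 8) ≤ (L ^ 2 * 2 * r ^ 8) ^ 4 ^ k * r' ^ 8 := by
    have : L * 2 ≤ (L * 2) ^ 4 ^ k := le_self_pow₀ (by linarith) h4
    calc _ ≤ (L * 2) ^ 4 ^ k * ((L * r ^ 8) ^ 4 ^ k * r' ^ 8) := by gcongr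
      _ = _ := by rw [← mul_assoc, ← mul_pow]; ring
  have hm0 : 0 ≤ (L * r ^ 8) ^ 4 ^ k * r' ^ 8 := by positivity
  generalize (L ^ 2 * 2 * r ^ 8) ^ 4 ^ k * r' ^ 8 = M at *
  generalize (L * r ^ 8) ^ 4 ^ k * r' ^ 8 = m at *
  have hRW : ν (p.R k x y * W) ≤ L * m := by
    refine (sn_mul le_rfl hW).trans ?_
    have : ν (p.R k x y) * (L * r ^ 2 * r' ^ 2) = L * (r ^ 2 * r' ^ 2 * ν (p.R k x y)) := by ring
    rw [this]; gcongr
  have hmM : m ≤ M := by nlinarith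
  have hAm : ν (Am p k x y W) ≤ M := (sn_add hS hRW).trans (by nlinarith)
  have hAp : ν (Ap p k x y W) ≤ M := (sn_sub hS hRW).trans (by nlinarith)
  obtain ⟨i, rfl⟩ := Nat.exists_eq_add_of_le hj
  rw [pow_add]
  cases e
  · simp only [Uf, Nat.add_sub_cancel_left]
    exact sn_mul (sn_pow h1 hAm _) (sn_pow h1 (hB.trans hmM) _)
  · simp only [Uf, Nat.add_sub_cancel_left]
    exact sn_mul (sn_pow h1 (hC.trans hmM) _) (sn_pow h1 hAp _)

/-- one monomial term -/
lemma term_bound (p p' : Prm) (n : ℕ) : ∃ L K : ℝ, 1 ≤ L ∧ 1 ≤ K ∧ ∀ (A : Type) [CommRing A] (ν : RingSeminorm A) (x y W V : A) (r r' : ℝ),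
    ν 1 ≤ 1 → 1 ≤ r → ν x ≤ r → 1 ≤ r' → ν y ≤ r' →
      (ν (p.F x * p.F y) ≤ (L * r ^ 2 * r' ^ 2) ^ 2) ∧ (ν (p'.F x * p'.F y) ≤ (L * r ^ 2 * r' ^ 2) ^ 2) ∧
      (ν W ≤ L * r ^ 2 * r' ^ 2 → ν V ≤ L * r ^ 2 * r' ^ 2 → ∀ k : ℕ, ∀ (q : Idx k n) e e',
      ν (x ^ (q.1 : ℕ) * Uf p k n e x y W q.2.1 * Uf p' k n e' x y V q.2.2) ≤
        K ^ 4 ^ k * r ^ ((16 * n + 1) * 4 ^ k) * r' ^ (16 * n)) := by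
  obtain ⟨L1, hL1, hb1⟩ := Uf_bound p
  obtain ⟨L2, hL2, hb2⟩ := Uf_bound p'
  obtain ⟨L, hL⟩ : ∃ L, L = max L1 L2 := ⟨_, rfl⟩
  have l1 : L1 ≤ L := hL ▸ le_max_left _ _
  have l2 : L2 ≤ L := hL ▸ le_max_right _ _
  have hLo : 1 ≤ L := hL1.trans l1
  refine ⟨L, (L ^ 2 * 2) ^ (2 * n), hLo, one_le_pow₀ (by nlinarith), fun A _ ν x y W V r r' h1 hr hx hr' hy => ?_⟩
  obtain ⟨f1, g1⟩ := hb1 L l1 A ν x y W r r' h1 hr hx hr' hy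
  obtain ⟨f2, g2⟩ := hb2 L l2 A ν x y V r r' h1 hr hx hr' hy
  refine ⟨f1, f2, fun hW hV k q e e' => ?_⟩
  have a1 := g1 hW k n q.2.1 (Nat.lt_succ_iff.1 q.2.1.2) e
  have a2 := g2 hV k n q.2.2 (Nat.lt_succ_iff.1 q.2.2.2) e'
  have a3 : ν (x ^ (q.1 : ℕ)) ≤ r ^ 4 ^ k := (sn_pow h1 hx _).trans (pow_le_pow_right₀ hr q.1.2.le)
  refine (sn_mul (sn_mul a3 a1) a2).trans (le_of_eq ?_)
  have : ∀ N : ℕ, r ^ N * ((L ^ 2 * 2 * r ^ 8) ^ N * r' ^ 8) ^ n * ((L ^ 2 * 2 * r ^ 8) ^ N * r' ^ 8) ^ n =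
      ((L ^ 2 * 2) ^ (2 * n)) ^ N * r ^ ((16 * n + 1) * N) * r' ^ (16 * n) := by
    intro N
    simp only [mul_pow, ← pow_mul]
    ring_nf
  exact this _
end bounds

end PartP5b

section PartP5c

section R2
open Polynomial

abbrev R1 (p : Prm) : Type := QuadraticAlgebra ℤ[X][X] (fS p) 0
abbrev R2 (p p' : Prm) : Type := QuadraticAlgebra (R1 p) (algebraMap ℤ[X][X] (R1 p) (fS p')) 0

variable (p p' : Prm)

noncomputable def gS : ℤ[X][X] →+* R2 p p' := (algebraMap (R1 p) (R2 p p')).comp (algebraMap ℤ[X][X] (R1 p))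
noncomputable def gx : R2 p p' := gS p p' (C X)
noncomputable def gy : R2 p p' := gS p p' X
noncomputable def gW : R2 p p' := algebraMap (R1 p) (R2 p p') QuadraticAlgebra.omega
noncomputable def gV : R2 p p' := QuadraticAlgebra.omega


def cmp4 {p p' : Prm} (z : R2 p p') (s : Bool × Bool) : ℤ[X][X] :=
  match s with
  | (false, false) => z.re.re
  | (true, false) => z.re.im
  | (false, true) => z.im.re
  | (true, true) => z.im.im

lemma cmp4_ext {z : R2 p p'} (h : ∀ s, cmp4 z s = 0) : z = 0 := by
  have h1 := h (false, false)
  have h2 := h (true, false)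
  have h3 := h (false, true)
  have h4 := h (true, true)
  simp only [cmp4] at h1 h2 h3 h4
  ext1 <;> ext1 <;> simpa

lemma cmp4_add (z w : R2 p p') (s) : cmp4 (z + w) s = cmp4 z s + cmp4 w s := by
  obtain ⟨(_ | _), (_ | _)⟩ := s <;> simp [cmp4]
lemma cmp4_zsmul (c : ℤ) (z : R2 p p') (s) : cmp4 (c • z) s = c • cmp4 z s := by
  obtain ⟨(_ | _), (_ | _)⟩ := s <;> simp [cmp4]
lemma cmp4_gS_mul (c : ℤ[X][X]) (z : R2 p p') (s) : cmp4 (gS p p' c * z) s = c * cmp4 z s := by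
  obtain ⟨(_ | _), (_ | _)⟩ := s <;> simp [cmp4, gS]
lemma cmp4_zero (s) : cmp4 (0 : R2 p p') s = 0 := by
  obtain ⟨(_ | _), (_ | _)⟩ := s <;> simp [cmp4]

noncomputable def coef {p p'} (z : R2 p p') (s : Bool × Bool) (i j : ℕ) : ℤ := ((cmp4 z s).coeff j).coeff i

/-- coefficient as additive hom -/
noncomputable def coefHom (s : Bool × Bool) (i j : ℕ) : R2 p p' →+ ℤ where
  toFun z := coef z s i j
  map_zero' := by simp [coef, cmp4_zero]
  map_add' z w := by simp [coef, cmp4_add]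

lemma gW_sq : gW p p' * gW p p' = p.F (gx p p') * p.F (gy p p') := by
  rw [gx, gy, ← p.map_F (gS p p'), ← p.map_F (gS p p'), ← map_mul, gW, ← map_mul]
  rw [QuadraticAlgebra.omega_mul_omega_eq_mk]
  rfl
lemma gV_sq : gV p p' * gV p p' = p'.F (gx p p') * p'.F (gy p p') := by
  rw [gx, gy, ← p'.map_F (gS p p'), ← p'.map_F (gS p p'), ← map_mul, gV]
  rw [QuadraticAlgebra.omega_mul_omega_eq_mk]
  rfl

/-- evaluation on the double quadratic algebra -/
noncomputable def evR {A : Type*} [CommRing A] (φ : ℤ[X][X] →+* A) (W V : A) (hW : W * W = φ (fS p)) (hV : V * V = φ (fS p')) :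
    R2 p p' →+* A :=
  evQ (evQ φ W hW) V (by rw [evQ_alg]; exact hV)

variable {A : Type*} [CommRing A] (φ : ℤ[X][X] →+* A) (W V : A) (hW : W * W = φ (fS p)) (hV : V * V = φ (fS p'))
lemma evR_gS (s) : evR p p' φ W V hW hV (gS p p' s) = φ s := by simp [evR, gS, evQ_alg]
lemma evR_gx : evR p p' φ W V hW hV (gx p p') = φ (C X) := evR_gS ..
lemma evR_gy : evR p p' φ W V hW hV (gy p p') = φ X := evR_gS ..
lemma evR_gW : evR p p' φ W V hW hV (gW p p') = W := by simp [evR, gW, evQ_alg, evQ_omega]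
lemma evR_gV : evR p p' φ W V hW hV (gV p p') = V := by simp [evR, gV, evQ_omega]
lemma evR_cmp4 (z : R2 p p') : evR p p' φ W V hW hV z =
    φ (cmp4 z (false, false)) + φ (cmp4 z (true, false)) * W + (φ (cmp4 z (false, true)) + φ (cmp4 z (true, true)) * W) * V := rfl

noncomputable def NN (z : R2 p p') : ℤ[X][X] := QuadraticAlgebra.norm (QuadraticAlgebra.norm z)

lemma NN_dvd (z : R2 p p') : z ∣ gS p p' (NN p p' z) := by
  refine dvd_trans ?_ ((algebraMap (R1 p) (R2 p p')).map_dvd (⟨_, QuadraticAlgebra.algebraMap_norm_eq_mul_star (QuadraticAlgebra.norm z)⟩ :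
    QuadraticAlgebra.norm z ∣ algebraMap ℤ[X][X] (R1 p) (NN p p' z)))
  change z ∣ algebraMap (R1 p) (R2 p p') (QuadraticAlgebra.norm z)
  rw [QuadraticAlgebra.algebraMap_norm_eq_mul_star]
  exact dvd_mul_right _ _

lemma NN_ne_zero (hb : 0 < p.b) (hb' : p'.b = p.b) (ht : p'.t = p.t) (hδ : p.δ ≠ 0) (hδ' : p'.δ ≠ 0)
    (hT : p.t ≠ p.t') (hT1 : p'.t ≠ p'.t') (hT' : p.t' ≠ p'.t') (z : R2 p p') (hz : z ≠ 0) : NN p p' z ≠ 0 := by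
  have h1 := nonsq_fS p hb hδ hT
  have h2 := nonsq_fS p' (hb' ▸ hb) hδ' hT1
  have h3 := nonsq_fS_mul p p' hb hb' ht hδ hδ' hT hT'
  have h4 := NonSq_ext h1 h2 h3
  have := QA_isDomain h1
  intro h
  exact hz (QA_norm_eq_zero h4 _ (QA_norm_eq_zero h1 _ h))

set_option maxHeartbeats 1000000 in
lemma R2_bound (n : ℕ) : ∃ K : ℝ, 1 ≤ K ∧ ∀ ρ ρ' : NNReal, 1 ≤ ρ → 1 ≤ ρ' → ∃ ν : RingSeminorm (R2 p p'),
    ν 1 ≤ 1 ∧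
    (∀ k : ℕ, ∀ (q : Idx k n) e e',
      ν (gx p p' ^ (q.1 : ℕ) * Uf p k n e (gx p p') (gy p p') (gW p p') q.2.1 * Uf p' k n e' (gx p p') (gy p p') (gV p p') q.2.2) ≤
        K ^ 4 ^ k * ρ ^ ((16 * n + 1) * 4 ^ k) * ρ' ^ (16 * n)) ∧
    (∀ z s i j, |(coef z s i j : ℝ)| * ρ ^ i * ρ' ^ j ≤ ν z) ∧
    (∀ z, pnorm (pnorm zν ρ) ρ' (NN p p' z) ≤ ν z ^ 4) := by
  obtain ⟨L, K, hL, hK, h⟩ := term_bound p p' n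
  refine ⟨K, hK, fun ρ ρ' hρ hρ' => ?_⟩
  have h01 : zν 1 ≤ 1 := by rw [zν_apply]; simp
  have h02 : pnorm (pnorm zν ρ) ρ' 1 ≤ 1 := by
    rw [← C_1, pnorm_C, ← C_1, pnorm_C]; exact h01
  have hx : pnorm (pnorm zν ρ) ρ' (C X) ≤ ρ := by
    rw [pnorm_C, pnorm_X]
    have := ρ.2
    nlinarith
  have hy : pnorm (pnorm zν ρ) ρ' X ≤ ρ' := by
    rw [pnorm_X, ← C_1, pnorm_C]
    have := ρ'.2
    nlinarith
  have hρr : (1 : ℝ) ≤ ρ := by exact_mod_cast hρ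
  have hρr' : (1 : ℝ) ≤ ρ' := by exact_mod_cast hρ'
  obtain ⟨f1, f2, -⟩ := h ℤ[X][X] (pnorm (pnorm zν ρ) ρ') (C X) X 0 0 ρ ρ' h02 hρr hx hρr' hy
  obtain ⟨κ, hκ⟩ : ∃ κ : NNReal, (κ : ℝ) = L * ρ ^ 2 * ρ' ^ 2 := ⟨⟨L * ρ ^ 2 * ρ' ^ 2, by positivity⟩, rfl⟩
  have hκ1 : (1 : ℝ) ≤ κ := by
    rw [hκ]
    exact one_le_mul_of_one_le_of_one_le (one_le_mul_of_one_le_of_one_le hL (one_le_pow₀ hρr)) (one_le_pow₀ hρr')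
  rw [← hκ] at f1 f2
  obtain ⟨ν0, hν0⟩ : ∃ ν0, ν0 = pnorm (pnorm zν ρ) ρ' := ⟨_, rfl⟩
  rw [← hν0] at f1 f2 h02 hx hy
  replace f1 : ν0 (fS p) ≤ (κ : ℝ) ^ 2 := f1
  replace f2 : ν0 (fS p') ≤ (κ : ℝ) ^ 2 := f2
  obtain ⟨ν1, hν1⟩ : ∃ ν1 : RingSeminorm (R1 p), ν1 = qnorm ν0 κ f1 := ⟨_, rfl⟩
  have g2 : ν1 (algebraMap ℤ[X][X] (R1 p) (fS p')) ≤ (κ : ℝ) ^ 2 := by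
    rw [hν1, qnorm_alg]; exact f2
  have h11 : ν1 1 ≤ 1 := by
    have := qnorm_alg ν0 κ f1 1
    rw [map_one] at this
    rw [hν1]; exact this.le.trans h02
  have al2 : ∀ z, qnorm ν1 κ g2 (algebraMap _ _ z) = ν1 z := fun z => qnorm_alg ν1 κ g2 z
  have gSn : ∀ z, qnorm ν1 κ g2 (gS p p' z) = ν0 z := by
    intro z
    have e1 := al2 (algebraMap _ _ z)
    have e2 : ν1 (algebraMap _ _ z) = ν0 z := by rw [hν1, qnorm_alg]
    exact e1.trans e2
  refine ⟨qnorm ν1 κ g2, ?_, ?_, ?_, ?_⟩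
  · have := gSn 1
    rw [map_one] at this
    rw [this]; exact h02
  · have h21 : qnorm ν1 κ g2 1 ≤ 1 := by
      have := gSn 1
      rw [map_one] at this
      rw [this]; exact h02
    refine (h _ (qnorm ν1 κ g2) (gx p p') (gy p p') (gW p p') (gV p p') ρ ρ' h21 hρr ?_ hρr' ?_).2.2 ?_ ?_
    · exact (gSn _).le.trans hx
    · exact (gSn _).le.trans hy
    · rw [← hκ]
      refine (al2 _).le.trans ?_
      rw [hν1]
      exact qnorm_omega ν0 κ f1 h02
    · rw [← hκ]
      exact qnorm_omega ν1 κ g2 h11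
  · intro z s i j
    have c1 : |(coef z s i j : ℝ)| * ρ ^ i * ρ' ^ j ≤ ν0 (cmp4 z s) := by
      rw [hν0]
      refine le_trans ?_ (coeff_le_pnorm _ _ _ j)
      refine mul_le_mul_of_nonneg_right ?_ (by positivity)
      refine le_trans ?_ (coeff_le_pnorm _ _ _ i)
      rw [zν_apply]; rfl
    refine c1.trans ?_
    have ap : ∀ z, ν1 z = ν0 z.re + κ * ν0 z.im := fun z => by rw [hν1]; rfl
    rw [qnorm_apply, ap, ap]
    have n1 := apply_nonneg ν0 z.re.re
    have n2 := apply_nonneg ν0 z.re.im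
    have n3 := apply_nonneg ν0 z.im.re
    have n4 := apply_nonneg ν0 z.im.im
    have m2 : ν0 z.re.im ≤ κ * ν0 z.re.im := by nlinarith
    have m3 : ν0 z.im.re ≤ κ * ν0 z.im.re := by nlinarith
    have m4 : ν0 z.im.im ≤ κ * ν0 z.im.im := by nlinarith
    have m5 : κ * ν0 z.im.im ≤ κ * (κ * ν0 z.im.im) := by nlinarith
    obtain ⟨(_ | _), (_ | _)⟩ := s <;> simp only [cmp4] <;> nlinarith
  · intro z
    have e1 := qnorm_norm ν1 κ g2 z
    have e2 := qnorm_norm ν0 κ f1 (QuadraticAlgebra.norm z)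
    rw [← hν1] at e2
    have e3 := pow_le_pow_left₀ (apply_nonneg _ _) e1 2
    have e4 := e2.trans e3
    rw [← pow_mul] at e4
    rw [← hν0]
    exact e4
end R2

end PartP5c

section PartP5d

section geom
open Polynomial Filter Topology

/-- projective proportionality of the first two coordinates -/
def Pr (s s' : ℂ × ℂ × ℂ) : Prop := ∃ l : ℂ, l ≠ 0 ∧ s.1 = l * s'.1 ∧ s.2.1 = l * s'.2.1

lemma Pr.dup {s s' : ℂ × ℂ × ℂ} (h : Pr s s') (a2 a4 : ℂ) : Pr (dup a2 a4 s) (dup a2 a4 s') := by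
  obtain ⟨l, hl, h1, h2⟩ := h
  refine ⟨l ^ 4, pow_ne_zero _ hl, ?_, ?_⟩ <;> simp only [_root_.dup, h1, h2] <;> ring

lemma Pr.iter {s s' : ℂ × ℂ × ℂ} (h : Pr s s') (a2 a4 : ℂ) (k : ℕ) :
    Pr ((_root_.dup a2 a4)^[k] s) ((_root_.dup a2 a4)^[k] s') := by
  induction k with
  | zero => exact h
  | succ k ih => rw [Function.iterate_succ_apply', Function.iterate_succ_apply']; exact ih.dup a2 a4

lemma Pr.trans {s s' s'' : ℂ × ℂ × ℂ} (h : Pr s s') (h' : Pr s' s'') : Pr s s'' := by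
  obtain ⟨l, hl, h1, h2⟩ := h
  obtain ⟨l', hl', h1', h2'⟩ := h'
  exact ⟨l * l', mul_ne_zero hl hl', by rw [h1, h1', mul_assoc], by rw [h2, h2', mul_assoc]⟩

/-- not both coordinates vanish -/
def NZ (s : ℂ × ℂ × ℂ) : Prop := ¬ (s.1 = 0 ∧ s.2.1 = 0)

lemma NZ_aux {a2 a4 α β : ℂ} (h4 : a4 ≠ 0) (hd : a2 ^ 2 - 4 * a4 ≠ 0)
    (h1 : α ^ 2 = a4 * β ^ 2) (h2 : α * β * (α ^ 2 + a2 * α * β + a4 * β ^ 2) = 0) : α = 0 ∧ β = 0 := by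
  have key : α = 0 ∨ β = 0 := by
    by_contra hc
    push Not at hc
    have h3 : α ^ 2 + a2 * α * β + a4 * β ^ 2 = 0 := by
      rcases mul_eq_zero.1 h2 with h | h
      · exact absurd h (mul_ne_zero hc.1 hc.2)
      · exact h
    have h5 : a2 * α = - 2 * a4 * β := by
      apply mul_right_cancel₀ hc.2
      linear_combination h3 - h1
    have h6 : a4 * (a2 ^ 2 - 4 * a4) * β ^ 2 = 0 := by
      linear_combination (-a2 ^ 2) * h1 + (a2 * α - 2 * a4 * β) * h5
    exact (mul_ne_zero (mul_ne_zero h4 hd) (pow_ne_zero 2 hc.2)) h6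
  rcases key with h | h
  · subst h
    refine ⟨rfl, ?_⟩
    have : a4 * β ^ 2 = 0 := by linear_combination -h1
    simpa [h4] using this
  · subst h
    refine ⟨?_, rfl⟩
    simpa using h1

lemma NZ.dup {s : ℂ × ℂ × ℂ} (h : NZ s) {a2 a4 : ℂ} (h4 : a4 ≠ 0) (hd : a2 ^ 2 - 4 * a4 ≠ 0) :
    NZ (dup a2 a4 s) := by
  rintro ⟨h1, h2⟩
  apply h
  simp only [_root_.dup] at h1 h2
  refine NZ_aux h4 hd (sub_eq_zero.1 (pow_eq_zero_iff (two_ne_zero)|>.1 h1)) ?_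
  have : (4:ℂ) * (s.1 * s.2.1 * (s.1 ^ 2 + a2 * s.1 * s.2.1 + a4 * s.2.1 ^ 2)) = 0 := by
    linear_combination h2
  simpa using this

lemma NZ.iter {s : ℂ × ℂ × ℂ} (h : NZ s) {a2 a4 : ℂ} (h4 : a4 ≠ 0) (hd : a2 ^ 2 - 4 * a4 ≠ 0) (k : ℕ) :
    NZ ((_root_.dup a2 a4)^[k] s) := by
  induction k with
  | zero => exact h
  | succ k ih => rw [Function.iterate_succ_apply']; exact ih.dup h4 hd

lemma NZ.pr {s s' : ℂ × ℂ × ℂ} (h : NZ s') (hp : Pr s s') : NZ s := by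
  obtain ⟨l, hl, h1, h2⟩ := hp
  rintro ⟨h3, h4⟩
  rw [h1] at h3; rw [h2] at h4
  exact h ⟨by simpa [hl] using h3, by simpa [hl] using h4⟩

lemma KK_nz {s s' : ℂ × ℂ × ℂ} (h : NZ s) (h' : NZ s') {a2 a4 : ℂ} (h4 : a4 ≠ 0) (hd : a2 ^ 2 - 4 * a4 ≠ 0)
    (hB : KB s.1 s.2.1 s'.1 s'.2.1 = 0) (hS : KS a2 a4 s.1 s.2.1 s'.1 s'.2.1 = 0)
    (hC : KC a4 s.1 s.2.1 s'.1 s'.2.1 = 0) : False := by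
  obtain ⟨α, β, ρ⟩ := s
  obtain ⟨α', β', ρ'⟩ := s'
  simp only [NZ] at *
  have hK := Kummer_rel a2 a4 α β α' β'
  rw [hB, hS] at hK
  have h1 : α * β' = α' * β := sub_eq_zero.1 (pow_eq_zero_iff two_ne_zero |>.1 hB)
  have h2 : α * α' = a4 * β * β' := sub_eq_zero.1 (pow_eq_zero_iff two_ne_zero |>.1 hC)
  have h3 : cub a2 a4 α β * cub a2 a4 α' β' = 0 := by linear_combination (-1/4) * hK
  obtain ⟨l, hl, e1, e2⟩ : ∃ l : ℂ, l ≠ 0 ∧ α' = l * α ∧ β' = l * β := by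
    by_cases hb : β = 0
    · have ha : α ≠ 0 := fun ha => h ⟨ha, hb⟩
      have hb' : β' = 0 := by
        have : α * β' = 0 := by rw [h1, hb, mul_zero]
        simpa [ha] using this
      refine ⟨α' / α, div_ne_zero (fun h => h' ⟨h, hb'⟩) ha, by field_simp, by rw [hb', hb, mul_zero]⟩
    · refine ⟨β' / β, div_ne_zero (fun h0 => h' ⟨?_, h0⟩) hb, by field_simp; linear_combination -h1, by field_simp⟩
      have : α' * β = 0 := by rw [← h1, h0, mul_zero]
      simpa [hb] using this
  subst e1 e2
  refine h (NZ_aux h4 hd (mul_left_cancel₀ hl (by linear_combination h2)) ?_)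
  have h5 : l ^ 4 * (cub a2 a4 α β) ^ 2 = 0 := by
    rw [← h3]; simp only [cub]; ring
  have h6 : cub a2 a4 α β = 0 := by simpa [hl] using h5
  exact h6

/-- asymptotics at infinity -/
def Asy (f : ℂ → ℂ × ℂ × ℂ) (c e : ℂ) : Prop :=
  c ≠ 0 ∧ (∀ᶠ u in Bornology.cobounded ℂ, (f u).2.1 ≠ 0) ∧
    Tendsto (fun u => (f u).1 / (f u).2.1 - c * u) (Bornology.cobounded ℂ) (𝓝 e)

lemma Asy.tendsto {f c e} (h : Asy f c e) :
    Tendsto (fun u => (f u).1 / (f u).2.1) (Bornology.cobounded ℂ) (Bornology.cobounded ℂ) := by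
  obtain ⟨hc, -, ht⟩ := h
  have h1 : Tendsto (fun u : ℂ => c * u) (Bornology.cobounded ℂ) (Bornology.cobounded ℂ) := by
    rw [← tendsto_norm_atTop_iff_cobounded]
    simp only [norm_mul]
    exact tendsto_norm_cobounded_atTop.const_mul_atTop (norm_pos_iff.2 hc)
  rw [← tendsto_norm_atTop_iff_cobounded] at h1 ⊢
  have h2 := ht.norm
  have h3 : Tendsto (fun u : ℂ => ‖c * u‖ + -‖(f u).1 / (f u).2.1 - c * u‖) (Bornology.cobounded ℂ) atTop :=
    h1.atTop_add h2.neg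
  refine tendsto_atTop_mono (fun u => ?_) h3
  have := norm_sub_le ((f u).1 / (f u).2.1) ((f u).1 / (f u).2.1 - c * u)
  rw [sub_sub_cancel] at this
  linarith

lemma Asy.ne {f c e} (h : Asy f c e) (z : ℂ) :
    ∀ᶠ u in Bornology.cobounded ℂ, (f u).1 / (f u).2.1 ≠ z := by
  have h1 := h.tendsto
  rw [← tendsto_norm_atTop_iff_cobounded] at h1
  filter_upwards [h1.eventually_gt_atTop ‖z‖] with u hu h2
  rw [h2] at hu
  exact lt_irrefl _ hu

lemma Asy.dup {f c e} (h : Asy f c e) (a2 a4 : ℂ) :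
    Asy (fun u => dup a2 a4 (f u)) (c / 4) (e / 4 - a2 / 4) := by
  have hX := h.tendsto
  have hw : Tendsto (fun u => ((f u).1 / (f u).2.1)⁻¹) (Bornology.cobounded ℂ) (𝓝 0) :=
    (tendsto_inv₀_cobounded).comp hX
  have hD : Tendsto (fun u => 1 + a2 * ((f u).1 / (f u).2.1)⁻¹ + a4 * ((f u).1 / (f u).2.1)⁻¹ ^ 2)
      (Bornology.cobounded ℂ) (𝓝 1) := by
    have := ((hw.const_mul a2).const_add 1).add ((hw.pow 2).const_mul a4)
    simpa using this
  have hN : Tendsto (fun u => -a2 - 3 * a4 * ((f u).1 / (f u).2.1)⁻¹ + a4 ^ 2 * ((f u).1 / (f u).2.1)⁻¹ ^ 3)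
      (Bornology.cobounded ℂ) (𝓝 (-a2)) := by
    have := ((hw.const_mul (3 * a4)).const_sub (-a2)).add ((hw.pow 3).const_mul (a4 ^ 2))
    simpa using this
  have hne := hD.eventually_ne one_ne_zero
  have hX0 := h.ne 0
  obtain ⟨hc, hb, ht⟩ := h
  refine ⟨by simpa using hc, ?_, ?_⟩
  · filter_upwards [hne, hX0, hb] with u h1 h2 h3
    have hα : (f u).1 ≠ 0 := fun h0 => h2 (by rw [h0, zero_div])
    simp only [_root_.dup]
    refine mul_ne_zero (mul_ne_zero (mul_ne_zero (by norm_num) hα) h3) ?_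
    intro h0
    apply h1
    field_simp
    linear_combination h0
  · have hq := (ht.div_const 4).add ((hN.div hD one_ne_zero).div_const 4)
    have e1 : e / 4 + -a2 / 1 / 4 = e / 4 - a2 / 4 := by ring
    rw [e1] at hq
    refine hq.congr' ?_
    filter_upwards [hne, hX0, hb] with u h1 h2 h3
    have hα : (f u).1 ≠ 0 := fun h0 => h2 (by rw [h0, zero_div])
    simp only [_root_.dup, Pi.div_apply]
    have h4 : (f u).1 ^ 2 + a2 * (f u).1 * (f u).2.1 + a4 * (f u).2.1 ^ 2 ≠ 0 := by
      intro h0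
      apply h1
      field_simp
      linear_combination h0
    have h5 : 1 + a2 * ((f u).1 / (f u).2.1)⁻¹ + a4 * ((f u).1 / (f u).2.1)⁻¹ ^ 2 =
      ((f u).1 ^ 2 + a2 * (f u).1 * (f u).2.1 + a4 * (f u).2.1 ^ 2) / (f u).1 ^ 2 := by
      field_simp
    rw [h5]
    generalize (f u).1 = α at *
    generalize (f u).2.1 = β at *
    obtain ⟨g, hg⟩ : ∃ g, g = α ^ 2 + a2 * α * β + a4 * β ^ 2 := ⟨_, rfl⟩
    rw [← hg] at h4 ⊢
    field_simp
    rw [hg]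
    ring

lemma Asy.iter {f c e} (h : Asy f c e) (a2 a4 : ℂ) (k : ℕ) :
    Asy (fun u => (_root_.dup a2 a4)^[k] (f u)) (c / 4 ^ k) (e / 4 ^ k - a2 / 3 * (1 - 1 / 4 ^ k)) := by
  induction k with
  | zero => simpa using h
  | succ k ih =>
    have := ih.dup a2 a4
    simp only [Function.iterate_succ_apply']
    convert this using 1
    · rw [pow_succ]; field_simp
    · rw [pow_succ]; field_simp; ring

lemma Asy.base {μ : ℂ} (h : μ ≠ 0) : Asy (fun u => (μ * u, 1, 0)) μ 0 := by
  refine ⟨h, by simp, ?_⟩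
  simp

lemma Asy.scale {f c e} (h : Asy f c e) {ν : ℂ} (hν : ν ≠ 0) :
    Asy (fun u => (ν * (f u).1, (f u).2.1, 0)) (ν * c) (ν * e) := by
  obtain ⟨hc, hb, ht⟩ := h
  refine ⟨mul_ne_zero hν hc, hb, ?_⟩
  refine (ht.const_mul ν).congr fun u => ?_
  simp only
  ring

lemma infinite_of_cobounded {P : ℂ → Prop} (h : ∀ᶠ u in Bornology.cobounded ℂ, P u) : {u | P u}.Infinite := by
  intro hf
  have h1 : {u | P u}ᶜ ∈ Bornology.cobounded ℂ := by
    rw [← Bornology.isBounded_def]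
    exact hf.isBounded
  have h2 : ∀ᶠ u in Bornology.cobounded ℂ, False := by
    filter_upwards [h, h1] with u h3 h4
    exact h4 h3
  exact absurd h2.exists (by simp)

/-- degrees -/
lemma dup_deg (a2 a4 : ℂ) (s : ℂ[X] × ℂ[X] × ℂ[X]) (N : ℕ) (h1 : s.1.natDegree = N) (h2 : s.2.1.natDegree < N) :
    (dup (C a2) (C a4) s).1.natDegree = 4 * N ∧ (dup (C a2) (C a4) s).2.1.natDegree < 4 * N := by
  obtain ⟨α, β, ρ⟩ := s
  simp only [dup] at *
  have hb : (C a4 * β ^ 2).natDegree < 2 * N := by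
    refine (natDegree_C_mul_le _ _).trans_lt ?_
    rw [natDegree_pow]; omega
  have ha : (α ^ 2).natDegree = 2 * N := by rw [natDegree_pow, h1]
  constructor
  · rw [natDegree_pow, natDegree_sub_eq_left_of_natDegree_lt (by rw [ha]; exact hb), ha]; ring
  · have h3 : (α ^ 2 + C a2 * α * β + C a4 * β ^ 2).natDegree ≤ 2 * N := by
      refine natDegree_add_le_of_degree_le (natDegree_add_le_of_degree_le ha.le ?_) hb.le
      refine natDegree_mul_le.trans ?_
      have := natDegree_C_mul_le a2 α
      omega
    refine natDegree_mul_le.trans_lt ?_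
    have h4 : (4 * α * β).natDegree < 2 * N := by
      refine natDegree_mul_le.trans_lt ?_
      have h5 : (4 * α).natDegree ≤ N := by
        rw [show (4 : ℂ[X]) = C 4 from (map_ofNat C 4).symm]
        exact (natDegree_C_mul_le _ _).trans h1.le
      omega
    omega

lemma dup_deg_iter (a2 a4 : ℂ) (s : ℂ[X] × ℂ[X] × ℂ[X]) (N : ℕ) (h1 : s.1.natDegree = N) (h2 : s.2.1.natDegree < N)
    (k : ℕ) : ((dup (C a2) (C a4))^[k] s).1.natDegree = 4 ^ k * N ∧ ((dup (C a2) (C a4))^[k] s).2.1.natDegree < 4 ^ k * N := by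
  induction k with
  | zero => simpa using ⟨h1, h2⟩
  | succ k ih =>
    rw [Function.iterate_succ_apply', pow_succ', mul_assoc]
    exact dup_deg a2 a4 _ _ ih.1 ih.2

end geom

end PartP5d

section PartP5d2

section geom2
open Polynomial Filter Topology

/-- the uniformising coordinate -/
noncomputable def xu (t s u : ℂ) : ℂ := ((2 * t + s) * u - (2 * t - s)) / (u - 1)

noncomputable def muP (p : Prm) (s : ℂ) : ℂ := p.δ * p.T * (s + p.T)

lemma T_ne (p : Prm) (hT : p.t ≠ p.t') : p.T ≠ 0 := sub_ne_zero.2 hT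

lemma sT_ne (p : Prm) (hb : 0 < p.b) (s : ℂ) (hs : s ^ 2 = -(p.b : ℂ)) : s + p.T ≠ 0 := by
  intro h
  have h1 : ((p.T ^ 2 + p.b : ℤ) : ℂ) = 0 := by
    push_cast
    linear_combination (p.T - s) * h + hs
  have h2 : p.T ^ 2 + p.b = 0 := by exact_mod_cast h1
  nlinarith [sq_nonneg p.T]

lemma muP_ne (p : Prm) (hb : 0 < p.b) (hδ : p.δ ≠ 0) (hT : p.t ≠ p.t') (s : ℂ) (hs : s ^ 2 = -(p.b : ℂ)) : muP p s ≠ 0 := by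
  have := T_ne p hT
  exact mul_ne_zero (mul_ne_zero (by exact_mod_cast hδ) (by exact_mod_cast this)) (sT_ne p hb s hs)

lemma param (p : Prm) (hb : 0 < p.b) (hδ : p.δ ≠ 0) (hT : p.t ≠ p.t') (s : ℂ) (hs : s ^ 2 = -(p.b : ℂ)) (u : ℂ) (hu : u ≠ 1) :
    Pr (p.s0 (xu p.t s u)) (dup (p.a2 : ℂ) (p.a4 : ℂ) (muP p s * u, 1, 0)) := by
  have hT0 : (p.T : ℂ) ≠ 0 := by exact_mod_cast T_ne p hT
  have hδ0 : (p.δ : ℂ) ≠ 0 := by exact_mod_cast hδ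
  have hsT := sT_ne p hb s hs
  have hμ := muP_ne p hb hδ hT s hs
  have hu1 : u - 1 ≠ 0 := sub_ne_zero.2 hu
  have hb' : (p.b : ℂ) = - s ^ 2 := by rw [hs]; ring
  have hs0 : s ≠ 0 := by
    rintro rfl
    have : (p.b : ℂ) = 0 := by simpa using hb'
    have : p.b = 0 := by exact_mod_cast this
    omega
  have ht' : (p.t' : ℂ) = p.t - p.T := by simp [Prm.T]
  have hx : xu p.t s u = 2 * p.t + s * (u + 1) / (u - 1) := by
    rw [xu]; field_simp; ring
  have hq1 : p.q1 (xu p.t s u) = 4 * s ^ 2 * u / (u - 1) ^ 2 := by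
    rw [Prm.q1, hx, hb']; field_simp; ring
  have hq2 : p.q2 (xu p.t s u) = (4 * s ^ 2 * u + 4 * p.T * s * (u + 1) * (u - 1) + 4 * p.T ^ 2 * (u - 1) ^ 2) / (u - 1) ^ 2 := by
    rw [Prm.q2, hx, hb', ht']; field_simp; ring
  have hm : p.m (xu p.t s u) = (s * (u + 1) + p.T * (u - 1)) / (u - 1) := by
    rw [Prm.m, hx, ht']; field_simp; ring
  refine ⟨4 * s ^ 2 * p.T * (p.T + s) / (muP p s ^ 3 * (u - 1) ^ 4), ?_, ?_, ?_⟩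
  · refine div_ne_zero (mul_ne_zero (mul_ne_zero (mul_ne_zero (by norm_num) (pow_ne_zero _ hs0)) hT0) ?_)
      (mul_ne_zero (pow_ne_zero _ hμ) (pow_ne_zero _ hu1))
    rwa [add_comm]
  · simp only [Prm.s0, dup, hm, Prm.κ, Prm.a4, muP]
    push_cast
    rw [hb', add_comm (p.T : ℂ) s]
    field_simp
    ring
  · simp only [Prm.s0, dup, hq1, hq2, Prm.κ, Prm.a2, Prm.a4, muP]
    push_cast
    rw [hb', add_comm (p.T : ℂ) s]
    field_simp
    ring

lemma a4_ne (p : Prm) (hb : 0 < p.b) (hδ : p.δ ≠ 0) (hT : p.t ≠ p.t') : p.a4 ≠ 0 := by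
  have := T_ne p hT
  have h2 : p.κ ≠ 0 := by
    have : 0 < p.κ := by unfold Prm.κ; positivity
    omega
  exact mul_ne_zero (mul_ne_zero (pow_ne_zero _ hδ) (pow_ne_zero _ this)) h2

lemma disc_ne (p : Prm) (hb : 0 < p.b) (hδ : p.δ ≠ 0) : p.a2 ^ 2 - 4 * p.a4 ≠ 0 := by
  have : p.a2 ^ 2 - 4 * p.a4 = (p.δ * p.b) ^ 2 := by
    simp only [Prm.a2, Prm.a4, Prm.κ]; ring
  rw [this]
  exact pow_ne_zero _ (mul_ne_zero hδ hb.ne')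

lemma sk_param (p : Prm) (hb : 0 < p.b) (hδ : p.δ ≠ 0) (hT : p.t ≠ p.t') (s : ℂ) (hs : s ^ 2 = -(p.b : ℂ)) (u : ℂ) (hu : u ≠ 1) (k : ℕ) :
    Pr (p.sk k (xu p.t s u)) ((dup (p.a2 : ℂ) (p.a4 : ℂ))^[k + 1] (muP p s * u, 1, 0)) := by
  rw [Function.iterate_succ_apply]
  exact (param p hb hδ hT s hs u hu).iter _ _ k

lemma mu_cross (p p' : Prm) (hb : 0 < p.b) (hb' : p'.b = p.b) (ht : p'.t = p.t) (hδ : p.δ ≠ 0) (hδ' : p'.δ ≠ 0)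
    (hT : p.t ≠ p.t') (hT1 : p'.t ≠ p'.t') (hT' : p.t' ≠ p'.t') (s : ℂ) (hs : s ^ 2 = -(p.b : ℂ)) (hre : s.re = 0) :
    muP p' s / muP p s * p.a2 - p'.a2 ≠ 0 := by
  have hT0 : (p.T : ℂ) ≠ 0 := by exact_mod_cast T_ne p hT
  have hT0' : (p'.T : ℂ) ≠ 0 := by exact_mod_cast T_ne p' hT1
  have hδ0 : (p.δ : ℂ) ≠ 0 := by exact_mod_cast hδ
  have hδ0' : (p'.δ : ℂ) ≠ 0 := by exact_mod_cast hδ'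
  have hsT := sT_ne p hb s hs
  have hsT' := sT_ne p' (hb' ▸ hb) s (by rw [hb']; exact hs)
  have hμ := muP_ne p hb hδ hT s hs
  have hbb : (p.b : ℂ) = - s ^ 2 := by rw [hs]; ring
  have hs0 : s ≠ 0 := by
    rintro rfl
    have : (p.b : ℂ) = 0 := by simpa using hbb
    have : p.b = 0 := by exact_mod_cast this
    omega
  have hTT : (p'.T : ℂ) - p.T ≠ 0 := by
    have : p'.T - p.T ≠ 0 := by unfold Prm.T; omega
    exact_mod_cast this
  intro h
  have h1 : muP p' s * p.a2 - p'.a2 * muP p s = 0 := by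
    field_simp at h
    linear_combination h
  have h2 : (p.δ : ℂ) * p'.δ * ((p'.T - p.T) * s * (s ^ 2 + s * (p.T + p'.T) + 2 * p.T * p'.T)) = 0 := by
    rw [← h1]
    simp only [muP, Prm.a2, Prm.κ, hb']
    push_cast
    rw [hbb]
    ring
  have h3 : s ^ 2 + s * (p.T + p'.T) + 2 * p.T * p'.T = 0 := by
    have : ((p.δ : ℂ) * p'.δ) * ((p'.T - p.T) * s) ≠ 0 := mul_ne_zero (mul_ne_zero hδ0 hδ0') (mul_ne_zero hTT hs0)
    refine (mul_eq_zero.1 (?_ : ((p.δ : ℂ) * p'.δ * ((p'.T - p.T) * s)) * _ = 0)).resolve_left this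
    rw [← h2]; ring
  rw [hs] at h3
  have hi := congrArg Complex.im h3
  have hr := congrArg Complex.re h3
  simp [hre] at hi hr
  have him : s.im ≠ 0 := fun h0 => hs0 (Complex.ext hre h0)
  have h5 : (p.T : ℝ) + p'.T = 0 := by
    rcases hi with h | h
    · exact absurd h him
    · exact h
  have hb0 : (0 : ℝ) < p.b := by exact_mod_cast hb
  have h6 : (p'.T : ℝ) = - p.T := by linarith
  rw [h6] at hr
  nlinarith [sq_nonneg (p.T : ℝ)]

end geom2

end PartP5d2

section PartP5d3

section geom3
open Polynomial Filter Topology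

lemma dup_zero3 {A : Type*} [CommRing A] (a2 a4 : A) (s : A × A × A) (h : s.2.2 = 0) (k : ℕ) :
    ((dup a2 a4)^[k] s).2.2 = 0 := by
  induction k with
  | zero => exact h
  | succ k ih => rw [Function.iterate_succ_apply']; simp [dup, ih]

lemma cub_of_dup {a2 a4 : ℂ} {s : ℂ × ℂ × ℂ} (h : (dup a2 a4 s).2.1 ≠ 0) : cub a2 a4 s.1 s.2.1 ≠ 0 := by
  intro h0
  apply h
  simp only [dup, cub] at *
  linear_combination 4 * h0

lemma cub_pr {a2 a4 : ℂ} {s s' : ℂ × ℂ × ℂ} (hp : Pr s s') (h : cub a2 a4 s'.1 s'.2.1 ≠ 0) : cub a2 a4 s.1 s.2.1 ≠ 0 := by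
  obtain ⟨l, hl, h1, h2⟩ := hp
  have : cub a2 a4 s.1 s.2.1 = l ^ 4 * cub a2 a4 s'.1 s'.2.1 := by rw [h1, h2]; simp only [cub]; ring
  rw [this]
  exact mul_ne_zero (pow_ne_zero _ hl) h

lemma geom (p p' : Prm) (hb : 0 < p.b) (hb' : p'.b = p.b) (ht : p'.t = p.t) (hδ : p.δ ≠ 0) (hδ' : p'.δ ≠ 0)
    (hT : p.t ≠ p.t') (hT1 : p'.t ≠ p'.t') (hT' : p.t' ≠ p'.t') (s : ℂ) (hs : s ^ 2 = -(p.b : ℂ)) (hre : s.re = 0)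
    (k : ℕ) (hk : 1 ≤ k) :
    ∃ b S c : ℂ[X], (∀ u, ¬ (b.eval u = 0 ∧ S.eval u = 0 ∧ c.eval u = 0)) ∧ 4 ^ k < c.natDegree ∧
      {u : ℂ | u ≠ 1 ∧ b.eval u ≠ 0 ∧ ∃ x2 l : ℂ, l ≠ 0 ∧ p.B k (xu p.t s u) x2 = 0 ∧ p.S k (xu p.t s u) x2 ≠ 0 ∧
        p'.B k (xu p.t s u) x2 = l * b.eval u ∧ p'.S k (xu p.t s u) x2 = l * S.eval u ∧
        p'.C k (xu p.t s u) x2 = l * c.eval u ∧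
        cub (p'.a2 : ℂ) p'.a4 (p'.sk k (xu p.t s u)).1 (p'.sk k (xu p.t s u)).2.1 ≠ 0 ∧
        cub (p'.a2 : ℂ) p'.a4 (p'.sk 0 x2).1 (p'.sk 0 x2).2.1 ≠ 0}.Infinite := by
  have hb1 : 0 < p'.b := hb' ▸ hb
  have hs' : s ^ 2 = -(p'.b : ℂ) := by rw [hb']; exact hs
  have hμ := muP_ne p hb hδ hT s hs
  have hμ' := muP_ne p' hb1 hδ' hT1 s hs'
  have hcross := mu_cross p p' hb hb' ht hδ hδ' hT hT1 hT' s hs hre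
  have h4 : (p.a4 : ℂ) ≠ 0 := by exact_mod_cast a4_ne p hb hδ hT
  have hd : (p.a2 : ℂ) ^ 2 - 4 * p.a4 ≠ 0 := by exact_mod_cast disc_ne p hb hδ
  have h4' : (p'.a4 : ℂ) ≠ 0 := by exact_mod_cast a4_ne p' hb1 hδ' hT1
  have hd' : (p'.a2 : ℂ) ^ 2 - 4 * p'.a4 ≠ 0 := by exact_mod_cast disc_ne p' hb1 hδ'
  have hpar := fun u hu k => sk_param p hb hδ hT s hs u hu k
  have hpar' := fun u hu k => sk_param p' hb1 hδ' hT1 s hs' u hu k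
  rw [ht] at hpar'
  generalize muP p s = μ at *
  generalize muP p' s = μ' at *
  obtain ⟨ν, hν⟩ : ∃ ν, ν = μ' / μ := ⟨_, rfl⟩
  have hν0 : ν ≠ 0 := by rw [hν]; exact div_ne_zero hμ' hμ
  obtain ⟨fA, hfA⟩ : ∃ f : ℂ → ℂ × ℂ × ℂ, f = fun u => (dup (p.a2 : ℂ) p.a4)^[k] (μ * u, 1, 0) := ⟨_, rfl⟩
  obtain ⟨fG, hfG⟩ : ∃ f : ℂ → ℂ × ℂ × ℂ, f = fun u => (dup (p'.a2 : ℂ) p'.a4)^[k + 1] (μ' * u, 1, 0) := ⟨_, rfl⟩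
  obtain ⟨fH, hfH⟩ : ∃ f : ℂ → ℂ × ℂ × ℂ, f = fun u => dup (p'.a2 : ℂ) p'.a4 (ν * (fA u).1, (fA u).2.1, 0) := ⟨_, rfl⟩
  have aA := (Asy.base hμ).iter (p.a2 : ℂ) p.a4 k
  rw [← hfA] at aA
  have aG := (Asy.base hμ').iter (p'.a2 : ℂ) p'.a4 (k + 1)
  rw [← hfG] at aG
  have aH := (aA.scale hν0).dup (p'.a2 : ℂ) p'.a4
  rw [← hfH] at aH
  have aA1 := aA.dup (p.a2 : ℂ) p.a4
  have aA2 := aA1.dup (p.a2 : ℂ) p.a4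
  have aG1 := aG.dup (p'.a2 : ℂ) p'.a4
  have aH1 := aH.dup (p'.a2 : ℂ) p'.a4
  obtain ⟨PA, hPA⟩ : ∃ P : ℂ[X] × ℂ[X] × ℂ[X], P = (dup (C (p.a2 : ℂ)) (C (p.a4 : ℂ)))^[k] (C μ * X, 1, 0) := ⟨_, rfl⟩
  obtain ⟨PG, hPG⟩ : ∃ P : ℂ[X] × ℂ[X] × ℂ[X], P = (dup (C (p'.a2 : ℂ)) (C (p'.a4 : ℂ)))^[k + 1] (C μ' * X, 1, 0) := ⟨_, rfl⟩
  obtain ⟨PH, hPH⟩ : ∃ P : ℂ[X] × ℂ[X] × ℂ[X], P = dup (C (p'.a2 : ℂ)) (C (p'.a4 : ℂ)) (C ν * PA.1, PA.2.1, 0) := ⟨_, rfl⟩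
  have eA : ∀ u, Prod.map (evalRingHom u) (Prod.map (evalRingHom u) (evalRingHom u)) PA = fA u := by
    intro u
    rw [hPA, dup_map_iter, hfA]
    simp
  have eG : ∀ u, Prod.map (evalRingHom u) (Prod.map (evalRingHom u) (evalRingHom u)) PG = fG u := by
    intro u
    rw [hPG, dup_map_iter, hfG]
    simp
  have eH : ∀ u, Prod.map (evalRingHom u) (Prod.map (evalRingHom u) (evalRingHom u)) PH = fH u := by
    intro u
    rw [hPH, dup_map, hfH]
    simp only [← eA u]
    simp
  have eG1 : ∀ u, PG.1.eval u = (fG u).1 := fun u => congrArg Prod.fst (eG u)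
  have eG2 : ∀ u, PG.2.1.eval u = (fG u).2.1 := fun u => congrArg (fun z => z.2.1) (eG u)
  have eH1 : ∀ u, PH.1.eval u = (fH u).1 := fun u => congrArg Prod.fst (eH u)
  have eH2 : ∀ u, PH.2.1.eval u = (fH u).2.1 := fun u => congrArg (fun z => z.2.1) (eH u)
  have base : ∀ μ : ℂ, μ ≠ 0 → ((C μ * X, 1, 0) : ℂ[X] × ℂ[X] × ℂ[X]).1.natDegree = 1 := by
    intro μ hμ; exact natDegree_C_mul_X μ hμ
  have dA := dup_deg_iter (p.a2 : ℂ) p.a4 _ 1 (base μ hμ) (by simp) k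
  rw [← hPA, mul_one] at dA
  have dG := dup_deg_iter (p'.a2 : ℂ) p'.a4 _ 1 (base μ' hμ') (by simp) (k + 1)
  rw [← hPG, mul_one] at dG
  have dH := dup_deg (p'.a2 : ℂ) p'.a4 (C ν * PA.1, PA.2.1, 0) (4 ^ k) (by
    simp only [natDegree_C_mul hν0]; exact dA.1) dA.2
  rw [← hPH] at dH
  have nA : ∀ u, NZ (fA u) := fun u => by
    rw [hfA]; exact NZ.iter (by simp [NZ]) h4 hd k
  have nG : ∀ u, NZ (fG u) := fun u => by
    rw [hfG]; exact NZ.iter (by simp [NZ]) h4' hd' (k + 1)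
  have nH : ∀ u, NZ (fH u) := fun u => by
    rw [hfH]; refine NZ.dup ?_ h4' hd'
    rintro ⟨h1, h2⟩
    exact nA u ⟨by simpa [hν0] using h1, h2⟩
  refine ⟨KB PG.1 PG.2.1 PH.1 PH.2.1, KS (C (p'.a2 : ℂ)) (C (p'.a4 : ℂ)) PG.1 PG.2.1 PH.1 PH.2.1,
    KC (C (p'.a4 : ℂ)) PG.1 PG.2.1 PH.1 PH.2.1, ?_, ?_, ?_⟩
  · rintro u ⟨h1, h2, h3⟩
    refine KK_nz (nG u) (nH u) h4' hd' ?_ ?_ ?_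
    · rw [← h1]; simp [KB, eG1, eG2, eH1, eH2]
    · rw [← h2]; simp [KS, eG1, eG2, eH1, eH2]
    · rw [← h3]; simp [KC, eG1, eG2, eH1, eH2]
  · have h1 : (PG.1 * PH.1).natDegree = 2 * 4 ^ (k + 1) := by
      have g1 : PG.1 ≠ 0 := by
        intro h0; have := dG.2; rw [← dG.1, h0] at this; simp at this
      have g2 : PH.1 ≠ 0 := by
        intro h0; have := dH.2; rw [← dH.1, h0] at this; simp at this
      rw [natDegree_mul g1 g2, dG.1, dH.1]; ring
    have h2 : (C (p'.a4 : ℂ) * PG.2.1 * PH.2.1).natDegree < 2 * 4 ^ (k + 1) := by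
      refine natDegree_mul_le.trans_lt ?_
      have := natDegree_C_mul_le (p'.a4 : ℂ) PG.2.1
      rw [pow_succ] at *
      omega
    rw [KC, natDegree_pow, natDegree_sub_eq_left_of_natDegree_lt (by rw [h1]; exact h2), h1]
    rw [pow_succ]
    have : 0 < 4 ^ k := by positivity
    omega
  · apply infinite_of_cobounded
    have hdiff : ∀ᶠ u in Bornology.cobounded ℂ, (fG u).1 / (fG u).2.1 ≠ (fH u).1 / (fH u).2.1 := by
      have h1 := aG.2.2.sub aH.2.2
      have h2 : (0 / 4 ^ (k + 1) - (p'.a2 : ℂ) / 3 * (1 - 1 / 4 ^ (k + 1))) -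
          (ν * (0 / 4 ^ k - (p.a2 : ℂ) / 3 * (1 - 1 / 4 ^ k)) / 4 - (p'.a2 : ℂ) / 4) ≠ 0 := by
        have h4k : (4 : ℂ) ^ k - 1 ≠ 0 := by
          have : (4 : ℤ) ^ k - 1 ≠ 0 := by
            have : (4 : ℤ) ^ 1 ≤ 4 ^ k := pow_le_pow_right₀ (by norm_num) hk
            omega
          exact_mod_cast this
        have : (0 / 4 ^ (k + 1) - (p'.a2 : ℂ) / 3 * (1 - 1 / 4 ^ (k + 1))) -
          (ν * (0 / 4 ^ k - (p.a2 : ℂ) / 3 * (1 - 1 / 4 ^ k)) / 4 - (p'.a2 : ℂ) / 4) =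
          (4 ^ k - 1) / (12 * 4 ^ k) * (ν * p.a2 - p'.a2) := by
          rw [pow_succ]; field_simp; ring
        rw [this, hν]
        exact mul_ne_zero (div_ne_zero h4k (by simp)) hcross
      filter_upwards [h1.eventually_ne h2] with u hu h3
      apply hu
      rw [h3, hν]
      field_simp
      ring
    have hu1 : ∀ᶠ u in Bornology.cobounded ℂ, u ≠ (1:ℂ) := by
      have := (Asy.base (one_ne_zero : (1:ℂ) ≠ 0)).ne 1
      simpa using this
    filter_upwards [hdiff, hu1, aA.2.1, aA.ne μ, aG.2.1, aH.2.1, aA1.2.1, aA2.2.1, aG1.2.1, aH1.2.1] with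
      u hdu hu1 bA neA bG bH bA1 bA2 bG1 bH1
    refine ⟨hu1, ?_, ?_⟩
    · intro h0
      apply hdu
      have h1 : ((fG u).1 * (fH u).2.1 - (fH u).1 * (fG u).2.1) ^ 2 = 0 := by
        rw [← h0]; simp [KB, eG1, eG2, eH1, eH2]
      have h2 := sub_eq_zero.1 (pow_eq_zero_iff two_ne_zero |>.1 h1)
      rw [div_eq_div_iff bG bH]
      exact h2
    · obtain ⟨u2, hu2⟩ : ∃ u2, u2 = (fA u).1 / (fA u).2.1 / μ := ⟨_, rfl⟩
      have hu21 : u2 ≠ 1 := by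
        rw [hu2]; intro h0
        apply neA
        field_simp at h0 ⊢
        linear_combination h0
      have r1 : Pr (μ * u2, 1, 0) (fA u) := by
        refine ⟨1 / (fA u).2.1, by simpa using bA, ?_, ?_⟩
        · simp only [hu2]; field_simp
        · simp only; field_simp
      have r2 : Pr (μ' * u2, 1, 0) (ν * (fA u).1, (fA u).2.1, 0) := by
        refine ⟨1 / (fA u).2.1, by simpa using bA, ?_, ?_⟩
        · simp only [hu2, hν]; field_simp
        · simp only; field_simp
      have k1 := hpar u hu1 k
      have k2 := (hpar u2 hu21 0).trans (r1.dup _ _)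
      have k1' := hpar' u hu1 k
      have k2' := (hpar' u2 hu21 0).trans (r2.dup _ _)
      have hk1 : (dup (p.a2 : ℂ) p.a4)^[k + 1] (μ * u, 1, 0) = dup (p.a2 : ℂ) p.a4 (fA u) := by
        rw [hfA, Function.iterate_succ_apply']
      rw [hk1] at k1
      have hk1' : (dup (p'.a2 : ℂ) p'.a4)^[k + 1] (μ' * u, 1, 0) = fG u := by rw [hfG]
      rw [hk1'] at k1'
      have hk2' : dup (p'.a2 : ℂ) p'.a4 (ν * (fA u).1, (fA u).2.1, 0) = fH u := by rw [hfH]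
      rw [hk2'] at k2'
      obtain ⟨l1, hl1, i1, i2⟩ := id k1'
      obtain ⟨l2, hl2, i3, i4⟩ := id k2'
      have hB0 : p.B k (xu p.t s u) (xu p.t s u2) = 0 := by
        obtain ⟨l1, hl1, i1, i2⟩ := k1
        obtain ⟨l2, hl2, i3, i4⟩ := k2
        rw [Prm.B, KB, i1, i2, i3, i4]; ring
      refine ⟨xu p.t s u2, l1 ^ 2 * l2 ^ 2, mul_ne_zero (pow_ne_zero _ hl1) (pow_ne_zero _ hl2), hB0, ?_, ?_, ?_, ?_, ?_, ?_⟩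
      · have hc1 := cub_pr k1 (cub_of_dup bA2)
        have hc2 := cub_pr k2 (cub_of_dup bA2)
        intro hS0
        have hK := Kummer_rel (p.a2 : ℂ) p.a4 (p.sk k (xu p.t s u)).1 (p.sk k (xu p.t s u)).2.1
          (p.sk 0 (xu p.t s u2)).1 (p.sk 0 (xu p.t s u2)).2.1
        rw [Prm.S] at hS0
        rw [Prm.B] at hB0
        rw [hS0, hB0] at hK
        apply mul_ne_zero hc1 hc2
        linear_combination (-1/4) * hK
      · rw [Prm.B, i1, i2, i3, i4]; simp [KB, eG1, eG2, eH1, eH2]; ring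
      · rw [Prm.S, i1, i2, i3, i4]; simp [KS, eG1, eG2, eH1, eH2]; ring
      · rw [Prm.C, i1, i2, i3, i4]; simp [KC, eG1, eG2, eH1, eH2]; ring
      · exact cub_pr k1' (cub_of_dup bG1)
      · exact cub_pr k2' (cub_of_dup bH1)

end geom3

end PartP5d3

section PartP5e

section gauss
open Polynomial

lemma pseudo_div (b s c : ℂ[X]) (g : ℂ[X][X]) : ∃ (m : ℕ) (h : ℂ[X][X]) (r1 r0 : ℂ[X]),
    C (b ^ m) * g = (C b * X ^ 2 - C (2 * s) * X + C c) * h + C r1 * X + C r0 := by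
  induction g using Polynomial.induction_on with
  | C a => exact ⟨0, 0, 0, a, by simp⟩
  | add g1 g2 h1 h2 =>
    obtain ⟨m1, h1, r1, r0, e1⟩ := h1
    obtain ⟨m2, h2, r1', r0', e2⟩ := h2
    refine ⟨m1 + m2, C (b ^ m2) * h1 + C (b ^ m1) * h2, b ^ m2 * r1 + b ^ m1 * r1', b ^ m2 * r0 + b ^ m1 * r0', ?_⟩
    rw [pow_add]
    simp only [C_add, C_mul] at *
    linear_combination C (b ^ m2) * e1 + C (b ^ m1) * e2
  | monomial i a h =>
    obtain ⟨m, h, r1, r0, e⟩ := h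
    refine ⟨m + 1, C b * X * h + C r1, 2 * s * r1 + b * r0, -(c * r1), ?_⟩
    rw [pow_succ, pow_succ]
    simp only [C_add, C_mul, C_neg, map_ofNat] at *
    linear_combination C b * X * e

lemma cancel_prim (b s c : ℂ[X]) (hnc : ∀ u, ¬ (b.eval u = 0 ∧ s.eval u = 0 ∧ c.eval u = 0)) (w : ℂ[X]) (hw : w ≠ 0) :
    ∀ g h : ℂ[X][X], C w * g = (C b * X ^ 2 - C (2 * s) * X + C c) * h →
      (C b * X ^ 2 - C (2 * s) * X + C c) ∣ g := by
  induction w using UniqueFactorizationMonoid.induction_on_prime with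
  | h₁ => exact absurd rfl hw
  | h₂ w hu =>
    intro g h e
    have hu' : IsUnit (C w : ℂ[X][X]) := hu.map C
    exact (hu'.dvd_mul_left (b := g)).1 ⟨h, e⟩
  | h₃ a π ha hp ih =>
    intro g h e
    have hd : C π ∣ (C b * X ^ 2 - C (2 * s) * X + C c) * h := by
      rw [← e, C_mul, mul_assoc]; exact dvd_mul_right _ _
    have hpp : Prime (C π : ℂ[X][X]) := Polynomial.prime_C_iff.2 hp
    rcases hpp.dvd_or_dvd hd with h1 | ⟨h', rfl⟩
    · exfalso
      rw [C_dvd_iff_dvd_coeff] at h1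
      have d0 := h1 0
      have d1 := h1 1
      have d2 := h1 2
      simp [coeff_X, coeff_C, coeff_X_pow] at d0 d1 d2
      have hdeg : π.degree ≠ 0 := by
        intro h0
        exact hp.not_unit (isUnit_iff_degree_eq_zero.2 h0)
      obtain ⟨u, hu⟩ := IsAlgClosed.exists_root π hdeg
      have ev : ∀ q, π ∣ q → q.eval u = 0 := by
        rintro q ⟨q', rfl⟩
        rw [eval_mul, hu.eq_zero, zero_mul]
      refine hnc u ⟨ev _ d2, ?_, ev _ d0⟩
      have := ev _ d1
      simpa using this
    · refine ih (right_ne_zero_of_mul hw) g h' ?_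
      have hπ : (C π : ℂ[X][X]) ≠ 0 := hpp.ne_zero
      apply mul_left_cancel₀ hπ
      rw [C_mul] at e
      linear_combination e

lemma gauss_quad (b s c : ℂ[X]) (hnc : ∀ u, ¬ (b.eval u = 0 ∧ s.eval u = 0 ∧ c.eval u = 0))
    (g : ℂ[X][X]) (hg : g ≠ 0) (d : ℕ) (hdeg : ∀ l, (g.coeff l).natDegree ≤ d) (hc : d < c.natDegree)
    (U : Set ℂ) (hU : U.Infinite) (hvan : ∀ u ∈ U, b.eval u ≠ 0 ∧ ∃ t1 t2 : ℂ, t1 ≠ t2 ∧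
      ∀ t, (t = t1 ∨ t = t2) → b.eval u * t ^ 2 - 2 * s.eval u * t + c.eval u = 0 ∧ (g.map (evalRingHom u)).eval t = 0) : False := by
  obtain ⟨m, h, r1, r0, e⟩ := pseudo_div b s c g
  have key : ∀ u ∈ U, r1.eval u = 0 ∧ r0.eval u = 0 := by
    intro u hu
    obtain ⟨-, t1, t2, hne, ht⟩ := hvan u hu
    have hz : ∀ t, (t = t1 ∨ t = t2) → r1.eval u * t + r0.eval u = 0 := by
      intro t htt
      obtain ⟨h1, h2⟩ := ht t htt
      have e' := congrArg (fun z => (z.map (evalRingHom u)).eval t) e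
      simp only [Polynomial.map_mul, Polynomial.map_add, Polynomial.map_sub, Polynomial.map_pow, map_C, map_X, eval_mul, eval_add,
        eval_sub, eval_C, eval_pow, eval_X, coe_evalRingHom, h2, eval_ofNat] at e'
      linear_combination -e' - (h.map (evalRingHom u)).eval t * h1
    have z1 := hz t1 (Or.inl rfl)
    have z2 := hz t2 (Or.inr rfl)
    have hr1 : r1.eval u = 0 := by
      have : r1.eval u * (t1 - t2) = 0 := by linear_combination z1 - z2
      exact (mul_eq_zero.1 this).resolve_right (sub_ne_zero.2 hne)
    exact ⟨hr1, by rw [hr1] at z1; linear_combination z1⟩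
  have zero_of : ∀ r : ℂ[X], (∀ u ∈ U, r.eval u = 0) → r = 0 := fun r hr =>
    Polynomial.eq_zero_of_infinite_isRoot r (hU.mono fun u hu => hr u hu)
  have hr1 := zero_of r1 fun u hu => (key u hu).1
  have hr0 := zero_of r0 fun u hu => (key u hu).2
  obtain ⟨u, hu⟩ := hU.nonempty
  have hb : b ≠ 0 := by rintro rfl; simpa using (hvan u hu).1
  rw [hr1, hr0] at e
  obtain ⟨h', rfl⟩ := cancel_prim b s c hnc (b ^ m) (pow_ne_zero _ hb) g h (by rw [e]; simp)
  have hc0 : c ≠ 0 := by rintro rfl; simp at hc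
  have tc := trailingCoeff_mul (C b * X ^ 2 - C (2 * s) * X + C c) h'
  have tq : (C b * X ^ 2 - C (2 * s) * X + C c).trailingCoeff = c := by
    have c0 : (C b * X ^ 2 - C (2 * s) * X + C c).coeff 0 = c := by simp
    rw [trailingCoeff_eq_coeff_zero (by rw [c0]; exact hc0), c0]
  rw [tq] at tc
  have h0 : ((C b * X ^ 2 - C (2 * s) * X + C c) * h').trailingCoeff ≠ 0 := trailingCoeff_nonzero_iff_nonzero.2 hg
  have hl := hdeg ((C b * X ^ 2 - C (2 * s) * X + C c) * h').natTrailingDegree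
  change natDegree (trailingCoeff _) ≤ d at hl
  have := natDegree_le_of_dvd ⟨_, tc⟩ h0
  omega
end gauss

end PartP5e

section PartP6

section siegel

attribute [local instance] Matrix.seminormedAddCommGroup in
lemma siegel_simple {α β : Type*} [Fintype α] [Fintype β] (A : Matrix α β ℤ)
    (h : 2 * Fintype.card α ≤ Fintype.card β) (hm : 0 < Fintype.card α) (M : ℝ) (hM : 1 ≤ M)
    (hA : ∀ i j, |(A i j : ℝ)| ≤ M) :
    ∃ t : β → ℤ, t ≠ 0 ∧ A.mulVec t = 0 ∧ ∀ j, |(t j : ℝ)| ≤ Fintype.card β * M := by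
  obtain ⟨t, h0, h1, h2⟩ := Int.Matrix.exists_ne_zero_int_vec_norm_le A (by omega) hm
  refine ⟨t, h0, h1, fun j => ?_⟩
  have hN : ‖A‖ ≤ M := by
    rw [Matrix.norm_le_iff (by linarith)]
    intro i j
    rw [Int.norm_eq_abs]; exact hA i j
  have h3 : |(t j : ℝ)| ≤ ‖t‖ := by
    rw [← Int.norm_eq_abs]; exact norm_le_pi_norm t j
  have hh : (2 : ℝ) * Fintype.card α ≤ Fintype.card β := by exact_mod_cast h
  have hm' : (0 : ℝ) < Fintype.card α := by exact_mod_cast hm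
  have hb : (1 : ℝ) ≤ Fintype.card β := by
    have : 1 ≤ Fintype.card β := by omega
    exact_mod_cast this
  have hbase : 1 ≤ (Fintype.card β : ℝ) * max 1 ‖A‖ :=
    one_le_mul_of_one_le_of_one_le hb (le_max_left _ _)
  refine h3.trans (h2.trans ?_)
  calc _ ≤ ((Fintype.card β : ℝ) * max 1 ‖A‖) ^ (1 : ℝ) := by
        apply Real.rpow_le_rpow_of_exponent_le hbase
        rw [div_le_one (by linarith)]
        linarith
    _ ≤ _ := by
        rw [Real.rpow_one]
        gcongr
        exact max_le hM hN

variable (p p' : Prm)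

/-- generic term -/
noncomputable def tm (k n : ℕ) (e e' : Bool) (q : Idx k n) : R2 p p' :=
  gx p p' ^ (q.1 : ℕ) * Uf p k n e (gx p p') (gy p p') (gW p p') q.2.1 * Uf p' k n e' (gx p p') (gy p p') (gV p p') q.2.2

/-- generic auxiliary form -/
noncomputable def gpol (k n : ℕ) (c : Idx k n → ℤ) (e e' : Bool) : R2 p p' :=
  pol p p' k n c e e' (gx p p') (gy p p') (gW p p') (gV p p')

lemma gpol_eq (k n : ℕ) (c : Idx k n → ℤ) (e e' : Bool) :
    gpol p p' k n c e e' = ∑ q, c q • tm p p' k n e e' q := by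
  simp only [gpol, pol, tm]
  refine Finset.sum_congr rfl fun q _ => ?_
  rw [zsmul_eq_mul]; ring

lemma coef_gpol (k n : ℕ) (c : Idx k n → ℤ) (e e' : Bool) (s i j) :
    coef (gpol p p' k n c e e') s i j = ∑ q, coef (tm p p' k n e e' q) s i j * c q := by
  have : ∀ z, coef z s i j = coefHom p p' s i j z := fun _ => rfl
  rw [gpol_eq, this, map_sum]
  refine Finset.sum_congr rfl fun q _ => ?_
  rw [map_zsmul, this, smul_eq_mul, mul_comm]

lemma deg_aux (a M : ℝ) (hM : 1 ≤ M) (ha : 1 ≤ a) (i d : ℕ) (h : ∀ ρ : NNReal, 1 ≤ ρ → a * ρ ^ i ≤ M * ρ ^ d) : i ≤ d := by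
  by_contra hid
  push Not at hid
  obtain ⟨e, rfl⟩ := Nat.exists_eq_add_of_le (Nat.succ_le_of_lt hid)
  obtain ⟨ρ, hρ⟩ : ∃ ρ : NNReal, (ρ : ℝ) = M + 1 := ⟨⟨M + 1, by linarith⟩, rfl⟩
  have h1 := h ρ (by rw [← NNReal.coe_le_coe, hρ]; simp; linarith)
  rw [hρ] at h1
  have : (0 : ℝ) < (M + 1) ^ d := by positivity
  have h2 : (1 : ℝ) ≤ (M + 1) ^ e := one_le_pow₀ (by linarith)
  rw [Nat.succ_eq_add_one, pow_add, pow_add, pow_one] at h1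
  have h3 : a * ((M + 1) * (M + 1) ^ e) ≤ M := by
    by_contra hc
    push Not at hc
    nlinarith
  have h4 : M + 1 ≤ (M + 1) * (M + 1) ^ e := le_mul_of_one_le_right (by linarith) h2
  nlinarith

lemma term_coef (n : ℕ) : ∃ K : ℝ, 1 ≤ K ∧
    (∀ k e e' (q : Idx k n) s i j, |(coef (tm p p' k n e e' q) s i j : ℝ)| ≤ K ^ 4 ^ k ∧
      (coef (tm p p' k n e e' q) s i j ≠ 0 → i ≤ (16 * n + 1) * 4 ^ k ∧ j ≤ 16 * n)) ∧
    (∀ k (c : Idx k n → ℤ) (M : ℝ), (∀ q, |(c q : ℝ)| ≤ M) → ∀ ρ ρ' : NNReal, 1 ≤ ρ → 1 ≤ ρ' →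
      pnorm (pnorm zν ρ) ρ' (NN p p' (gpol p p' k n c false false)) ≤
        (Fintype.card (Idx k n) * M * (K ^ 4 ^ k * ρ ^ ((16 * n + 1) * 4 ^ k) * ρ' ^ (16 * n))) ^ 4) := by
  obtain ⟨K, hK, h⟩ := R2_bound p p' n
  refine ⟨K, hK, ?_, ?_⟩
  · intro k e e' q s i j
    have key : ∀ ρ ρ' : NNReal, 1 ≤ ρ → 1 ≤ ρ' → |(coef (tm p p' k n e e' q) s i j : ℝ)| * ρ ^ i * ρ' ^ j ≤
        K ^ 4 ^ k * ρ ^ ((16 * n + 1) * 4 ^ k) * ρ' ^ (16 * n) := by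
      intro ρ ρ' hρ hρ'
      obtain ⟨ν, -, h2, h3, -⟩ := h ρ ρ' hρ hρ'
      exact (h3 _ s i j).trans (h2 k q e e')
    have hKk : 1 ≤ K ^ 4 ^ k := one_le_pow₀ hK
    constructor
    · simpa using key 1 1 le_rfl le_rfl
    · intro hne
      have h1 : (1 : ℝ) ≤ |(coef (tm p p' k n e e' q) s i j : ℝ)| := by
        exact_mod_cast Int.one_le_abs hne
      constructor
      · refine deg_aux _ _ hKk h1 _ _ fun ρ hρ => ?_
        simpa using key ρ 1 hρ le_rfl
      · refine deg_aux _ _ hKk h1 _ _ fun ρ hρ => ?_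
        simpa using key 1 ρ le_rfl hρ
  · intro k c M hc ρ ρ' hρ hρ'
    obtain ⟨ν, h1, h2, -, h4⟩ := h ρ ρ' hρ hρ'
    refine (h4 _).trans (pow_le_pow_left₀ (apply_nonneg _ _) ?_ 4)
    rw [gpol_eq]
    refine (seminorm_sum_le _ _ _).trans ?_
    have : ∀ q ∈ Finset.univ, ν (c q • tm p p' k n false false q) ≤ M * (K ^ 4 ^ k * ρ ^ ((16 * n + 1) * 4 ^ k) * ρ' ^ (16 * n)) := by
      intro q _
      rw [zsmul_eq_mul]
      exact sn_mul ((sn_int h1 _).trans (hc q)) (h2 k q false false)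
    refine (Finset.sum_le_card_nsmul _ _ _ this).trans (le_of_eq ?_)
    rw [nsmul_eq_mul, Finset.card_univ]; ring

lemma siegel (n : ℕ) (hn : 11000 ≤ n) : ∃ K : ℝ, 1 ≤ K ∧ ∀ k, ∃ c : Idx k n → ℤ, c ≠ 0 ∧
    (∀ e e' s i j, |(coef (gpol p p' k n c e e') s i j : ℝ)| ≤ K ^ 4 ^ k ∧
      (coef (gpol p p' k n c e e') s i j ≠ 0 → i + 4 ≤ 16 * (n - 1) * 4 ^ k ∧ j ≤ 16 * n)) ∧
    (∀ ρ ρ' : NNReal, 1 ≤ ρ → 1 ≤ ρ' →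
      pnorm (pnorm zν ρ) ρ' (NN p p' (gpol p p' k n c false false)) ≤
        (K ^ 4 ^ k * ρ ^ ((16 * n + 1) * 4 ^ k) * ρ' ^ (16 * n)) ^ 4) := by
  obtain ⟨K, hK, hco, hNN⟩ := term_coef p p' n
  have hcard : ∀ k, (Fintype.card (Idx k n) : ℝ) = 4 ^ k * (n + 1) ^ 2 := by
    intro k
    simp [Idx]; ring
  refine ⟨(4 * (n + 1) ^ 2) ^ 2 * K ^ 2, ?_, fun k => ?_⟩
  · have : (1 : ℝ) ≤ 4 * (n + 1) ^ 2 := by nlinarith [(Nat.cast_nonneg n : (0 : ℝ) ≤ n)]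
    exact one_le_mul_of_one_le_of_one_le (one_le_pow₀ this) (one_le_pow₀ hK)
  obtain ⟨N, hN⟩ : ∃ N, N = 4 ^ k := ⟨_, rfl⟩
  have hN1 : 1 ≤ N := hN ▸ Nat.one_le_pow _ _ (by norm_num)
  have hKk : 1 ≤ K ^ 4 ^ k := one_le_pow₀ hK
  have hcb : (Fintype.card (Idx k n) : ℝ) ≤ (4 * (n + 1) ^ 2) ^ 4 ^ k := by
    rw [hcard, mul_pow]
    have hlt : (4 : ℝ) ^ k ≤ 4 ^ 4 ^ k := by
      apply pow_le_pow_right₀ (by norm_num)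
      exact (Nat.lt_pow_self (by norm_num)).le
    have h2 : ((n : ℝ) + 1) ^ 2 ≤ (((n : ℝ) + 1) ^ 2) ^ 4 ^ k :=
      le_self_pow₀ (one_le_pow₀ (by linarith [(Nat.cast_nonneg n : (0 : ℝ) ≤ n)])) (by positivity)
    gcongr
  let α := (Bool × Bool) × (Bool × Bool) × Fin (17 * N + 4) × Fin (16 * n + 1)
  let A : Matrix α (Idx k n) ℤ := Matrix.of fun r q =>
    coef (tm p p' k n r.1.1 r.1.2 q) r.2.1 (16 * (n - 1) * N - 3 + r.2.2.1) r.2.2.2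
  have hα : Fintype.card α = 16 * ((17 * N + 4) * (16 * n + 1)) := by
    simp [α]; ring
  have hβ : Fintype.card (Idx k n) = N * ((n + 1) * (n + 1)) := by simp [Idx, hN]
  obtain ⟨c, hc0, hAc, hcb2⟩ := siegel_simple A (by
      rw [hα, hβ]
      have : (17 * N + 4) ≤ 21 * N := by omega
      calc 2 * (16 * ((17 * N + 4) * (16 * n + 1))) ≤ 2 * (16 * ((21 * N) * (16 * n + 1))) := by gcongr
        _ = N * (672 * (16 * n + 1)) := by ring
        _ ≤ _ := by
          exact Nat.mul_le_mul_left _ (by nlinarith)) (by rw [hα]; positivity) (K ^ 4 ^ k) hKk (fun r q => (hco k _ _ q _ _ _).1)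
  have fin : (Fintype.card (Idx k n) : ℝ) * (Fintype.card (Idx k n) * K ^ 4 ^ k) * K ^ 4 ^ k ≤
      ((4 * (n + 1) ^ 2) ^ 2 * K ^ 2) ^ 4 ^ k := by
    calc _ ≤ ((4 * ((n : ℝ) + 1) ^ 2) ^ 4 ^ k) * (((4 * ((n : ℝ) + 1) ^ 2) ^ 4 ^ k) * K ^ 4 ^ k) * K ^ 4 ^ k := by gcongr
      _ = _ := by simp only [mul_pow, ← pow_mul]; ring
  refine ⟨c, hc0, ?_, ?_⟩
  · intro e e' s i j
    have sum_b : |(coef (gpol p p' k n c e e') s i j : ℝ)| ≤ Fintype.card (Idx k n) * (K ^ 4 ^ k * (Fintype.card (Idx k n) * K ^ 4 ^ k)) := by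
      rw [coef_gpol]
      push_cast
      refine (Finset.abs_sum_le_sum_abs _ _).trans ?_
      refine (Finset.sum_le_card_nsmul _ _ (K ^ 4 ^ k * (Fintype.card (Idx k n) * K ^ 4 ^ k)) ?_).trans (le_of_eq ?_)
      · intro q _
        rw [abs_mul]
        exact mul_le_mul (hco k e e' q s i j).1 (hcb2 q) (abs_nonneg _) (by positivity)
      · rw [nsmul_eq_mul, Finset.card_univ]
    refine ⟨sum_b.trans (le_trans (le_of_eq (by ring)) fin), fun hne => ?_⟩
    have hex : ∃ q, coef (tm p p' k n e e' q) s i j ≠ 0 := by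
      by_contra hcon
      push Not at hcon
      apply hne
      rw [coef_gpol]
      exact Finset.sum_eq_zero fun q _ => by rw [hcon q, zero_mul]
    obtain ⟨q, hq⟩ := hex
    obtain ⟨d1, d2⟩ := (hco k e e' q s i j).2 hq
    refine ⟨?_, d2⟩
    rw [← hN] at d1 ⊢
    by_contra hcon
    push Not at hcon
    apply hne
    rw [coef_gpol]
    have hn1 : 16 * n * N = 16 * (n - 1) * N + 16 * N := by
      obtain ⟨m, rfl⟩ : ∃ m, n = m + 1 := ⟨n - 1, by omega⟩
      simp; ring
    have hbig : 4 ≤ 16 * (n - 1) * N := by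
      have : 1 ≤ (n - 1) * N := Nat.one_le_iff_ne_zero.2 (Nat.mul_ne_zero (by omega) (by omega))
      nlinarith
    have d3 : i ≤ 16 * (n - 1) * N + 17 * N := by
      have : (16 * n + 1) * N = 16 * n * N + N := by ring
      omega
    have hi : i - (16 * (n - 1) * N - 3) < 17 * N + 4 := by omega
    have hr := congrFun hAc ((e, e'), s, ⟨i - (16 * (n - 1) * N - 3), hi⟩, ⟨j, by omega⟩)
    simp only [Matrix.mulVec, dotProduct, A, Matrix.of_apply, Pi.zero_apply] at hr
    rw [show 16 * (n - 1) * N - 3 + (i - (16 * (n - 1) * N - 3)) = i by omega] at hr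
    exact hr
  · intro ρ ρ' hρ hρ'
    refine (hNN k c _ hcb2 ρ ρ' hρ hρ').trans ?_
    refine pow_le_pow_left₀ (by positivity) ?_ 4
    calc _ = (Fintype.card (Idx k n) : ℝ) * (Fintype.card (Idx k n) * K ^ 4 ^ k) * K ^ 4 ^ k * (ρ ^ ((16 * n + 1) * 4 ^ k) * ρ' ^ (16 * n)) := by ring
      _ ≤ ((4 * (n + 1) ^ 2) ^ 2 * K ^ 2) ^ 4 ^ k * (ρ ^ ((16 * n + 1) * 4 ^ k) * ρ' ^ (16 * n)) := by gcongr
      _ = _ := by ring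
end siegel

end PartP6

section PartP5f

section indep
open Polynomial

noncomputable def evC (x y : ℂ) : ℤ[X][X] →+* ℂ := eval₂RingHom (eval₂RingHom (Int.castRingHom ℂ) x) y
lemma evC_x (x y : ℂ) : evC x y (C X) = x := by simp [evC]
lemma evC_y (x y : ℂ) : evC x y X = y := by simp [evC]
lemma evC_fS (p : Prm) (x y : ℂ) : evC x y (fS p) = p.F x * p.F y := by
  rw [fS, map_mul, p.map_F (evC x y), p.map_F (evC x y), evC_x, evC_y]

lemma B_gen_ne (p : Prm) (hb : 0 < p.b) (hδ : p.δ ≠ 0) (hT : p.t ≠ p.t') (k : ℕ) : p.B k (C X : ℤ[X][X]) X ≠ 0 := by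
  intro h0
  have hz : ∀ x y : ℂ, p.B k x y = 0 := by
    intro x y
    have := congrArg (evC x y) h0
    rwa [p.map_B (evC x y), evC_x, evC_y, map_zero] at this
  obtain ⟨s, hs, hs0, hre⟩ := exists_s p.b hb
  have hμ := muP_ne p hb hδ hT s hs
  have h4 : (p.a4 : ℂ) ≠ 0 := by exact_mod_cast a4_ne p hb hδ hT
  have hd : (p.a2 : ℂ) ^ 2 - 4 * p.a4 ≠ 0 := by exact_mod_cast disc_ne p hb hδ
  have n1 : NZ (p.sk k (xu p.t s 0)) :=
    (NZ.iter (by simp [NZ]) h4 hd (k + 1)).pr (sk_param p hb hδ hT s hs 0 (by norm_num) k)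
  have hB : ∀ y : ℂ, (p.sk k (xu p.t s 0)).1 * (p.sk 0 y).2.1 = (p.sk 0 y).1 * (p.sk k (xu p.t s 0)).2.1 := by
    intro y
    exact sub_eq_zero.1 (pow_eq_zero_iff two_ne_zero |>.1 (hz (xu p.t s 0) y))
  obtain ⟨l1, hl1, e1, e2⟩ := sk_param p hb hδ hT s hs 0 (by norm_num) 0
  have h1 := hB (xu p.t s 0)
  rw [e1, e2] at h1
  simp [dup, hl1, h4] at h1
  obtain ⟨w, hw⟩ := IsAlgClosed.exists_eq_mul_self (p.a4 : ℂ)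
  obtain ⟨v, hv1, hv⟩ : ∃ v : ℂ, v ≠ 1 ∧ (muP p s * v) ^ 2 = p.a4 := by
    by_cases h : w / muP p s = 1
    · refine ⟨-1, by norm_num, ?_⟩
      have : w = muP p s := by field_simp at h; exact h
      rw [hw, this]; ring
    · refine ⟨_, h, ?_⟩
      rw [hw]; field_simp
  have n2 : NZ (p.sk 0 (xu p.t s v)) :=
    (NZ.iter (by simp [NZ]) h4 hd (0 + 1)).pr (sk_param p hb hδ hT s hs v hv1 0)
  obtain ⟨l2, hl2, e3, e4⟩ := sk_param p hb hδ hT s hs v hv1 0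
  have hα : (p.sk 0 (xu p.t s v)).1 = 0 := by
    rw [e3]; simp [dup, hv]
  have h2 := hB (xu p.t s v)
  rw [hα, zero_mul] at h2
  rcases mul_eq_zero.1 h2 with h | h
  · exact n1 ⟨h, h1⟩
  · exact n2 ⟨hα, h⟩

lemma indep (p p' : Prm) (hb : 0 < p.b) (hb' : p'.b = p.b) (ht : p'.t = p.t) (hδ : p.δ ≠ 0) (hδ' : p'.δ ≠ 0)
    (hT : p.t ≠ p.t') (hT1 : p'.t ≠ p'.t') (hT' : p.t' ≠ p'.t') (k n : ℕ) (hk : 1 ≤ k) (c : Idx k n → ℤ) (hc : c ≠ 0) :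
    gpol p p' k n c false false ≠ 0 := by
  intro h0
  -- maximal j
  obtain ⟨j0, hj0, hmax⟩ : ∃ j0 : Fin (n + 1), (∃ i l, c (i, j0, l) ≠ 0) ∧ ∀ i j l, c (i, j, l) ≠ 0 → j ≤ j0 := by
    classical
    obtain ⟨q, hq⟩ := Function.ne_iff.1 hc
    have hne : (Finset.univ.filter fun j : Fin (n + 1) => ∃ i l, c (i, j, l) ≠ 0).Nonempty :=
      ⟨q.2.1, by simp only [Finset.mem_filter, Finset.mem_univ, true_and]; exact ⟨q.1, q.2.2, hq⟩⟩
    refine ⟨_, (Finset.mem_filter.1 (Finset.max'_mem _ hne)).2, fun i j l h => Finset.le_max' _ _ ?_⟩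
    simp only [Finset.mem_filter, Finset.mem_univ, true_and]; exact ⟨i, l, h⟩
  obtain ⟨Sg, hSg⟩ : ∃ z : R2 p p', z = ∑ q : Idx k n, (c q : R2 p p') * gx p p' ^ (q.1 : ℕ) *
      (Am p k (gx p p') (gy p p') (gW p p') ^ (q.2.1 : ℕ) * p.B k (gx p p') (gy p p') ^ ((j0 : ℕ) - q.2.1)) *
      Uf p' k n false (gx p p') (gy p p') (gV p p') q.2.2 := ⟨_, rfl⟩
  have hgB : p.B k (gx p p') (gy p p') = gS p p' (p.B k (C X : ℤ[X][X]) X) := by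
    rw [gx, gy, ← p.map_B (gS p p')]
  have hfac : gpol p p' k n c false false = gS p p' (p.B k (C X : ℤ[X][X]) X ^ (n - j0)) * Sg := by
    rw [hSg, gpol, pol, map_pow, ← hgB, Finset.mul_sum]
    refine Finset.sum_congr rfl fun q _ => ?_
    by_cases hq : c q = 0
    · rw [hq]; simp
    have h1 : (q.2.1 : ℕ) ≤ j0 := hmax q.1 q.2.1 q.2.2 hq
    have h2 : (j0 : ℕ) ≤ n := Nat.lt_succ_iff.1 j0.2
    have h3 : n - (q.2.1 : ℕ) = (n - j0) + (j0 - q.2.1) := by omega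
    rw [show Uf p k n false (gx p p') (gy p p') (gW p p') q.2.1 =
      Am p k (gx p p') (gy p p') (gW p p') ^ (q.2.1 : ℕ) * p.B k (gx p p') (gy p p') ^ (n - (q.2.1 : ℕ)) from rfl, h3, pow_add]
    ring
  have hS0 : Sg = 0 := by
    refine cmp4_ext p p' fun s => ?_
    have h1 := cmp4_gS_mul p p' (p.B k (C X : ℤ[X][X]) X ^ (n - j0)) Sg s
    rw [← hfac, h0, cmp4_zero] at h1
    exact (mul_eq_zero.1 h1.symm).resolve_left (pow_ne_zero _ (B_gen_ne p hb hδ hT k))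
  -- evaluation
  have hev : ∀ x1 x2 W V : ℂ, W * W = p.F x1 * p.F x2 → V * V = p'.F x1 * p'.F x2 → p.B k x1 x2 = 0 →
      Am p k x1 x2 W ≠ 0 → p'.B k x1 x2 ≠ 0 →
      ∑ l : Fin (n + 1), (∑ i : Fin (4 ^ k), (c (i, j0, l) : ℂ) * x1 ^ (i : ℕ)) * (Am p' k x1 x2 V / p'.B k x1 x2) ^ (l : ℕ) = 0 := by
    intro x1 x2 W V hW hV hB hA hB'
    have h1 := congrArg (evR p p' (evC x1 x2) W V (by rw [evC_fS, hW]) (by rw [evC_fS, hV])) hS0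
    rw [hSg, map_zero, map_sum] at h1
    simp only [map_mul, map_pow, map_intCast, map_Am, map_Uf, p.map_B, evR_gx, evR_gy, evR_gW, evR_gV, evC_x, evC_y, hB] at h1
    have h2 : ∑ q : Idx k n, (c q : ℂ) * x1 ^ (q.1 : ℕ) * (Am p k x1 x2 W ^ (q.2.1 : ℕ) * 0 ^ ((j0 : ℕ) - q.2.1)) *
        Uf p' k n false x1 x2 V q.2.2 = (Am p k x1 x2 W ^ (j0 : ℕ) * p'.B k x1 x2 ^ n) *
        ∑ l : Fin (n + 1), (∑ i : Fin (4 ^ k), (c (i, j0, l) : ℂ) * x1 ^ (i : ℕ)) * (Am p' k x1 x2 V / p'.B k x1 x2) ^ (l : ℕ) := by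
      rw [Fintype.sum_prod_type, Finset.mul_sum]
      simp only [Fintype.sum_prod_type]
      simp only [Finset.sum_mul, Finset.mul_sum]
      rw [Finset.sum_comm, Finset.sum_eq_single j0]
      · rw [Finset.sum_comm]
        refine Finset.sum_congr rfl fun l _ => Finset.sum_congr rfl fun i _ => ?_
        have hl : (l : ℕ) ≤ n := Nat.lt_succ_iff.1 l.2
        simp only [Uf, Nat.sub_self, pow_zero, mul_one]
        rw [div_pow]
        have : p'.B k x1 x2 ^ n = p'.B k x1 x2 ^ (n - (l : ℕ)) * p'.B k x1 x2 ^ (l : ℕ) := by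
          rw [← pow_add]; congr 1; omega
        rw [this]
        field_simp
      · intro j _ hj
        refine Finset.sum_eq_zero fun i _ => Finset.sum_eq_zero fun l _ => ?_
        by_cases hq : c (i, j, l) = 0
        · simp [hq]
        have h3 : (j : ℕ) ≤ j0 := hmax i j l hq
        have h4 : (j : ℕ) ≠ j0 := fun h => hj (Fin.ext h)
        have h5 : (j0 : ℕ) - j ≠ 0 := by omega
        simp [zero_pow h5]
      · simp
    rw [h2] at h1
    exact (mul_eq_zero.1 h1).resolve_left (mul_ne_zero (pow_ne_zero _ hA) (pow_ne_zero _ hB'))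
  obtain ⟨s, hs, hs0, hre⟩ := exists_s p.b hb
  obtain ⟨b, S, cc, hnc, hdeg, hinf⟩ := geom p p' hb hb' ht hδ hδ' hT hT1 hT' s hs hre k hk
  obtain ⟨gl, hgl⟩ : ∃ gl : Fin (n + 1) → ℂ[X], gl = fun l => ∑ i : Fin (4 ^ k), C (c (i, j0, l) : ℂ) *
    ((C (2 * p.t + s) * X - C (2 * p.t - s)) ^ (i : ℕ) * (X - C 1) ^ (4 ^ k - 1 - (i : ℕ))) := ⟨_, rfl⟩
  have hgle : ∀ l u, u ≠ 1 → (gl l).eval u = (u - 1) ^ (4 ^ k - 1) * ∑ i : Fin (4 ^ k), (c (i, j0, l) : ℂ) * (xu p.t s u) ^ (i : ℕ) := by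
    intro l u hu
    have hu1 : u - 1 ≠ 0 := sub_ne_zero.2 hu
    rw [hgl, eval_finset_sum, Finset.mul_sum]
    refine Finset.sum_congr rfl fun i _ => ?_
    simp only [eval_mul, eval_C, eval_pow, eval_sub, eval_X, xu]
    have : 4 ^ k - 1 = (4 ^ k - 1 - (i : ℕ)) + i := by have := i.2; omega
    have h3 : (u - 1) ^ (4 ^ k - 1) = (u - 1) ^ (4 ^ k - 1 - (i : ℕ)) * (u - 1) ^ (i : ℕ) := by rw [← pow_add, ← this]
    rw [h3, div_pow]
    field_simp
  have hgl0 : ∃ l, gl l ≠ 0 := by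
    obtain ⟨i0, l, hil⟩ := hj0
    refine ⟨l, fun hz => hil ?_⟩
    have hP : (∑ i : Fin (4 ^ k), C (c (i, j0, l) : ℂ) * X ^ (i : ℕ)) = 0 := by
      refine eq_zero_of_infinite_isRoot _ ((Set.Infinite.image (f := xu p.t s) (s := {u | u ≠ 1}) ?_ ?_).mono ?_)
      · intro u hu v hv huv
        have hu1 : u - 1 ≠ 0 := sub_ne_zero.2 hu
        have hv1 : v - 1 ≠ 0 := sub_ne_zero.2 hv
        simp only [xu] at huv
        rw [div_eq_div_iff hu1 hv1] at huv
        have : s * (u - v) = 0 := by linear_combination (-1/2) * huv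
        exact sub_eq_zero.1 ((mul_eq_zero.1 this).resolve_left hs0)
      · exact (Set.finite_singleton (1:ℂ)).infinite_compl
      · rintro _ ⟨u, hu, rfl⟩
        have h1 := hgle l u hu
        rw [hz, eval_zero] at h1
        have h2 := (mul_eq_zero.1 h1.symm).resolve_left (pow_ne_zero _ (sub_ne_zero.2 hu))
        simp only [Set.mem_ofPred_eq, IsRoot.def, eval_finset_sum, eval_mul, eval_C, eval_pow, eval_X]
        exact h2
    have h3 := congrArg (fun P => P.coeff (i0 : ℕ)) hP
    simp only [finset_sum_coeff, coeff_C_mul_X_pow, coeff_zero] at h3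
    rw [Finset.sum_eq_single i0] at h3
    · simpa using h3
    · intro i _ hi
      rw [if_neg]
      exact fun h => hi (Fin.ext h.symm)
    · simp
  obtain ⟨g, hg⟩ : ∃ g : ℂ[X][X], g = ∑ l : Fin (n + 1), C (gl l) * X ^ (l : ℕ) := ⟨_, rfl⟩
  have hgc : ∀ l : Fin (n + 1), g.coeff l = gl l := by
    intro l
    rw [hg]
    simp only [finset_sum_coeff, coeff_C_mul_X_pow]
    rw [Finset.sum_eq_single l]
    · simp
    · intro i _ hi
      rw [if_neg]
      exact fun h => hi (Fin.ext h.symm)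
    · simp
  have hdegl : ∀ l, (gl l).natDegree ≤ 4 ^ k := by
    intro l
    rw [hgl]
    refine natDegree_sum_le_of_forall_le _ _ fun i _ => ?_
    refine (natDegree_C_mul_le _ _).trans (natDegree_mul_le.trans ?_)
    have e1 : ((C (2 * p.t + s) * X - C (2 * p.t - s)) ^ (i : ℕ) : ℂ[X]).natDegree ≤ i := by
      refine natDegree_pow_le.trans ?_
      have : (C (2 * p.t + s) * X - C (2 * p.t - s) : ℂ[X]).natDegree ≤ 1 := by
        rw [natDegree_sub_C]
        exact (natDegree_C_mul_le _ _).trans natDegree_X_le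
      nlinarith
    have e2 : ((X - C 1) ^ (4 ^ k - 1 - (i : ℕ)) : ℂ[X]).natDegree = 4 ^ k - 1 - i := by
      rw [natDegree_pow, natDegree_X_sub_C, mul_one]
    have := i.2
    omega
  refine gauss_quad b S cc hnc g ?_ (4 ^ k) ?_ hdeg _ hinf ?_
  · intro h
    obtain ⟨l, hl⟩ := hgl0
    apply hl
    rw [← hgc, h, coeff_zero]
  · intro l
    by_cases hl : l < n + 1
    · have := hgc ⟨l, hl⟩
      simp only at this
      rw [this]; exact hdegl _
    · have : g.coeff l = 0 := by
        rw [hg, finset_sum_coeff]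
        refine Finset.sum_eq_zero fun i _ => ?_
        rw [coeff_C_mul_X_pow, if_neg]
        have := i.2
        omega
      rw [this]; simp
  · rintro u ⟨hu1, hbu, x2, lam, hlam, hB0, hSne, eB, eS, eC, c1, c2⟩
    refine ⟨hbu, ?_⟩
    obtain ⟨x1, hx1⟩ : ∃ x1, x1 = xu p.t s u := ⟨_, rfl⟩
    rw [← hx1] at hB0 hSne eB eS eC c1
    have hB' : p'.B k x1 x2 ≠ 0 := by rw [eB]; exact mul_ne_zero hlam hbu
    obtain ⟨W, hW, hA⟩ : ∃ W : ℂ, W * W = p.F x1 * p.F x2 ∧ Am p k x1 x2 W ≠ 0 := by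
      obtain ⟨W, hW⟩ := IsAlgClosed.exists_eq_mul_self (p.F x1 * p.F x2)
      by_cases h : Am p k x1 x2 W = 0
      · refine ⟨-W, by rw [hW]; ring, fun h' => hSne ?_⟩
        simp only [Am] at h h'
        linear_combination (1/2) * h + (1/2) * h'
      · exact ⟨W, hW.symm, h⟩
    obtain ⟨V, hV⟩ := IsAlgClosed.exists_eq_mul_self (p'.F x1 * p'.F x2)
    have hRV : p'.R k x1 x2 * V ≠ 0 := by
      have i1 := p'.sk_inv k x1
      have i2 := p'.sk_inv 0 x2
      intro hz
      apply mul_ne_zero c1 c2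
      have : (p'.R k x1 x2 * V) ^ 2 = 4 * (cub (p'.a2 : ℂ) p'.a4 (p'.sk k x1).1 (p'.sk k x1).2.1 * cub (p'.a2 : ℂ) p'.a4 (p'.sk 0 x2).1 (p'.sk 0 x2).2.1) := by
        rw [← i1, ← i2, Prm.R]
        linear_combination (-4 * (p'.sk k x1).2.2 ^ 2 * (p'.sk 0 x2).2.2 ^ 2) * hV
      rw [hz] at this
      linear_combination (-1/4) * this
    have hq : ∀ V : ℂ, V * V = p'.F x1 * p'.F x2 → b.eval u * (Am p' k x1 x2 V / p'.B k x1 x2) ^ 2 -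
        2 * S.eval u * (Am p' k x1 x2 V / p'.B k x1 x2) + cc.eval u = 0 ∧
        (g.map (evalRingHom u)).eval (Am p' k x1 x2 V / p'.B k x1 x2) = 0 := by
      intro V hV
      constructor
      · apply mul_left_cancel₀ hlam
        have h1 := p'.APM k x1 x2 V hV
        have : lam * (b.eval u * (Am p' k x1 x2 V / p'.B k x1 x2) ^ 2 -
          2 * S.eval u * (Am p' k x1 x2 V / p'.B k x1 x2) + cc.eval u) =
          (p'.B k x1 x2) * (Am p' k x1 x2 V / p'.B k x1 x2) ^ 2 -
          2 * (p'.S k x1 x2) * (Am p' k x1 x2 V / p'.B k x1 x2) + p'.C k x1 x2 := by rw [eB, eS, eC]; ring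
        rw [this, mul_zero]
        field_simp
        simp only [Am]
        linear_combination -h1
      · have h1 := hev x1 x2 W V hW hV hB0 hA hB'
        rw [hg, Polynomial.map_sum, eval_finset_sum]
        simp only [Polynomial.map_mul, map_C, Polynomial.map_pow, map_X, eval_mul, eval_C, eval_pow, eval_X, coe_evalRingHom]
        simp only [hgle _ u hu1, ← hx1]
        have : ∀ l : Fin (n + 1), (u - 1) ^ (4 ^ k - 1) * (∑ i : Fin (4 ^ k), (c (i, j0, l) : ℂ) * x1 ^ (i : ℕ)) * (Am p' k x1 x2 V / p'.B k x1 x2) ^ (l : ℕ) =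
          (u - 1) ^ (4 ^ k - 1) * ((∑ i : Fin (4 ^ k), (c (i, j0, l) : ℂ) * x1 ^ (i : ℕ)) * (Am p' k x1 x2 V / p'.B k x1 x2) ^ (l : ℕ)) := fun l => by ring
        rw [Finset.sum_congr rfl fun l _ => this l, ← Finset.mul_sum, h1, mul_zero]
    refine ⟨Am p' k x1 x2 V / p'.B k x1 x2, Am p' k x1 x2 (-V) / p'.B k x1 x2, ?_, fun t ht => ?_⟩
    · intro h
      rw [div_left_inj' hB'] at h
      simp only [Am] at h
      apply hRV
      linear_combination (1/2) * h
    · rcases ht with rfl | rfl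
      · exact hq V hV.symm
      · exact hq (-V) (by rw [hV]; ring)

end indep

end PartP5f

section PartP7a

section

/-- weighted truncated l1 norm of an integral power series -/
noncomputable def sN (r : ℝ) (N : ℕ) (f : PowerSeries ℤ) : ℝ :=
  ∑ i ∈ Finset.range N, |((PowerSeries.coeff i f : ℤ) : ℝ)| * r ^ i

theorem sN_nonneg {r : ℝ} (hr : 0 ≤ r) (N : ℕ) (f : PowerSeries ℤ) : 0 ≤ sN r N f :=
  Finset.sum_nonneg fun _ _ => by positivity

theorem sN_add {r : ℝ} (hr : 0 ≤ r) (N : ℕ) (f g : PowerSeries ℤ) :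
    sN r N (f + g) ≤ sN r N f + sN r N g := by
  unfold sN
  rw [← Finset.sum_add_distrib]
  refine Finset.sum_le_sum fun i _ => ?_
  rw [← add_mul, map_add]
  push_cast
  gcongr
  exact abs_add_le _ _

theorem sN_mul {r : ℝ} (hr : 0 ≤ r) (N : ℕ) (f g : PowerSeries ℤ) :
    sN r N (f * g) ≤ sN r N f * sN r N g := by
  have key : ∀ i ∈ Finset.range N, |((PowerSeries.coeff i (f * g) : ℤ) : ℝ)| * r ^ i ≤
      ∑ x ∈ (Finset.range N ×ˢ Finset.range N).filter (fun x => x.1 + x.2 = i),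
        (|((PowerSeries.coeff x.1 f : ℤ) : ℝ)| * r ^ x.1) *
          (|((PowerSeries.coeff x.2 g : ℤ) : ℝ)| * r ^ x.2) := by
    intro i hi
    have hset : (Finset.range N ×ˢ Finset.range N).filter (fun x : ℕ × ℕ => x.1 + x.2 = i) =
        Finset.HasAntidiagonal.antidiagonal i := by
      ext x
      simp only [Finset.mem_filter, Finset.mem_product, Finset.mem_range,
        Finset.HasAntidiagonal.mem_antidiagonal] at hi ⊢
      omega
    rw [hset, PowerSeries.coeff_mul]
    push_cast
    calc _ ≤ (∑ x ∈ Finset.HasAntidiagonal.antidiagonal i, |((PowerSeries.coeff x.1 f : ℤ) : ℝ) *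
          ((PowerSeries.coeff x.2 g : ℤ) : ℝ)|) * r ^ i := by
          gcongr
          exact Finset.abs_sum_le_sum_abs _ _
      _ = _ := by
          rw [Finset.sum_mul]
          refine Finset.sum_congr rfl fun x hx => ?_
          rw [Finset.HasAntidiagonal.mem_antidiagonal] at hx
          rw [abs_mul, ← hx, pow_add]
          ring
  calc sN r N (f * g) ≤ _ := Finset.sum_le_sum key
    _ ≤ ∑ x ∈ Finset.range N ×ˢ Finset.range N,
        (|((PowerSeries.coeff x.1 f : ℤ) : ℝ)| * r ^ x.1) *
          (|((PowerSeries.coeff x.2 g : ℤ) : ℝ)| * r ^ x.2) := by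
        rw [← Finset.sum_biUnion]
        · refine Finset.sum_le_sum_of_subset_of_nonneg ?_ fun _ _ _ => by positivity
          intro x hx
          simp only [Finset.mem_biUnion, Finset.mem_filter] at hx
          obtain ⟨_, _, h, _⟩ := hx
          exact h
        · intro i _ j _ hij
          refine Finset.disjoint_left.2 fun x hx hx' => hij ?_
          rw [← (Finset.mem_filter.1 hx).2, ← (Finset.mem_filter.1 hx').2]
    _ = _ := by
        rw [Finset.sum_product, sN, sN, Finset.sum_mul_sum]

theorem sN_C {r : ℝ} (N : ℕ) (a : ℤ) : sN r N (PowerSeries.C a) ≤ |(a : ℝ)| := by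
  unfold sN
  rcases N with _ | N
  · simp
  rw [Finset.sum_eq_single 0]
  · simp
  · intro i _ hi
    rw [PowerSeries.coeff_C, if_neg hi]; simp
  · simp

theorem sN_X {r : ℝ} (hr : 0 ≤ r) (N : ℕ) : sN r N (PowerSeries.X) ≤ r := by
  unfold sN
  by_cases hN : 1 < N
  · rw [Finset.sum_eq_single 1]
    · simp
    · intro i _ hi
      simp [PowerSeries.coeff_X, hi]
    · simp [hN]
  · rw [Finset.sum_eq_zero]
    · exact hr
    · intro i hi
      rw [Finset.mem_range] at hi
      have : i = 0 := by omega
      subst this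
      simp

theorem sN_X_mul {r : ℝ} (N : ℕ) (f : PowerSeries ℤ) :
    sN r (N + 1) (PowerSeries.X * f) = r * sN r N f := by
  unfold sN
  rw [Finset.sum_range_succ']
  simp only [PowerSeries.coeff_succ_X_mul, PowerSeries.coeff_zero_X_mul]
  rw [Finset.mul_sum]
  simp
  refine Finset.sum_congr rfl fun i _ => ?_
  ring

theorem sN_mono {r : ℝ} (hr : 0 ≤ r) (N : ℕ) (f : PowerSeries ℤ) :
    sN r N f ≤ sN r (N + 1) f := by
  unfold sN
  rw [Finset.sum_range_succ]
  have : 0 ≤ |((PowerSeries.coeff N f : ℤ) : ℝ)| * r ^ N := by positivity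
  linarith

/-- bounded weighted norm -/
def gd (r M : ℝ) (f : PowerSeries ℤ) : Prop := ∀ N, sN r N f ≤ M

theorem gd_coeff {r M : ℝ} {f : PowerSeries ℤ} (hr : 0 ≤ r) (h : gd r M f) (i : ℕ) :
    |((PowerSeries.coeff i f : ℤ) : ℝ)| * r ^ i ≤ M :=
  (Finset.single_le_sum (f := fun i => |((PowerSeries.coeff i f : ℤ) : ℝ)| * r ^ i)
    (fun _ _ => by positivity) (Finset.self_mem_range_succ i)).trans (h (i + 1))

theorem gd_nonneg {r M : ℝ} {f : PowerSeries ℤ} (h : gd r M f) : 0 ≤ M := by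
  simpa [sN] using h 0

theorem gd_mono {r M M' : ℝ} {f : PowerSeries ℤ} (h : gd r M f) (hM : M ≤ M') : gd r M' f :=
  fun N => (h N).trans hM

theorem gd_add {r M M' : ℝ} {f g : PowerSeries ℤ} (hr : 0 ≤ r) (h : gd r M f)
    (h' : gd r M' g) : gd r (M + M') (f + g) :=
  fun N => (sN_add hr N f g).trans (add_le_add (h N) (h' N))

theorem gd_mul {r M M' : ℝ} {f g : PowerSeries ℤ} (hr : 0 ≤ r) (h : gd r M f)
    (h' : gd r M' g) : gd r (M * M') (f * g) :=
  fun N => (sN_mul hr N f g).trans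
    (mul_le_mul (h N) (h' N) (sN_nonneg hr N g) (gd_nonneg h))

theorem gd_C (r : ℝ) (a : ℤ) : gd r |(a : ℝ)| (PowerSeries.C a) := fun N => sN_C N a

theorem gd_X {r : ℝ} (hr : 0 ≤ r) : gd r r PowerSeries.X := fun N => sN_X hr N

theorem gd_one (r : ℝ) : gd r 1 1 := by
  have := gd_C r 1
  simpa using this

theorem gd_pow {r M : ℝ} {f : PowerSeries ℤ} (hr : 0 ≤ r) (h : gd r M f) (n : ℕ) :
    gd r (M ^ n) (f ^ n) := by
  induction n with
  | zero => simpa using gd_one r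
  | succ n ih => rw [pow_succ, pow_succ]; exact gd_mul hr ih h

theorem gd_sum {r : ℝ} {ι : Type*} (s : Finset ι) (f : ι → PowerSeries ℤ) (M : ℝ)
    (hr : 0 ≤ r) (h : ∀ i ∈ s, gd r M (f i)) : gd r (s.card * M) (∑ i ∈ s, f i) := by
  classical
  induction s using Finset.induction_on with
  | empty => intro N; simp [sN]
  | insert a s ha ih =>
    rw [Finset.sum_insert ha, Finset.card_insert_of_notMem ha]
    refine gd_mono (gd_add hr (h a (Finset.mem_insert_self _ _))
      (ih fun i hi => h i (Finset.mem_insert_of_mem hi))) ?_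
    push_cast
    linarith

theorem exists_z (u : PowerSeries ℤ) (hu : PowerSeries.constantCoeff u = 0) :
    ∃ z : PowerSeries ℤ, z + z ^ 2 = u ∧ PowerSeries.constantCoeff z = 0 := by
  obtain ⟨D, hD⟩ : ∃ D : PowerSeries ℤ, D = PowerSeries.map (Nat.castRingHom ℤ)
    PowerSeries.catalanSeries := ⟨_, rfl⟩
  have h1 : D ^ 2 * PowerSeries.X + 1 = D := by
    have := congrArg (PowerSeries.map (Nat.castRingHom ℤ))
      PowerSeries.catalanSeries_sq_mul_X_add_one
    simpa [← hD] using this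
  have hs : PowerSeries.HasSubst (-u) :=
    PowerSeries.HasSubst.of_constantCoeff_zero' (by simp [hu])
  have h2 := congrArg (PowerSeries.substAlgHom (R := ℤ) hs) h1
  obtain ⟨E, hE⟩ : ∃ E, E = PowerSeries.substAlgHom (R := ℤ) hs D := ⟨_, rfl⟩
  have h3 : PowerSeries.substAlgHom (R := ℤ) hs PowerSeries.X = -u := by
    rw [PowerSeries.coe_substAlgHom, PowerSeries.subst_X hs]
  rw [map_add, map_mul, map_pow, map_one, h3, ← hE] at h2
  refine ⟨u * E, ?_, by simp [hu]⟩
  linear_combination (-u) * h2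

theorem exists_sqrt {r : ℝ} (hr : 0 ≤ r) (u : PowerSeries ℤ)
    (hu : PowerSeries.constantCoeff u = 0) (h : gd r (1 / 4) u) :
    ∃ Z : PowerSeries ℤ, Z ^ 2 = 1 + 4 * u ∧ PowerSeries.constantCoeff Z = 1 ∧ gd r 2 Z := by
  obtain ⟨z, hz, hz0⟩ := exists_z u hu
  have hg : gd r (1 / 2) z := by
    obtain ⟨w, rfl⟩ := PowerSeries.X_dvd_iff.2 hz0
    intro N
    induction N with
    | zero => simp [sN]
    | succ N ih =>
      have e : PowerSeries.X * w = u + PowerSeries.X * (PowerSeries.X * w * (-w)) := by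
        linear_combination hz
      have h1 : sN r (N + 1) (PowerSeries.X * w) ≤
          1 / 4 + r * (sN r N (PowerSeries.X * w) * sN r N (-w)) := by
        conv_lhs => rw [e]
        refine (sN_add hr _ _ _).trans (add_le_add (h _) ?_)
        rw [sN_X_mul]
        exact mul_le_mul_of_nonneg_left (sN_mul hr _ _ _) hr
      have h2 : sN r N (-w) = sN r N w := by simp [sN]
      have h3 := sN_X_mul (r := r) N w
      rw [h2] at h1
      have h4 := sN_nonneg hr N w
      have h5 : 0 ≤ r * sN r N w := by positivity
      nlinarith
  refine ⟨1 + 2 * z, by rw [← hz]; ring, by simp [hz0], ?_⟩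
  have := gd_add hr (gd_one r) (gd_mul hr (gd_C r 2) hg)
  have e2 : (PowerSeries.C 2 : PowerSeries ℤ) = 2 := by simp
  rw [e2] at this
  exact gd_mono this (by norm_num)

end

end PartP7a

section PartP7b

section
open Polynomial

/-- naive multiplicative height -/
noncomputable def Hq (ξ : ℚ) : ℝ := max |(ξ.num : ℝ)| ξ.den

/-- specialise the second variable -/
noncomputable def Gsp (ξ : ℚ) (G : ℤ[X][X]) : ℚ[X] :=
  G.eval₂ (mapRingHom (Int.castRingHom ℚ)) (C ξ)

theorem exp_le_of_bound {a L : ℝ} {i d : ℕ} (ha : 1 ≤ a)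
    (h : ∀ ρ : ℝ, 1 ≤ ρ → a * ρ ^ i ≤ L * ρ ^ d) : i ≤ d := by
  by_contra hlt
  push Not at hlt
  obtain ⟨j, rfl⟩ := Nat.exists_eq_add_of_lt hlt
  have hL : 1 ≤ L := by
    have := h 1 le_rfl
    simp at this
    linarith
  have h1 := h (L + 1) (by linarith)
  have h2 : 0 < (L + 1) ^ d := by positivity
  have h3 : a * (L + 1) ^ (j + 1) ≤ L := by
    rw [add_assoc, pow_add] at h1
    by_contra h4
    push Not at h4
    nlinarith
  have h5 : L + 1 ≤ (L + 1) ^ (j + 1) := le_self_pow₀ (by linarith) (by omega)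
  nlinarith

theorem G_order (G : ℤ[X][X]) (hG : G ≠ 0) (L : ℝ) (hL1 : 1 ≤ L) (d1 d2 : ℕ) (hd1 : 1 ≤ d1)
    (h : ∀ ρ ρ' : NNReal, 1 ≤ ρ → 1 ≤ ρ' →
      pnorm (pnorm zν ρ) ρ' G ≤ L * (ρ : ℝ) ^ d1 * (ρ' : ℝ) ^ d2)
    (ξ1 ξ2 : ℚ) (hξ : L < Hq ξ2) :
    Gsp ξ2 G ≠ 0 ∧ ∀ I, (X - C ξ1) ^ I ∣ Gsp ξ2 G →
      Hq ξ1 ^ (I - (d2 + 1)) ≤ (d2 + 1).factorial * ((d1 : ℝ) ^ (d2 + 1) * L) ^ (d2 + 1) := by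
  have hco : ∀ i j (ρ ρ' : NNReal), 1 ≤ ρ → 1 ≤ ρ' →
      |(((G.coeff j).coeff i : ℤ) : ℝ)| * (ρ : ℝ) ^ i * (ρ' : ℝ) ^ j ≤
        L * (ρ : ℝ) ^ d1 * (ρ' : ℝ) ^ d2 := by
    intro i j ρ ρ' hρ hρ'
    refine le_trans ?_ (h ρ ρ' hρ hρ')
    refine le_trans ?_ (coeff_le_pnorm _ ρ' G j)
    have := coeff_le_pnorm zν ρ (G.coeff j) i
    rw [zν_apply] at this
    gcongr
  have habs : ∀ i j, (G.coeff j).coeff i ≠ 0 → (1 : ℝ) ≤ |(((G.coeff j).coeff i : ℤ) : ℝ)| := by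
    intro i j hne
    exact_mod_cast Int.one_le_abs hne
  have hdeg2 : ∀ i j, (G.coeff j).coeff i ≠ 0 → j ≤ d2 := by
    intro i j hne
    refine exp_le_of_bound (habs i j hne) (L := L) fun ρ hρ => ?_
    obtain ⟨r, hr⟩ : ∃ r : NNReal, (r : ℝ) = ρ := ⟨⟨ρ, by linarith⟩, rfl⟩
    have := hco i j 1 r le_rfl (by rw [← NNReal.coe_le_coe, hr]; simpa using hρ)
    rw [hr] at this
    simpa using this
  have hdeg1 : ∀ i j, (G.coeff j).coeff i ≠ 0 → i ≤ d1 := by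
    intro i j hne
    refine exp_le_of_bound (habs i j hne) (L := L) fun ρ hρ => ?_
    obtain ⟨r, hr⟩ : ∃ r : NNReal, (r : ℝ) = ρ := ⟨⟨ρ, by linarith⟩, rfl⟩
    have := hco i j r 1 (by rw [← NNReal.coe_le_coe, hr]; simpa using hρ) le_rfl
    rw [hr] at this
    simpa using this
  have hnd : G.natDegree < d2 + 1 := by
    have h1 : G.leadingCoeff ≠ 0 := leadingCoeff_ne_zero.2 hG
    have h2 : G.leadingCoeff.leadingCoeff ≠ 0 := leadingCoeff_ne_zero.2 h1
    exact Nat.lt_succ_of_le (hdeg2 _ _ h2)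
  have hnorm1 : pnorm (pnorm zν 1) 1 G ≤ L := by simpa using h 1 1 le_rfl le_rfl
  have hgL : ∀ j, pnorm zν 1 (G.coeff j) ≤ L := by
    intro j
    have := coeff_le_pnorm (pnorm zν 1) 1 G j
    simp only [NNReal.coe_one, one_pow, mul_one] at this
    exact this.trans hnorm1
  have hsum : Gsp ξ2 G = ∑ j ∈ Finset.range (d2 + 1),
      C (ξ2 ^ j) * (G.coeff j).map (Int.castRingHom ℚ) := by
    rw [Gsp, eval₂_eq_sum_range' _ hnd]
    refine Finset.sum_congr rfl fun j _ => ?_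
    rw [C_pow, mul_comm]; rfl
  have hne : Gsp ξ2 G ≠ 0 := by
    intro h0
    obtain ⟨i, hi⟩ : ∃ i, (G.leadingCoeff).coeff i ≠ 0 :=
      ⟨_, leadingCoeff_ne_zero.2 (leadingCoeff_ne_zero.2 hG)⟩
    obtain ⟨U, hU⟩ : ∃ U : ℤ[X], U = ∑ j ∈ Finset.range (d2 + 1),
      monomial j ((G.coeff j).coeff i) := ⟨_, rfl⟩
    have hUc : U.coeff G.natDegree = (G.leadingCoeff).coeff i := by
      rw [hU, finsetSum_coeff]
      simp only [coeff_monomial]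
      rw [Finset.sum_ite_eq' ]
      simp [hnd]
    have hU0 : U ≠ 0 := by
      rintro rfl
      rw [coeff_zero] at hUc
      exact hi hUc.symm
    have hUn : pnorm zν 1 U ≤ L := by
      refine le_trans ?_ hnorm1
      rw [hU]
      refine (seminorm_sum_le _ _ _).trans ?_
      rw [pnorm_def, sum_over_range' _ (by simp) _ hnd]
      refine Finset.sum_le_sum fun j _ => ?_
      rw [pnorm_monomial]
      have := coeff_le_pnorm zν 1 (G.coeff j) i
      simpa using this
    have hdv : (X - C ξ2) ^ 1 ∣ U.map (Int.castRingHom ℚ) := by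
      rw [pow_one, dvd_iff_isRoot, IsRoot.def]
      have h1 : (Gsp ξ2 G).coeff i = 0 := by rw [h0, coeff_zero]
      rw [hsum, finsetSum_coeff] at h1
      rw [hU, Polynomial.map_sum, eval_finsetSum, ← h1]
      refine Finset.sum_congr rfl fun j _ => ?_
      rw [map_monomial, eval_monomial, coeff_C_mul, coeff_map, mul_comm]
    have := root_height_pow_le U hU0 ξ2 1 hdv
    rw [pow_one] at this
    exact absurd (this.trans hUn) (not_le.2 hξ)
  refine ⟨hne, fun I hI => ?_⟩
  rw [hsum, ← Fin.sum_univ_eq_sum_range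
    (fun j => C (ξ2 ^ j) * (G.coeff j).map (Int.castRingHom ℚ))] at hne hI
  refine order_bound (m := d2 + 1) (fun j => G.coeff j) (fun j => ξ2 ^ (j : ℕ)) ξ1 I d1 L hd1 hL1
    (fun j => ?_) (fun j => hgL j) hne hI
  by_cases h0 : G.coeff j = 0
  · simp [h0]
  · exact hdeg1 _ _ (leadingCoeff_ne_zero.2 h0)


theorem aux_poly (p p' : Prm) (hb : 0 < p.b) (hb' : p'.b = p.b) (ht : p'.t = p.t) (hδ : p.δ ≠ 0)
    (hδ' : p'.δ ≠ 0) (hT : p.t ≠ p.t') (hT1 : p'.t ≠ p'.t') (hT' : p.t' ≠ p'.t') (n : ℕ)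
    (hn : 11000 ≤ n) : ∃ K : ℝ, 1 ≤ K ∧ ∀ k, 1 ≤ k → ∃ c : Idx k n → ℤ,
    (∀ e e' s i j, |(coef (gpol p p' k n c e e') s i j : ℝ)| ≤ K ^ 4 ^ k ∧
      (coef (gpol p p' k n c e e') s i j ≠ 0 → i + 4 ≤ 16 * (n - 1) * 4 ^ k ∧ j ≤ 16 * n)) ∧
    ∀ ξ1 ξ2 : ℚ, K ^ 4 ^ k < Hq ξ2 →
      Gsp ξ2 (NN p p' (gpol p p' k n c false false)) ≠ 0 ∧
      ∀ I, (X - C ξ1) ^ I ∣ Gsp ξ2 (NN p p' (gpol p p' k n c false false)) →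
        Hq ξ1 ^ (I - (64 * n + 1)) ≤ K ^ 4 ^ k := by
  obtain ⟨K, hK, hs⟩ := siegel p p' n hn
  obtain ⟨m, hm⟩ : ∃ m, m = 64 * n + 1 := ⟨_, rfl⟩
  obtain ⟨f, hf⟩ : ∃ f : ℝ, f = m.factorial := ⟨_, rfl⟩
  obtain ⟨d, hd⟩ : ∃ d : ℝ, d = 4 * (64 * n + 4) := ⟨_, rfl⟩
  have hf1 : 1 ≤ f := by rw [hf]; exact_mod_cast Nat.one_le_iff_ne_zero.2 (Nat.factorial_ne_zero m)
  have hd1 : 1 ≤ d := by rw [hd]; linarith [(Nat.cast_nonneg n : (0 : ℝ) ≤ n)]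
  have hK4 : 1 ≤ K ^ 4 := one_le_pow₀ hK
  have hdK : K ^ 4 ≤ d ^ m * K ^ 4 := le_mul_of_one_le_left (by positivity) (one_le_pow₀ hd1)
  have hdKm : K ^ 4 ≤ (d ^ m * K ^ 4) ^ m :=
    hdK.trans (le_self_pow₀ (hK4.trans hdK) (by omega))
  have hKC4 : K ^ 4 ≤ f * (d ^ m * K ^ 4) ^ m :=
    hdKm.trans (le_mul_of_one_le_left (by linarith) hf1)
  have hKC : K ≤ f * (d ^ m * K ^ 4) ^ m := (le_self_pow₀ hK (by norm_num)).trans hKC4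
  refine ⟨f * (d ^ m * K ^ 4) ^ m, hK.trans hKC, fun k hk => ?_⟩
  obtain ⟨c, hc, h1, h2⟩ := hs k
  refine ⟨c, fun e e' s i j => ⟨((h1 e e' s i j).1).trans ?_, (h1 e e' s i j).2⟩, ?_⟩
  · gcongr
  have hG : NN p p' (gpol p p' k n c false false) ≠ 0 :=
    NN_ne_zero p p' hb hb' ht hδ hδ' hT hT1 hT' _ (indep p p' hb hb' ht hδ hδ' hT hT1 hT' k n hk c hc)
  intro ξ1 ξ2 hξ
  have hL : (K ^ 4) ^ 4 ^ k < Hq ξ2 := lt_of_le_of_lt (by gcongr) hξ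
  have h4k : 1 ≤ 4 ^ k := Nat.one_le_pow _ _ (by norm_num)
  obtain ⟨h3, h4⟩ := G_order _ hG ((K ^ 4) ^ 4 ^ k) (one_le_pow₀ hK4) (4 * ((16 * n + 1) * 4 ^ k))
    (64 * n) (by nlinarith) (fun ρ ρ' hρ hρ' => (h2 ρ ρ' hρ hρ').trans (le_of_eq (by
      rw [mul_pow, mul_pow, ← pow_mul, ← pow_mul, ← pow_mul, ← pow_mul]
      congr 2
      · congr 1; ring
      · congr 1; ring
      · ring))) ξ1 ξ2 hL
  refine ⟨h3, fun I hI => (h4 I hI).trans ?_⟩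
  rw [← hm, ← hf]
  have e1 : (((4 * ((16 * n + 1) * 4 ^ k) : ℕ) : ℝ)) ≤ d ^ 4 ^ k := by
    have : ((4 ^ k : ℕ) : ℝ) ≤ 4 ^ 4 ^ k := by
      exact_mod_cast (Nat.lt_pow_self (by norm_num : 1 < 4)).le
    have h64 : (1 : ℝ) ≤ 64 * n + 4 := by linarith [(Nat.cast_nonneg n : (0 : ℝ) ≤ n)]
    have h65 : (64 * n + 4 : ℝ) ≤ (64 * n + 4) ^ 4 ^ k := le_self_pow₀ h64 (by omega)
    rw [hd, mul_pow]
    push_cast at this ⊢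
    calc (4 * ((16 * n + 1) * 4 ^ k) : ℝ) = 4 ^ k * (64 * n + 4) := by ring
      _ ≤ _ := by gcongr
  have e2 : f ≤ f ^ 4 ^ k := le_self_pow₀ hf1 (by omega)
  calc f * (((4 * ((16 * n + 1) * 4 ^ k) : ℕ) : ℝ) ^ m * (K ^ 4) ^ 4 ^ k) ^ m
      ≤ f ^ 4 ^ k * ((d ^ 4 ^ k) ^ m * (K ^ 4) ^ 4 ^ k) ^ m := by gcongr
    _ = _ := by
      rw [mul_pow f, ← pow_mul d, mul_comm (4 ^ k) m, pow_mul d, ← mul_pow, ← pow_mul,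
        mul_comm (4 ^ k) m, pow_mul]

end

end PartP7b

section PartP7c

section
variable {A A' : Type*} [CommRing A] [CommRing A']

def Fh (p : Prm) (x q : A) : A :=
  p.δ * ((x - 2 * p.t * q) ^ 2 + p.b * q ^ 2) * ((x - 2 * p.t' * q) ^ 2 + p.b * q ^ 2)

/-- divided difference -/
def Eh (p : Prm) (x q h : A) : A :=
  p.δ * (((x - 2 * p.t * q) ^ 2 + p.b * q ^ 2) * (2 * (x - 2 * p.t' * q) + h) +
    ((x - 2 * p.t' * q) ^ 2 + p.b * q ^ 2) * (2 * (x - 2 * p.t * q) + h) +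
    h * (2 * (x - 2 * p.t * q) + h) * (2 * (x - 2 * p.t' * q) + h))

theorem Fh_add (p : Prm) (x q h : A) : Fh p (x + h) q = Fh p x q + h * Eh p x q h := by
  unfold Fh Eh; ring

theorem Fh_F (p : Prm) (x q : A) : Fh p (q * x) q = q ^ 4 * p.F x := by
  unfold Fh Prm.F Prm.q1 Prm.q2; ring

theorem map_Fh (p : Prm) (φ : A →+* A') (x q : A) : φ (Fh p x q) = Fh p (φ x) (φ q) := by
  simp [Fh, map_ofNat]

/-- bound on parameters -/
def Pbd (p : Prm) (M : ℝ) : Prop :=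
  1 + 2 * |(p.t : ℝ)| ≤ M ∧ 1 + 2 * |(p.t' : ℝ)| ≤ M ∧ |(p.b : ℝ)| ≤ M ∧ |(p.δ : ℝ)| ≤ M

theorem Pbd_one {p : Prm} {M : ℝ} (h : Pbd p M) : 1 ≤ M := by
  have := abs_nonneg (p.t : ℝ)
  linarith [h.1]

theorem Fh_bound {p : Prm} {M H : ℝ} (hM : Pbd p M) (x q : ℤ) (hx : |(x : ℝ)| ≤ H)
    (hq : |(q : ℝ)| ≤ H) : |((Fh p x q : ℤ) : ℝ)| ≤ 4 * M ^ 5 * H ^ 4 := by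
  have hM1 := Pbd_one hM
  obtain ⟨h1, h2, h3, h4⟩ := hM
  have hH : 0 ≤ H := (abs_nonneg _).trans hx
  have lin : ∀ t : ℤ, 1 + 2 * |(t : ℝ)| ≤ M →
      |((x : ℝ) - 2 * t * q) ^ 2 + p.b * q ^ 2| ≤ 2 * M ^ 2 * H ^ 2 := by
    intro t ht
    have a1 : |(x : ℝ) - 2 * t * q| ≤ M * H := by
      refine (abs_sub _ _).trans ?_
      rw [abs_mul, abs_mul, abs_two]
      calc |(x : ℝ)| + 2 * |(t : ℝ)| * |(q : ℝ)| ≤ H + 2 * |(t : ℝ)| * H := by gcongr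
        _ = (1 + 2 * |(t : ℝ)|) * H := by ring
        _ ≤ _ := by gcongr
    refine (abs_add_le _ _).trans ?_
    rw [abs_pow, abs_mul, abs_pow]
    calc |(x : ℝ) - 2 * t * q| ^ 2 + |(p.b : ℝ)| * |(q : ℝ)| ^ 2 ≤ (M * H) ^ 2 + M * H ^ 2 := by
          gcongr
      _ ≤ (M * H) ^ 2 + M ^ 2 * H ^ 2 := by gcongr; nlinarith
      _ = _ := by ring
  have e := lin _ h1
  have e' := lin _ h2
  unfold Fh
  push_cast
  rw [abs_mul, abs_mul]
  calc _ ≤ M * (2 * M ^ 2 * H ^ 2) * (2 * M ^ 2 * H ^ 2) := by gcongr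
    _ = _ := by ring

theorem gd_intCast (r : ℝ) (a : ℤ) : gd r |(a : ℝ)| (a : PowerSeries ℤ) := by
  have := gd_C r a
  simpa using this

theorem gd_sub {r M M' : ℝ} {f g : PowerSeries ℤ} (hr : 0 ≤ r) (h : gd r M f)
    (h' : gd r M' g) : gd r (M + M') (f - g) := by
  rw [sub_eq_add_neg]
  refine gd_add hr h fun N => ?_
  have := h' N
  simpa [sN] using this

theorem gd_two (r : ℝ) : gd r 2 (2 : PowerSeries ℤ) := by
  have := gd_intCast r 2
  simpa using this

theorem Eh_bound {p : Prm} {M H r : ℝ} (hr : 0 ≤ r) (hM : Pbd p M) (x q h : PowerSeries ℤ)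
    (hx : gd r H x) (hq : gd r H q) (hh : gd r H h) :
    gd r (21 * M ^ 4 * H ^ 3) (Eh p x q h) := by
  have hM1 := Pbd_one hM
  obtain ⟨h1, h2, h3, h4⟩ := hM
  have hH : 0 ≤ H := gd_nonneg hx
  have lin : ∀ t : ℤ, 1 + 2 * |(t : ℝ)| ≤ M → gd r (M * H) (x - 2 * t * q) := by
    intro t ht
    refine gd_mono (gd_sub hr hx (gd_mul hr (gd_mul hr (gd_two r) (gd_intCast r t)) hq)) ?_
    calc H + 2 * |(t : ℝ)| * H = (1 + 2 * |(t : ℝ)|) * H := by ring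
        _ ≤ _ := by gcongr
  have quad : ∀ t : ℤ, 1 + 2 * |(t : ℝ)| ≤ M →
      gd r (2 * M ^ 2 * H ^ 2) ((x - 2 * t * q) ^ 2 + p.b * q ^ 2) := by
    intro t ht
    refine gd_mono (gd_add hr (gd_pow hr (lin t ht) 2)
      (gd_mul hr (gd_intCast r p.b) (gd_pow hr hq 2))) ?_
    calc (M * H) ^ 2 + |(p.b : ℝ)| * H ^ 2 ≤ (M * H) ^ 2 + M * H ^ 2 := by gcongr
      _ ≤ (M * H) ^ 2 + M ^ 2 * H ^ 2 := by gcongr; nlinarith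
      _ = _ := by ring
  have dd : ∀ t : ℤ, 1 + 2 * |(t : ℝ)| ≤ M → gd r (3 * M * H) (2 * (x - 2 * t * q) + h) := by
    intro t ht
    refine gd_mono (gd_add hr (gd_mul hr (gd_two r) (lin t ht)) hh) ?_
    nlinarith
  refine gd_mono (gd_mul hr (gd_mono (gd_intCast r p.δ) h4) (gd_add hr (gd_add hr
    (gd_mul hr (quad _ h1) (dd _ h2)) (gd_mul hr (quad _ h2) (dd _ h1)))
    (gd_mul hr (gd_mul hr hh (dd _ h1)) (dd _ h2)))) ?_
  have : M ^ 3 * H ^ 3 ≤ M ^ 4 * H ^ 3 := by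
    gcongr
    norm_num
  nlinarith

theorem loc_sqrt {p : Prm} {M H r : ℝ} (hM : Pbd p M) (P Q F2 c : ℤ) (hH : 1 ≤ H)
    (hP : |(P : ℝ)| ≤ H) (hQ : |(Q : ℝ)| ≤ H) (hF2 : |(F2 : ℝ)| ≤ 4 * M ^ 5 * H ^ 4)
    (hc : c = 4 * Fh p P Q * F2) (hr : r = (336 * M ^ 10 * H ^ 8)⁻¹) :
    gd r (2 * H) (PowerSeries.C P + PowerSeries.C c * PowerSeries.X) ∧
    ∃ Z : PowerSeries ℤ, Fh p (PowerSeries.C P + PowerSeries.C c * PowerSeries.X)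
      (PowerSeries.C Q) = PowerSeries.C (Fh p P Q) * Z ^ 2 ∧
      PowerSeries.constantCoeff Z = 1 ∧ gd r 2 Z := by
  have hM1 := Pbd_one hM
  have hpos : 0 < 336 * M ^ 10 * H ^ 8 := by positivity
  have hr0 : 0 ≤ r := by rw [hr]; positivity
  have hrr : r * (336 * M ^ 10 * H ^ 8) = 1 := by rw [hr]; exact inv_mul_cancel₀ hpos.ne'
  have hF := Fh_bound hM P Q hP hQ
  have hcb : |(c : ℝ)| ≤ 64 * M ^ 10 * H ^ 8 := by
    rw [hc]
    push_cast
    rw [abs_mul, abs_mul]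
    calc |(4 : ℝ)| * |((Fh p P Q : ℤ) : ℝ)| * |(F2 : ℝ)|
        ≤ 4 * (4 * M ^ 5 * H ^ 4) * (4 * M ^ 5 * H ^ 4) := by
          rw [abs_of_pos (by norm_num : (0 : ℝ) < 4)]
          gcongr
      _ = _ := by ring
  have hcr : |(c : ℝ)| * r ≤ H := by
    calc |(c : ℝ)| * r ≤ (64 * M ^ 10 * H ^ 8) * r := by gcongr
      _ ≤ 1 := by nlinarith
      _ ≤ H := hH
  have hh : gd r H (PowerSeries.C c * PowerSeries.X) :=
    gd_mono (gd_mul hr0 (gd_C r c) (gd_X hr0)) hcr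
  have hx : gd r H (PowerSeries.C P) := gd_mono (gd_C r P) hP
  have hq : gd r H (PowerSeries.C Q) := gd_mono (gd_C r Q) hQ
  refine ⟨gd_mono (gd_add hr0 hx hh) (by linarith), ?_⟩
  have hE := Eh_bound hr0 hM _ _ _ hx hq hh
  obtain ⟨E, hEd⟩ : ∃ E, E = Eh p (PowerSeries.C P) (PowerSeries.C Q)
    (PowerSeries.C c * PowerSeries.X) := ⟨_, rfl⟩
  rw [← hEd] at hE
  have hu : gd r (1 / 4) (PowerSeries.C F2 * PowerSeries.X * E) := by
    refine gd_mono (gd_mul hr0 (gd_mul hr0 (gd_mono (gd_C r F2) hF2) (gd_X hr0)) hE) ?_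
    have h1 : M ^ 9 * H ^ 7 ≤ M ^ 10 * H ^ 8 := by
      gcongr <;> norm_num
    calc 4 * M ^ 5 * H ^ 4 * r * (21 * M ^ 4 * H ^ 3) = 84 * r * (M ^ 9 * H ^ 7) := by ring
      _ ≤ 84 * r * (M ^ 10 * H ^ 8) := by gcongr
      _ = 1 / 4 * (r * (336 * M ^ 10 * H ^ 8)) := by ring
      _ ≤ _ := by rw [hrr]; norm_num
  obtain ⟨Z, hZ, hZ0, hZg⟩ := exists_sqrt hr0 (PowerSeries.C F2 * PowerSeries.X * E) (by simp) hu
  refine ⟨Z, ?_, hZ0, hZg⟩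
  rw [Fh_add, ← hEd, hZ, ← map_Fh p (PowerSeries.C : ℤ →+* PowerSeries ℤ), hc]
  simp only [map_mul, map_ofNat]
  ring

theorem lead {f f' D N : PowerSeries ℚ} {u : ℚ} {i n : ℕ} (h : f' * D ^ n = f * N ^ n)
    (hf : PowerSeries.X ^ i ∣ f) (hD : PowerSeries.constantCoeff D ≠ 0)
    (hu : u * PowerSeries.constantCoeff D = PowerSeries.constantCoeff N) :
    PowerSeries.X ^ i ∣ f' ∧
      PowerSeries.coeff i f' = PowerSeries.coeff i f * u ^ n := by
  have hDu : IsUnit (D ^ n) := by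
    rw [PowerSeries.isUnit_iff_constantCoeff, map_pow]
    exact (isUnit_iff_ne_zero.2 hD).pow n
  have hd : PowerSeries.X ^ i ∣ f' := by
    have : PowerSeries.X ^ i ∣ f' * D ^ n := h ▸ Dvd.dvd.mul_right hf _
    exact (IsUnit.dvd_mul_right hDu).1 this
  refine ⟨hd, ?_⟩
  obtain ⟨a, rfl⟩ := hf
  obtain ⟨a', rfl⟩ := hd
  have h2 : a' * D ^ n = a * N ^ n := by
    refine mul_left_cancel₀ (pow_ne_zero i (PowerSeries.X_ne_zero (R := ℚ))) ?_
    rw [← mul_assoc, ← mul_assoc]; exact h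
  have h3 := congrArg PowerSeries.constantCoeff h2
  simp only [map_mul, map_pow] at h3
  rw [← hu, mul_pow, ← mul_assoc] at h3
  have h4 := mul_right_cancel₀ (pow_ne_zero n hD) h3
  have h5 : ∀ g : PowerSeries ℚ, PowerSeries.coeff i (PowerSeries.X ^ i * g) =
      PowerSeries.constantCoeff g := by
    intro g
    have := PowerSeries.coeff_X_pow_mul g i 0
    simpa using this
  rw [h5, h5, h4]

theorem int_lead {l00 l10 l01 l11 : ℤ} {u v : ℚ} {n : ℕ} {M : ℝ} (h0 : l00 ≠ 0)
    (h10 : (l10 : ℚ) = l00 * u ^ n) (h01 : (l01 : ℚ) = l00 * v ^ n)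
    (h11 : (l11 : ℚ) = l00 * u ^ n * v ^ n) (b00 : |(l00 : ℝ)| ≤ M) (b10 : |(l10 : ℝ)| ≤ M)
    (b01 : |(l01 : ℝ)| ≤ M) (b11 : |(l11 : ℝ)| ≤ M) : (Hq u * Hq v) ^ n ≤ M := by
  obtain ⟨a, ha⟩ : ∃ a, a = u.num ^ n := ⟨_, rfl⟩
  obtain ⟨b, hb⟩ : ∃ b, b = (u.den : ℤ) ^ n := ⟨_, rfl⟩
  obtain ⟨c, hc⟩ : ∃ c, c = v.num ^ n := ⟨_, rfl⟩
  obtain ⟨d, hd⟩ : ∃ d, d = (v.den : ℤ) ^ n := ⟨_, rfl⟩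
  have hab : IsCoprime b a := by
    rw [ha, hb]
    refine IsCoprime.pow (Int.isCoprime_iff_gcd_eq_one.2 ?_)
    have := u.reduced
    rw [Int.gcd_comm]
    simpa [Int.gcd, Nat.Coprime] using this
  have hcd : IsCoprime d c := by
    rw [hc, hd]
    refine IsCoprime.pow (Int.isCoprime_iff_gcd_eq_one.2 ?_)
    have := v.reduced
    rw [Int.gcd_comm]
    simpa [Int.gcd, Nat.Coprime] using this
  have hb0 : b ≠ 0 := by rw [hb]; exact pow_ne_zero _ (by exact_mod_cast u.den_nz)
  have hd0 : d ≠ 0 := by rw [hd]; exact pow_ne_zero _ (by exact_mod_cast v.den_nz)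
  have hu : u ^ n * (b : ℚ) = a := by
    rw [ha, hb]; push_cast; rw [← mul_pow, Rat.mul_den_eq_num]
  have hv : v ^ n * (d : ℚ) = c := by
    rw [hc, hd]; push_cast; rw [← mul_pow, Rat.mul_den_eq_num]
  have e10 : l10 * b = l00 * a := by
    have : (l10 : ℚ) * b = l00 * a := by rw [h10, ← hu]; ring
    exact_mod_cast this
  have e01 : l01 * d = l00 * c := by
    have : (l01 : ℚ) * d = l00 * c := by rw [h01, ← hv]; ring
    exact_mod_cast this
  have e11 : l11 * b = l01 * a := by
    have : (l11 : ℚ) * b = l01 * a := by rw [h11, h01, ← hu]; ring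
    exact_mod_cast this
  obtain ⟨μ, rfl⟩ : b ∣ l00 := hab.dvd_of_dvd_mul_right ⟨l10, by rw [← e10]; ring⟩
  obtain ⟨w, rfl⟩ : b ∣ l01 := hab.dvd_of_dvd_mul_right ⟨l11, by rw [← e11]; ring⟩
  have e2 : w * d = μ * c := mul_left_cancel₀ hb0 (by linear_combination e01)
  obtain ⟨η, rfl⟩ : d ∣ μ := hcd.dvd_of_dvd_mul_right ⟨w, by rw [← e2]; ring⟩
  have f01 : w = η * c := mul_right_cancel₀ hd0 (by linear_combination e2)
  have f10 : l10 = η * d * a := mul_right_cancel₀ hb0 (by linear_combination e10)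
  have f11 : l11 = η * c * a := mul_right_cancel₀ hb0 (by rw [e11, f01]; ring)
  have hη : η ≠ 0 := by rintro rfl; simp at h0
  have hη1 : (1 : ℝ) ≤ |(η : ℝ)| := by exact_mod_cast Int.one_le_abs hη
  have drop : ∀ z : ℝ, |(η : ℝ)| * z ≤ M → 0 ≤ z → z ≤ M := by
    intro z h hz
    nlinarith
  have m : ∀ x y : ℝ, 0 ≤ x → 0 ≤ y → max x y ^ n = max (x ^ n) (y ^ n) := by
    intro x y hx hy
    rcases le_total x y with h | h
    · rw [max_eq_right h, max_eq_right (by gcongr)]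
    · rw [max_eq_left h, max_eq_left (by gcongr)]
  have k1 : Hq u ^ n = max |(a : ℝ)| |(b : ℝ)| := by
    rw [Hq, m _ _ (abs_nonneg _) (Nat.cast_nonneg _), ha, hb]
    push_cast
    rw [abs_pow, abs_pow, Nat.abs_cast]
  have k2 : Hq v ^ n = max |(c : ℝ)| |(d : ℝ)| := by
    rw [Hq, m _ _ (abs_nonneg _) (Nat.cast_nonneg _), hc, hd]
    push_cast
    rw [abs_pow, abs_pow, Nat.abs_cast]
  rw [mul_pow, k1, k2]
  rw [f10] at b10
  rw [f01] at b01
  rw [f11] at b11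
  push_cast [abs_mul] at b00 b10 b01 b11
  have g00 := drop (|(b : ℝ)| * |(d : ℝ)|) (by linarith) (by positivity)
  have g10 := drop (|(a : ℝ)| * |(d : ℝ)|) (by linarith) (by positivity)
  have g01 := drop (|(b : ℝ)| * |(c : ℝ)|) (by linarith) (by positivity)
  have g11 := drop (|(a : ℝ)| * |(c : ℝ)|) (by linarith) (by positivity)
  rcases max_choice |(a : ℝ)| |(b : ℝ)| with h | h <;>
  rcases max_choice |(c : ℝ)| |(d : ℝ)| with h' | h' <;> rw [h, h'] <;> assumption

end

end PartP7c

section PartP7d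

section
open Polynomial

theorem phi_sum {A : Type*} [CommRing A] (x y : A) (q : ℤ[X][X]) (D E : ℕ)
    (h : ∀ i j, (q.coeff j).coeff i ≠ 0 → i + 4 ≤ D ∧ j ≤ E) :
    eval₂RingHom (eval₂RingHom (Int.castRingHom A) x) y q =
      ∑ j ∈ Finset.range (E + 1), ∑ i ∈ Finset.range (D - 3),
        (((q.coeff j).coeff i : ℤ) : A) * x ^ i * y ^ j := by
  have h1 : q.natDegree < E + 1 := by
    refine Nat.lt_succ_of_le (natDegree_le_iff_coeff_eq_zero.2 fun N hN => ?_)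
    ext i
    by_contra hne
    have := (h i N hne).2
    omega
  rw [coe_eval₂RingHom, eval₂_eq_sum_range' _ h1]
  refine Finset.sum_congr rfl fun j _ => ?_
  by_cases h0 : q.coeff j = 0
  · simp [h0]
  have h2 : (q.coeff j).natDegree < D - 3 := by
    have := (h _ j (leadingCoeff_ne_zero.2 h0)).1
    omega
  rw [coe_eval₂RingHom, eval₂_eq_sum_range' _ h2, Finset.sum_mul]
  rfl

/-- base change of power series -/
noncomputable def ιS : PowerSeries ℤ →+* PowerSeries ℚ := PowerSeries.map (Int.castRingHom ℚ)

theorem term_int {r H1 H2 N Kk : ℝ} (hr : 0 ≤ r) (hH1 : 0 ≤ H1) (hH2 : 0 ≤ H2) (q1 q2 P2 : ℤ)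
    (X1 Sg : PowerSeries ℤ) (x y S : PowerSeries ℚ) (D E s : ℕ) (hs : s ≤ 4)
    (hx : (q1 : PowerSeries ℚ) * x = ιS X1) (hy : (q2 : PowerSeries ℚ) * y = P2)
    (hS : ((q1 : PowerSeries ℚ) * q2) ^ s * S = ιS Sg)
    (bx : gd r (2 * H1) X1) (b1 : |(q1 : ℝ)| ≤ H1) (b2 : |(q2 : ℝ)| ≤ H2) (bP : |(P2 : ℝ)| ≤ H2)
    (bS : gd r (N * (H1 * H2) ^ s) Sg) (q : ℤ[X][X])
    (h : ∀ i j, |(((q.coeff j).coeff i : ℤ) : ℝ)| ≤ Kk ∧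
      ((q.coeff j).coeff i ≠ 0 → i + 4 ≤ D ∧ j ≤ E)) :
    ∃ g : PowerSeries ℤ, ιS g = (q1 : PowerSeries ℚ) ^ D * (q2 : PowerSeries ℚ) ^ (E + 4) *
      (eval₂RingHom (eval₂RingHom (Int.castRingHom (PowerSeries ℚ)) x) y q * S) ∧
      gd r (((E + 1 : ℕ) : ℝ) * (((D - 3 : ℕ) : ℝ) *
        (Kk * 2 ^ D * N * H1 ^ D * H2 ^ (E + 4)))) g := by
  have hKk : 0 ≤ Kk := (abs_nonneg _).trans (h 0 0).1
  refine ⟨∑ j ∈ Finset.range (E + 1), ∑ i ∈ Finset.range (D - 3),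
    ((((q.coeff j).coeff i : ℤ) : PowerSeries ℤ) * (q1 : PowerSeries ℤ) ^ (D - i - s) * X1 ^ i *
      (q2 : PowerSeries ℤ) ^ (E + 4 - j - s) * (P2 : PowerSeries ℤ) ^ j * Sg), ?_, ?_⟩
  · rw [phi_sum x y q D E fun i j => (h i j).2, Finset.sum_mul, Finset.mul_sum, map_sum]
    refine Finset.sum_congr rfl fun j hj => ?_
    rw [Finset.sum_mul, Finset.mul_sum, map_sum]
    refine Finset.sum_congr rfl fun i hi => ?_
    rw [Finset.mem_range] at hi hj
    obtain ⟨a, ha⟩ : ∃ a, D = a + s + i := ⟨D - i - s, by omega⟩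
    obtain ⟨b, hb⟩ : ∃ b, E + 4 = b + s + j := ⟨E + 4 - j - s, by omega⟩
    have e1 : D - i - s = a := by omega
    have e2 : E + 4 - j - s = b := by omega
    rw [e1, e2, ha, hb]
    simp only [map_mul, map_pow, map_intCast]
    rw [← hx, ← hy, ← hS]
    ring
  · have hc1 : (E + 1 : ℕ) = (Finset.range (E + 1)).card := by simp
    have hc2 : (D - 3 : ℕ) = (Finset.range (D - 3)).card := by simp
    refine gd_mono (gd_sum (Finset.range (E + 1)) _ (((D - 3 : ℕ) : ℝ) *
        (Kk * 2 ^ D * N * H1 ^ D * H2 ^ (E + 4))) hr fun j hj => ?_) (by rw [← hc1])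
    refine gd_mono (gd_sum (Finset.range (D - 3)) _
        (Kk * 2 ^ D * N * H1 ^ D * H2 ^ (E + 4)) hr fun i hi => ?_) (by rw [← hc2])
    rw [Finset.mem_range] at hi hj
    obtain ⟨a, ha⟩ : ∃ a, D = a + s + i := ⟨D - i - s, by omega⟩
    obtain ⟨b, hb⟩ : ∃ b, E + 4 = b + s + j := ⟨E + 4 - j - s, by omega⟩
    have e1 : D - i - s = a := by omega
    have e2 : E + 4 - j - s = b := by omega
    rw [e1, e2]
    refine gd_mono (gd_mul hr (gd_mul hr (gd_mul hr (gd_mul hr (gd_mul hr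
      (gd_mono (gd_intCast r _) (h i j).1) (gd_pow hr (gd_mono (gd_intCast r q1) b1) a))
      (gd_pow hr bx i)) (gd_pow hr (gd_mono (gd_intCast r q2) b2) b))
      (gd_pow hr (gd_mono (gd_intCast r P2) bP) j)) bS) ?_
    have hN : 0 ≤ N * (H1 * H2) ^ s := gd_nonneg bS
    have h2i : (2 : ℝ) ^ i ≤ 2 ^ D := pow_le_pow_right₀ (by norm_num) (by omega)
    calc Kk * H1 ^ a * (2 * H1) ^ i * H2 ^ b * H2 ^ j * (N * (H1 * H2) ^ s)
        = 2 ^ i * (Kk * H1 ^ (a + i) * H2 ^ (b + j) * (N * (H1 * H2) ^ s)) := by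
          rw [mul_pow, pow_add, pow_add]; ring
      _ ≤ 2 ^ D * (Kk * H1 ^ (a + i) * H2 ^ (b + j) * (N * (H1 * H2) ^ s)) := by
          gcongr
      _ = _ := by
          rw [hb]
          nth_rw 3 [ha]
          simp only [mul_pow, pow_add]; ring

theorem rat_int_of_sq {x : ℚ} {z : ℤ} (h : x ^ 2 = z) : ∃ w : ℤ, x = w ∧ w ^ 2 = z := by
  have h1 : IsSquare (z : ℚ) := ⟨x, by rw [← h, sq]⟩
  obtain ⟨m, hm⟩ := Rat.isSquare_intCast_iff.1 h1
  have h2 : x ^ 2 = (m : ℚ) ^ 2 := by rw [h, hm]; push_cast; ring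
  rcases sq_eq_sq_iff_eq_or_eq_neg.1 h2 with h3 | h3
  · exact ⟨m, h3, by rw [hm]; ring⟩
  · exact ⟨-m, by rw [h3]; push_cast; ring, by rw [hm]; ring⟩

theorem Hq_num (ξ : ℚ) : |(ξ.num : ℝ)| ≤ Hq ξ := le_max_left _ _
theorem Hq_den (ξ : ℚ) : |((ξ.den : ℤ) : ℝ)| ≤ Hq ξ := by
  have : (0 : ℝ) ≤ ξ.den := Nat.cast_nonneg _
  push_cast
  rw [abs_of_nonneg this]
  exact le_max_right _ _
theorem Hq_one (ξ : ℚ) : 1 ≤ Hq ξ := by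
  refine le_trans ?_ (le_max_right _ _)
  exact_mod_cast ξ.den_pos

theorem om_int {p : Prm} {M : ℝ} (hM : Pbd p M) (ξ ω : ℚ) (h : ω ^ 2 = p.F ξ) :
    ∃ Ω : ℤ, (Ω : ℚ) = (ξ.den : ℚ) ^ 2 * ω ∧ |(Ω : ℝ)| ≤ 2 * M ^ 3 * Hq ξ ^ 2 := by
  have hM1 := Pbd_one hM
  have h1 : ((ξ.den : ℚ) ^ 2 * ω) ^ 2 = ((Fh p ξ.num (ξ.den : ℤ) : ℤ) : ℚ) := by
    have := map_Fh p (Int.castRingHom ℚ) ξ.num (ξ.den : ℤ)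
    simp only [eq_intCast, Int.cast_natCast] at this
    rw [this, ← Rat.den_mul_eq_num, Fh_F, ← h]
    ring
  obtain ⟨w, hw, hw2⟩ := rat_int_of_sq h1
  refine ⟨w, hw.symm, ?_⟩
  have h2 := Fh_bound hM ξ.num ξ.den (Hq_num ξ) (Hq_den ξ)
  rw [← hw2] at h2
  have hH := Hq_one ξ
  refine abs_le_of_sq_le_sq ?_ (by positivity)
  push_cast at h2
  have h3 := (le_abs_self _).trans h2
  have h4 : M ^ 5 ≤ M ^ 6 := by gcongr; norm_num
  calc (w : ℝ) ^ 2 ≤ 4 * M ^ 5 * Hq ξ ^ 4 := h3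
    _ ≤ 4 * M ^ 6 * Hq ξ ^ 4 := by gcongr
    _ = _ := by ring

theorem local_curve {p : Prm} {M r : ℝ} (hr : 0 ≤ r) (hM : Pbd p M) (ξ1 ξ2 ω1 ω2 : ℚ)
    (h1 : ω1 ^ 2 = p.F ξ1) (h2 : ω2 ^ 2 = p.F ξ2) (X1 Z : PowerSeries ℤ) (x : PowerSeries ℚ)
    (hx : ((ξ1.den : ℤ) : PowerSeries ℚ) * x = ιS X1)
    (hZ : Fh p X1 (PowerSeries.C (ξ1.den : ℤ)) =
      PowerSeries.C (Fh p ξ1.num (ξ1.den : ℤ)) * Z ^ 2)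
    (hZ0 : PowerSeries.constantCoeff Z = 1) (hZg : gd r 2 Z) :
    ∃ (W : PowerSeries ℚ) (g : PowerSeries ℤ), W * W = p.F x * p.F (PowerSeries.C ξ2) ∧
      PowerSeries.constantCoeff W = ω1 * ω2 ∧
      (((ξ1.den : ℤ) : PowerSeries ℚ) * ((ξ2.den : ℤ) : PowerSeries ℚ)) ^ 2 * W = ιS g ∧
      gd r (8 * M ^ 6 * (Hq ξ1 * Hq ξ2) ^ 2) g := by
  have hM1 := Pbd_one hM
  obtain ⟨Ω1, hΩ1, bΩ1⟩ := om_int hM ξ1 ω1 h1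
  obtain ⟨Ω2, hΩ2, bΩ2⟩ := om_int hM ξ2 ω2 h2
  have hq0 : (ξ1.den : ℚ) ≠ 0 := by exact_mod_cast ξ1.den_nz
  have hH1 := Hq_one ξ1
  have hH2 := Hq_one ξ2
  refine ⟨PowerSeries.C (ω1 * ω2) * ιS Z, (Ω1 : PowerSeries ℤ) * Ω2 * Z, ?_, ?_, ?_, ?_⟩
  · have e1 := congrArg ιS hZ
    rw [map_Fh, ← hx] at e1
    have e2 : ιS (PowerSeries.C (ξ1.den : ℤ)) = ((ξ1.den : ℤ) : PowerSeries ℚ) := by simp [ιS]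
    rw [e2, Fh_F] at e1
    have e3 : ιS (PowerSeries.C (Fh p ξ1.num (ξ1.den : ℤ))) =
        PowerSeries.C ((ξ1.den : ℚ) ^ 4 * p.F ξ1) := by
      rw [← Fh_F, Rat.den_mul_eq_num]
      have := map_Fh p (Int.castRingHom ℚ) ξ1.num (ξ1.den : ℤ)
      simp only [eq_intCast, Int.cast_natCast] at this
      rw [← this]
      simp [ιS]
    rw [map_mul, e3, map_pow] at e1
    have e4 : ((ξ1.den : ℤ) : PowerSeries ℚ) = PowerSeries.C (ξ1.den : ℚ) := by simp
    rw [e4, map_mul, map_pow] at e1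
    have hC : (PowerSeries.C (ξ1.den : ℚ)) ^ 4 ≠ 0 := by
      refine pow_ne_zero _ fun h => hq0 ?_
      exact PowerSeries.C_injective (by rw [h, map_zero])
    have e5 : p.F x = PowerSeries.C (p.F ξ1) * ιS Z ^ 2 :=
      mul_left_cancel₀ hC (by rw [e1]; ring)
    rw [e5, ← p.map_F (PowerSeries.C : ℚ →+* PowerSeries ℚ), ← h1, ← h2]
    simp only [map_mul, map_pow]
    ring
  · have : PowerSeries.constantCoeff (ιS Z) = 1 := by
      rw [ιS, ← PowerSeries.coeff_zero_eq_constantCoeff_apply, PowerSeries.coeff_map,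
        PowerSeries.coeff_zero_eq_constantCoeff_apply, hZ0]
      simp
    rw [map_mul, this]
    simp
  · have e1 : ιS ((Ω1 : PowerSeries ℤ) * Ω2 * Z) = PowerSeries.C ((Ω1 : ℚ) * Ω2) * ιS Z := by
      simp
    rw [e1, hΩ1, hΩ2]
    simp
    ring
  · refine gd_mono (gd_mul hr (gd_mul hr (gd_mono (gd_intCast r Ω1) bΩ1)
      (gd_mono (gd_intCast r Ω2) bΩ2)) hZg) (le_of_eq ?_)
    ring

end

end PartP7d

section PartP7e

section
open Polynomial

theorem vanish (g : ℚ[X]) (hg : g ≠ 0) (ξ a : ℚ) (ha : a ≠ 0) (f x : PowerSeries ℚ)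
    (hx : x = PowerSeries.C ξ + PowerSeries.C a * PowerSeries.X)
    (hf : f ∣ eval₂ (PowerSeries.C : ℚ →+* PowerSeries ℚ) x g) :
    f ≠ 0 ∧ ∀ i, PowerSeries.X ^ i ∣ f → (X - C ξ) ^ i ∣ g := by
  obtain ⟨h, hgh, hh⟩ := exists_eq_pow_rootMultiplicity_mul_and_not_dvd g hg ξ
  obtain ⟨I, hI⟩ : ∃ I, I = rootMultiplicity ξ g := ⟨_, rfl⟩
  rw [← hI] at hgh
  have hx0 : PowerSeries.constantCoeff x = ξ := by simp [hx]
  have hu : IsUnit (PowerSeries.C a ^ I * eval₂ (PowerSeries.C : ℚ →+* PowerSeries ℚ) x h) := by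
    rw [PowerSeries.isUnit_iff_constantCoeff, isUnit_iff_ne_zero, map_mul, map_pow,
      PowerSeries.constantCoeff_C, hom_eval₂, hx0]
    refine mul_ne_zero (pow_ne_zero _ ha) ?_
    rw [dvd_iff_isRoot, IsRoot.def] at hh
    have : (PowerSeries.constantCoeff (R := ℚ)).comp PowerSeries.C = RingHom.id ℚ := by
      ext; simp
    rw [this]
    exact hh
  have e : eval₂ (PowerSeries.C : ℚ →+* PowerSeries ℚ) x g = PowerSeries.X ^ I *
      (PowerSeries.C a ^ I * eval₂ (PowerSeries.C : ℚ →+* PowerSeries ℚ) x h) := by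
    conv_lhs => rw [hgh]
    rw [eval₂_mul, eval₂_pow, eval₂_sub, eval₂_X, eval₂_C, hx]
    ring
  rw [e] at hf
  refine ⟨?_, fun i hi => ?_⟩
  · rintro rfl
    rw [zero_dvd_iff] at hf
    exact mul_ne_zero (pow_ne_zero _ PowerSeries.X_ne_zero) hu.ne_zero hf
  · have h1 := (IsUnit.dvd_mul_right hu).1 (hi.trans hf)
    have h2 : i ≤ I := (pow_dvd_pow_iff PowerSeries.X_ne_zero
      (fun h => by simpa using (PowerSeries.isUnit_iff_constantCoeff.1 h))).1 h1
    rw [hgh]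
    exact Dvd.dvd.mul_right (pow_dvd_pow _ h2) _

theorem phi_Gsp (x : PowerSeries ℚ) (ξ : ℚ) (G : ℤ[X][X]) :
    eval₂RingHom (eval₂RingHom (Int.castRingHom (PowerSeries ℚ)) x) (PowerSeries.C ξ) G =
      eval₂ (PowerSeries.C : ℚ →+* PowerSeries ℚ) x (Gsp ξ G) := by
  have : (eval₂RingHom (PowerSeries.C : ℚ →+* PowerSeries ℚ) x).comp
      (eval₂RingHom (mapRingHom (Int.castRingHom ℚ)) (C ξ)) =
      eval₂RingHom (eval₂RingHom (Int.castRingHom (PowerSeries ℚ)) x) (PowerSeries.C ξ) := by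
    refine Polynomial.ringHom_ext' ?_ ?_
    · refine Polynomial.ringHom_ext' ?_ ?_
      · exact RingHom.ext_int _ _
      · simp
    · simp
  rw [← this]
  rfl

/-- Kummer relation: `u` is the `X`-coordinate of `2^k P + Q` -/
def Kr (p : Prm) (k : ℕ) (x y W u : ℚ) : Prop :=
  (p.B k x y ≠ 0 ∧ u * p.B k x y = Ap p k x y W) ∨
  (Am p k x y W ≠ 0 ∧ u * Am p k x y W = p.C k x y)


theorem exists_Pbd (p p' : Prm) : ∃ M : ℝ, Pbd p M ∧ Pbd p' M := by
  refine ⟨1 + 2 * |(p.t : ℝ)| + 2 * |(p.t' : ℝ)| + |(p.b : ℝ)| + |(p.δ : ℝ)| +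
    2 * |(p'.t : ℝ)| + 2 * |(p'.t' : ℝ)| + |(p'.b : ℝ)| + |(p'.δ : ℝ)|, ?_, ?_⟩
  all_goals
    have := abs_nonneg (p.t : ℝ)
    have := abs_nonneg (p.t' : ℝ)
    have := abs_nonneg (p.b : ℝ)
    have := abs_nonneg (p.δ : ℝ)
    have := abs_nonneg (p'.t : ℝ)
    have := abs_nonneg (p'.t' : ℝ)
    have := abs_nonneg (p'.b : ℝ)
    have := abs_nonneg (p'.δ : ℝ)
    refine ⟨?_, ?_, ?_, ?_⟩ <;> linarith

theorem Fh_ne (p : Prm) (hb : 0 < p.b) (hδ : p.δ ≠ 0) (ξ : ℚ) :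
    Fh p ξ.num (ξ.den : ℤ) ≠ 0 := by
  have hd : (ξ.den : ℤ) ≠ 0 := by exact_mod_cast ξ.den_nz
  have hd2 : 0 < (ξ.den : ℤ) ^ 2 := by positivity
  unfold Fh
  simp only [Int.cast_id]
  refine mul_ne_zero (mul_ne_zero hδ ?_) ?_ <;> positivity

/-- leading coefficient relation on the first curve -/
theorem lead1 (p p' : Prm) (k n : ℕ) (c : Idx k n → ℤ) (x W V : PowerSeries ℚ) (ξ1 ξ2 u w : ℚ)
    (hx : PowerSeries.constantCoeff x = ξ1)
    (hW : W * W = p.F x * p.F (PowerSeries.C ξ2)) (hw : PowerSeries.constantCoeff W = w)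
    (hu : Kr p k ξ1 ξ2 w u) (e' : Bool) (i : ℕ)
    (hd : PowerSeries.X ^ i ∣ pol p p' k n c false e' x (PowerSeries.C ξ2) W V) :
    PowerSeries.X ^ i ∣ pol p p' k n c true e' x (PowerSeries.C ξ2) W V ∧
    PowerSeries.coeff i (pol p p' k n c true e' x (PowerSeries.C ξ2) W V) =
      PowerSeries.coeff i (pol p p' k n c false e' x (PowerSeries.C ξ2) W V) * u ^ n := by
  have cB : PowerSeries.constantCoeff (p.B k x (PowerSeries.C ξ2)) = p.B k ξ1 ξ2 := by
    rw [p.map_B, hx, PowerSeries.constantCoeff_C]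
  have cC : PowerSeries.constantCoeff (p.C k x (PowerSeries.C ξ2)) = p.C k ξ1 ξ2 := by
    rw [p.map_C, hx, PowerSeries.constantCoeff_C]
  have cAp : PowerSeries.constantCoeff (Ap p k x (PowerSeries.C ξ2) W) = Ap p k ξ1 ξ2 w := by
    rw [map_Ap, hx, PowerSeries.constantCoeff_C, hw]
  have cAm : PowerSeries.constantCoeff (Am p k x (PowerSeries.C ξ2) W) = Am p k ξ1 ξ2 w := by
    rw [map_Am, hx, PowerSeries.constantCoeff_C, hw]
  rcases hu with ⟨h0, h1⟩ | ⟨h0, h1⟩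
  · exact lead (pol_B1 hW e') hd (by rw [cB]; exact h0) (by rw [cB, cAp]; exact h1)
  · exact lead (pol_C1 hW e') hd (by rw [cAm]; exact h0) (by rw [cAm, cC]; exact h1)

theorem lead2 (p p' : Prm) (k n : ℕ) (c : Idx k n → ℤ) (x W V : PowerSeries ℚ) (ξ1 ξ2 u w : ℚ)
    (hx : PowerSeries.constantCoeff x = ξ1)
    (hW : V * V = p'.F x * p'.F (PowerSeries.C ξ2)) (hw : PowerSeries.constantCoeff V = w)
    (hu : Kr p' k ξ1 ξ2 w u) (e' : Bool) (i : ℕ)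
    (hd : PowerSeries.X ^ i ∣ pol p p' k n c e' false x (PowerSeries.C ξ2) W V) :
    PowerSeries.X ^ i ∣ pol p p' k n c e' true x (PowerSeries.C ξ2) W V ∧
    PowerSeries.coeff i (pol p p' k n c e' true x (PowerSeries.C ξ2) W V) =
      PowerSeries.coeff i (pol p p' k n c e' false x (PowerSeries.C ξ2) W V) * u ^ n := by
  have cB : PowerSeries.constantCoeff (p'.B k x (PowerSeries.C ξ2)) = p'.B k ξ1 ξ2 := by
    rw [p'.map_B, hx, PowerSeries.constantCoeff_C]
  have cC : PowerSeries.constantCoeff (p'.C k x (PowerSeries.C ξ2)) = p'.C k ξ1 ξ2 := by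
    rw [p'.map_C, hx, PowerSeries.constantCoeff_C]
  have cAp : PowerSeries.constantCoeff (Ap p' k x (PowerSeries.C ξ2) V) = Ap p' k ξ1 ξ2 w := by
    rw [map_Ap, hx, PowerSeries.constantCoeff_C, hw]
  have cAm : PowerSeries.constantCoeff (Am p' k x (PowerSeries.C ξ2) V) = Am p' k ξ1 ξ2 w := by
    rw [map_Am, hx, PowerSeries.constantCoeff_C, hw]
  rcases hu with ⟨h0, h1⟩ | ⟨h0, h1⟩
  · exact lead (pol_B2 hW e') hd (by rw [cB]; exact h0) (by rw [cB, cAp]; exact h1)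
  · exact lead (pol_C2 hW e') hd (by rw [cAm]; exact h0) (by rw [cAm, cC]; exact h1)

theorem main_ineq (p p' : Prm) (hb : 0 < p.b) (hb' : p'.b = p.b) (ht : p'.t = p.t) (hδ : p.δ ≠ 0)
    (hδ' : p'.δ ≠ 0) (hT : p.t ≠ p.t') (hT1 : p'.t ≠ p'.t') (hT' : p.t' ≠ p'.t') (n : ℕ)
    (hn : 11000 ≤ n) : ∃ K : ℝ, 1 ≤ K ∧ ∀ k, 9 * (64 * n + 1) ≤ 4 * 4 ^ k → 1 ≤ k →
    ∀ ξ1 ξ2 ω1 ω2 θ1 θ2 u v : ℚ, ω1 ^ 2 = p.F ξ1 → ω2 ^ 2 = p.F ξ2 → θ1 ^ 2 = p'.F ξ1 →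
    θ2 ^ 2 = p'.F ξ2 → K ≤ Hq ξ1 → K ^ 4 ^ k < Hq ξ2 → Kr p k ξ1 ξ2 (ω1 * ω2) u →
    Kr p' k ξ1 ξ2 (θ1 * θ2) v →
    (Hq u * Hq v) ^ n ≤ K ^ 4 ^ k * Hq ξ1 ^ ((16 * (n - 1) + 4) * 4 ^ k) *
      Hq ξ2 ^ (16 * n + 4) := by
  obtain ⟨K, hK, haux⟩ := aux_poly p p' hb hb' ht hδ hδ' hT hT1 hT' n hn
  obtain ⟨M, hM, hM'⟩ := exists_Pbd p p'
  have hM1 := Pbd_one hM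
  obtain ⟨R0, hR0⟩ : ∃ R0 : ℝ, R0 = 336 * M ^ 10 := ⟨_, rfl⟩
  obtain ⟨c0, hc0⟩ : ∃ c0 : ℝ, c0 = 4 * (16 * n + 1) * (64 * M ^ 12) := ⟨_, rfl⟩
  have hn0 : (0 : ℝ) ≤ n := Nat.cast_nonneg n
  have hR01 : 1 ≤ R0 := by
    rw [hR0]
    have : 1 ≤ M ^ 10 := one_le_pow₀ hM1
    linarith
  have hc01 : 1 ≤ c0 := by
    rw [hc0]
    have : 1 ≤ M ^ 12 := one_le_pow₀ hM1
    nlinarith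
  have h2n : (1 : ℝ) ≤ 2 ^ (32 * n) := one_le_pow₀ (by norm_num)
  have hK10 : K ≤ K ^ 10 := le_self_pow₀ hK (by norm_num)
  have hbig : K ≤ c0 * K ^ 10 * 2 ^ (32 * n) := by
    calc K ≤ 1 * K ^ 10 * 1 := by linarith
      _ ≤ _ := by gcongr
  refine ⟨R0 + c0 * K ^ 10 * 2 ^ (32 * n), by linarith, ?_⟩
  intro k hk4 hk1 ξ1 ξ2 ω1 ω2 θ1 θ2 u v hω1 hω2 hθ1 hθ2 hξ1 hξ2 hu hv
  obtain ⟨c, hco, hG⟩ := haux k hk1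
  have hH1 := Hq_one ξ1
  have hH2 := Hq_one ξ2
  obtain ⟨hG0, hGI⟩ := hG ξ1 ξ2 (lt_of_le_of_lt (by gcongr; linarith) hξ2)
  -- local parameter
  obtain ⟨cc, hcc⟩ : ∃ cc : ℤ, cc = 4 * Fh p ξ1.num (ξ1.den : ℤ) * Fh p' ξ1.num (ξ1.den : ℤ) :=
    ⟨_, rfl⟩
  have hcc' : cc = 4 * Fh p' ξ1.num (ξ1.den : ℤ) * Fh p ξ1.num (ξ1.den : ℤ) := by rw [hcc]; ring
  have hcc0 : cc ≠ 0 := by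
    rw [hcc]
    exact mul_ne_zero (mul_ne_zero (by norm_num) (Fh_ne p hb hδ ξ1))
      (Fh_ne p' (hb' ▸ hb) hδ' ξ1)
  obtain ⟨r, hr⟩ : ∃ r : ℝ, r = (336 * M ^ 10 * Hq ξ1 ^ 8)⁻¹ := ⟨_, rfl⟩
  have hr0 : 0 < r := by rw [hr]; positivity
  have hrr : r * (R0 * Hq ξ1 ^ 8) = 1 := by
    rw [hr, hR0]
    exact inv_mul_cancel₀ (by positivity)
  obtain ⟨hX1, Z1, hZ1, hZ10, hZ1g⟩ := loc_sqrt hM ξ1.num ξ1.den (Fh p' ξ1.num (ξ1.den : ℤ)) cc hH1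
    (Hq_num ξ1) (Hq_den ξ1) (Fh_bound hM' _ _ (Hq_num ξ1) (Hq_den ξ1)) hcc hr
  obtain ⟨-, Z2, hZ2, hZ20, hZ2g⟩ := loc_sqrt hM' ξ1.num ξ1.den (Fh p ξ1.num (ξ1.den : ℤ)) cc hH1
    (Hq_num ξ1) (Hq_den ξ1) (Fh_bound hM _ _ (Hq_num ξ1) (Hq_den ξ1)) hcc' hr
  obtain ⟨X1, hX1d⟩ : ∃ X1, X1 = PowerSeries.C ξ1.num + PowerSeries.C cc * PowerSeries.X :=
    ⟨_, rfl⟩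
  rw [← hX1d] at hX1 hZ1 hZ2
  have hq0 : (ξ1.den : ℚ) ≠ 0 := by exact_mod_cast ξ1.den_nz
  obtain ⟨x, hxd⟩ : ∃ x : PowerSeries ℚ, x = PowerSeries.C ξ1 +
    PowerSeries.C ((cc : ℚ) / ξ1.den) * PowerSeries.X := ⟨_, rfl⟩
  have hx0 : PowerSeries.constantCoeff x = ξ1 := by simp [hxd]
  have hx : ((ξ1.den : ℤ) : PowerSeries ℚ) * x = ιS X1 := by
    have e4 : ((ξ1.den : ℤ) : PowerSeries ℚ) = PowerSeries.C (ξ1.den : ℚ) := by simp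
    have e5 : ιS X1 = PowerSeries.C (ξ1.num : ℚ) + PowerSeries.C (cc : ℚ) * PowerSeries.X := by
      rw [hX1d]; simp [ιS]
    rw [e4, e5, hxd, mul_add, ← mul_assoc, ← map_mul, ← map_mul, Rat.den_mul_eq_num,
      mul_div_cancel₀ _ hq0]
  have hy : ((ξ2.den : ℤ) : PowerSeries ℚ) * PowerSeries.C ξ2 = (ξ2.num : PowerSeries ℚ) := by
    have e4 : ((ξ2.den : ℤ) : PowerSeries ℚ) = PowerSeries.C (ξ2.den : ℚ) := by simp
    have e5 : (ξ2.num : PowerSeries ℚ) = PowerSeries.C (ξ2.num : ℚ) := by simp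
    rw [e4, e5, ← map_mul, Rat.den_mul_eq_num]
  obtain ⟨W, gw, hW, hW0, hWg, bW⟩ := local_curve hr0.le hM ξ1 ξ2 ω1 ω2 hω1 hω2 X1 Z1 x hx hZ1 hZ10 hZ1g
  obtain ⟨V, gv, hV, hV0, hVg, bV⟩ := local_curve hr0.le hM' ξ1 ξ2 θ1 θ2 hθ1 hθ2 X1 Z2 x hx hZ2 hZ20 hZ2g
  obtain ⟨φ, hφ⟩ : ∃ φ : ℤ[X][X] →+* PowerSeries ℚ, φ =
    eval₂RingHom (eval₂RingHom (Int.castRingHom (PowerSeries ℚ)) x) (PowerSeries.C ξ2) := ⟨_, rfl⟩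
  have hφx : φ (C X) = x := by simp [hφ]
  have hφy : φ X = PowerSeries.C ξ2 := by simp [hφ]
  have hφW : W * W = φ (fS p) := by
    rw [hW, fS, map_mul, p.map_F φ, p.map_F φ, hφx, hφy]
  have hφV : V * V = φ (fS p') := by
    rw [hV, fS, map_mul, p'.map_F φ, p'.map_F φ, hφx, hφy]
  have hpol : ∀ e e', evR p p' φ W V hφW hφV (gpol p p' k n c e e') =
      pol p p' k n c e e' x (PowerSeries.C ξ2) W V := by
    intro e e'
    rw [gpol, map_pol, evR_gx, evR_gy, evR_gW, evR_gV, hφx, hφy]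
  -- order of vanishing
  have hdv : pol p p' k n c false false x (PowerSeries.C ξ2) W V ∣
      eval₂ (PowerSeries.C : ℚ →+* PowerSeries ℚ) x
        (Gsp ξ2 (NN p p' (gpol p p' k n c false false))) := by
    rw [← phi_Gsp, ← hφ, ← evR_gS p p' φ W V hφW hφV, ← hpol]
    exact map_dvd _ (NN_dvd p p' _)
  obtain ⟨hP0, hPi⟩ := vanish _ hG0 ξ1 ((cc : ℚ) / ξ1.den)
    (div_ne_zero (by exact_mod_cast hcc0) hq0) _ x hxd hdv
  obtain ⟨i0, hi0⟩ : ∃ i0, i0 = (pol p p' k n c false false x (PowerSeries.C ξ2) W V).order.toNat :=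
    ⟨_, rfl⟩
  have hcoe : PowerSeries.coeff i0 (pol p p' k n c false false x (PowerSeries.C ξ2) W V) ≠ 0 := by
    rw [hi0]
    exact PowerSeries.coeff_order hP0
  have hXd : PowerSeries.X ^ i0 ∣ pol p p' k n c false false x (PowerSeries.C ξ2) W V := by
    rw [hi0]; exact PowerSeries.X_pow_order_dvd
  have hI := hGI i0 (hPi i0 hXd)
  -- leading coefficients
  obtain ⟨hX10, l10⟩ := lead1 p p' k n c x W V ξ1 ξ2 u _ hx0 hW hW0 hu false i0 hXd
  obtain ⟨hX01, l01⟩ := lead2 p p' k n c x W V ξ1 ξ2 v _ hx0 hV hV0 hv false i0 hXd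
  obtain ⟨hX11, l11⟩ := lead1 p p' k n c x W V ξ1 ξ2 u _ hx0 hW hW0 hu true i0 hX01
  rw [l01] at l11
  obtain ⟨D, hD⟩ : ∃ D, D = 16 * (n - 1) * 4 ^ k := ⟨_, rfl⟩
  obtain ⟨BB, hBB⟩ : ∃ BB : ℝ, BB = ((16 * n + 1 : ℕ) : ℝ) * (((D - 3 : ℕ) : ℝ) *
        (K ^ 4 ^ k * 2 ^ D * (64 * M ^ 12) * Hq ξ1 ^ D * Hq ξ2 ^ (16 * n + 4))) := ⟨_, rfl⟩
  have hlam : ∀ e e', ∃ l : ℤ, (l : ℚ) = (ξ1.den : ℚ) ^ D * (ξ2.den : ℚ) ^ (16 * n + 4) *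
      PowerSeries.coeff i0 (pol p p' k n c e e' x (PowerSeries.C ξ2) W V) ∧
      |(l : ℝ)| * r ^ i0 ≤ 4 * BB := by
    intro e e'
    have ht : ∀ (s : Bool × Bool) (S : PowerSeries ℚ) (Sg : PowerSeries ℤ) (ss : ℕ), ss ≤ 4 →
        (((ξ1.den : ℤ) : PowerSeries ℚ) * ((ξ2.den : ℤ) : PowerSeries ℚ)) ^ ss * S = ιS Sg →
        gd r (64 * M ^ 12 * (Hq ξ1 * Hq ξ2) ^ ss) Sg →
        ∃ g : PowerSeries ℤ, ιS g = ((ξ1.den : ℤ) : PowerSeries ℚ) ^ D *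
          ((ξ2.den : ℤ) : PowerSeries ℚ) ^ (16 * n + 4) *
          (φ (cmp4 (gpol p p' k n c e e') s) * S) ∧ gd r BB g := by
      intro s S Sg ss hss h1 h2
      rw [hφ, hBB]
      exact term_int hr0.le (by linarith) (by linarith) ξ1.den ξ2.den ξ2.num X1 Sg x
        (PowerSeries.C ξ2) S D (16 * n) ss hss hx hy h1 hX1 (Hq_den ξ1) (Hq_den ξ2) (Hq_num ξ2) h2
        (cmp4 (gpol p p' k n c e e') s) (fun i j => by rw [hD]; exact hco e e' s i j)
    have hM12 : 1 ≤ M ^ 12 := one_le_pow₀ hM1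
    have hM6 : M ^ 6 ≤ M ^ 12 := pow_le_pow_right₀ hM1 (by norm_num)
    have hHH : 0 ≤ (Hq ξ1 * Hq ξ2) ^ 2 := by positivity
    obtain ⟨g1, e1, b1⟩ := ht (false, false) 1 1 0 (by norm_num) (by simp)
      (gd_mono (gd_one r) (by rw [pow_zero]; linarith))
    obtain ⟨g2, e2, b2⟩ := ht (true, false) W gw 2 (by norm_num) hWg
      (gd_mono bW (by gcongr; linarith))
    obtain ⟨g3, e3, b3⟩ := ht (false, true) V gv 2 (by norm_num) hVg
      (gd_mono bV (by gcongr; linarith))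
    obtain ⟨g4, e4, b4⟩ := ht (true, true) (W * V) (gw * gv) 4 (by norm_num)
      (by rw [map_mul, ← hWg, ← hVg]; ring)
      (gd_mono (gd_mul hr0.le bW bV) (le_of_eq (by ring)))
    refine ⟨PowerSeries.coeff i0 (g1 + g2 + g3 + g4), ?_, ?_⟩
    · have h1 : ιS (g1 + g2 + g3 + g4) = PowerSeries.C ((ξ1.den : ℚ) ^ D *
          (ξ2.den : ℚ) ^ (16 * n + 4)) * pol p p' k n c e e' x (PowerSeries.C ξ2) W V := by
        rw [← hpol, evR_cmp4, map_add, map_add, map_add, e1, e2, e3, e4]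
        simp only [map_mul, map_pow, map_natCast, Int.cast_natCast]
        ring
      have h2 := congrArg (PowerSeries.coeff i0) h1
      rw [PowerSeries.coeff_C_mul] at h2
      rw [← h2, ιS, PowerSeries.coeff_map]
      rfl
    · refine gd_coeff hr0.le (gd_mono (gd_add hr0.le (gd_add hr0.le (gd_add hr0.le b1 b2) b3) b4) ?_) i0
      linarith
  obtain ⟨m00, f00, g00⟩ := hlam false false
  obtain ⟨m10, f10, g10⟩ := hlam true false
  obtain ⟨m01, f01, g01⟩ := hlam false true
  obtain ⟨m11, f11, g11⟩ := hlam true true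
  have hq20 : (ξ2.den : ℚ) ≠ 0 := by exact_mod_cast ξ2.den_nz
  have hm0 : m00 ≠ 0 := by
    have : (m00 : ℚ) ≠ 0 := by
      rw [f00]
      exact mul_ne_zero (mul_ne_zero (pow_ne_zero _ hq0) (pow_ne_zero _ hq20)) hcoe
    exact_mod_cast this
  -- final bound
  have hBB0 : 0 ≤ BB := by rw [hBB]; positivity
  have hfin : 4 * BB * (R0 * Hq ξ1 ^ 8) ^ i0 ≤ (R0 + c0 * K ^ 10 * 2 ^ (32 * n)) ^ 4 ^ k *
      Hq ξ1 ^ ((16 * (n - 1) + 4) * 4 ^ k) * Hq ξ2 ^ (16 * n + 4) := by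
    have hRH : R0 ≤ Hq ξ1 := by
      refine le_trans ?_ hξ1
      have : 0 ≤ c0 * K ^ 10 * 2 ^ (32 * n) := by positivity
      linarith
    have s1 : (R0 * Hq ξ1 ^ 8) ^ i0 ≤ Hq ξ1 ^ (9 * (64 * n + 1)) * (K ^ 9) ^ 4 ^ k := by
      calc (R0 * Hq ξ1 ^ 8) ^ i0 ≤ (Hq ξ1 * Hq ξ1 ^ 8) ^ i0 := by gcongr
        _ = (Hq ξ1 ^ i0) ^ 9 := by rw [← pow_succ', ← pow_mul, ← pow_mul, mul_comm]
        _ ≤ (Hq ξ1 ^ ((64 * n + 1) + (i0 - (64 * n + 1)))) ^ 9 := by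
          gcongr
          omega
        _ ≤ (Hq ξ1 ^ (64 * n + 1) * K ^ 4 ^ k) ^ 9 := by
          rw [pow_add]
          gcongr
        _ = _ := by
          rw [mul_pow, ← pow_mul, ← pow_mul, ← pow_mul, mul_comm _ 9, mul_comm _ 9]
    have s2 : Hq ξ1 ^ D * Hq ξ1 ^ (9 * (64 * n + 1)) ≤ Hq ξ1 ^ ((16 * (n - 1) + 4) * 4 ^ k) := by
      rw [← pow_add]
      refine pow_le_pow_right₀ hH1 ?_
      rw [hD, add_mul]
      omega
    have s3 : ((D - 3 : ℕ) : ℝ) * 2 ^ D ≤ (2 ^ (32 * n)) ^ 4 ^ k := by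
      have : ((D - 3 : ℕ) : ℝ) ≤ 2 ^ D := by
        have h1 : D - 3 ≤ 2 ^ D := (Nat.sub_le _ _).trans (Nat.lt_pow_self (by norm_num)).le
        exact_mod_cast h1
      calc ((D - 3 : ℕ) : ℝ) * 2 ^ D ≤ 2 ^ D * 2 ^ D := by gcongr
        _ = 2 ^ (D + D) := by rw [pow_add]
        _ ≤ 2 ^ (32 * n * 4 ^ k) := by
          refine pow_le_pow_right₀ (by norm_num) ?_
          rw [hD, ← add_mul]
          gcongr
          omega
        _ = _ := by rw [pow_mul]
    have h4k : 4 ^ k ≠ 0 := by positivity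
    have s4 : c0 ≤ c0 ^ 4 ^ k := le_self_pow₀ hc01 h4k
    calc 4 * BB * (R0 * Hq ξ1 ^ 8) ^ i0
        ≤ 4 * BB * (Hq ξ1 ^ (9 * (64 * n + 1)) * (K ^ 9) ^ 4 ^ k) := by gcongr
      _ = c0 * (K ^ 4 ^ k * (K ^ 9) ^ 4 ^ k) * (((D - 3 : ℕ) : ℝ) * 2 ^ D) *
          (Hq ξ1 ^ D * Hq ξ1 ^ (9 * (64 * n + 1))) * Hq ξ2 ^ (16 * n + 4) := by
          rw [hBB, hc0]; push_cast; ring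
      _ ≤ c0 ^ 4 ^ k * (K ^ 4 ^ k * (K ^ 9) ^ 4 ^ k) * ((2 ^ (32 * n)) ^ 4 ^ k) *
          Hq ξ1 ^ ((16 * (n - 1) + 4) * 4 ^ k) * Hq ξ2 ^ (16 * n + 4) := by
          gcongr
      _ = (c0 * K ^ 10 * 2 ^ (32 * n)) ^ 4 ^ k *
          Hq ξ1 ^ ((16 * (n - 1) + 4) * 4 ^ k) * Hq ξ2 ^ (16 * n + 4) := by
          rw [← mul_pow, ← mul_pow, ← mul_pow]
          congr 4
          ring
      _ ≤ _ := by gcongr; linarith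
  have hlast : ∀ l : ℤ, |(l : ℝ)| * r ^ i0 ≤ 4 * BB →
      |(l : ℝ)| ≤ (R0 + c0 * K ^ 10 * 2 ^ (32 * n)) ^ 4 ^ k *
      Hq ξ1 ^ ((16 * (n - 1) + 4) * 4 ^ k) * Hq ξ2 ^ (16 * n + 4) := by
    intro l hl
    refine le_trans ?_ hfin
    calc |(l : ℝ)| = |(l : ℝ)| * r ^ i0 * (R0 * Hq ξ1 ^ 8) ^ i0 := by
          rw [mul_assoc, ← mul_pow, hrr, one_pow, mul_one]
      _ ≤ _ := by gcongr
  refine int_lead hm0 ?_ ?_ ?_ (hlast _ g00) (hlast _ g10) (hlast _ g01) (hlast _ g11)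
  · rw [f10, f00, l10]; ring
  · rw [f01, f00, l01]; ring
  · rw [f11, f00, l11]; ring

end

end PartP7e

section PartP7f

section P7f
open WeierstrassCurve Height

lemma Hq_log (u : ℚ) : Real.log (Hq u) = logHeight₁ u := by
  rw [Rat.logHeight₁_eq_log_max]
  congr 1
  unfold Hq
  push_cast
  rw [Nat.cast_natAbs]
  push_cast
  rfl

lemma hom_c (r s : ℚ) : (MvPolynomial.C r * MvPolynomial.X 0 ^ 2 +
    MvPolynomial.C s * MvPolynomial.X 1 ^ 2 : MvPolynomial (Fin 2) ℚ).IsHomogeneous 2 :=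
  (MvPolynomial.IsHomogeneous.C_mul ((MvPolynomial.isHomogeneous_X ℚ 0).pow 2) r).add
    (MvPolynomial.IsHomogeneous.C_mul ((MvPolynomial.isHomogeneous_X ℚ 1).pow 2) s)

lemma height_m (e κ b T : ℚ) (he : e ≠ 0) (hκ : κ ≠ 0) (hb : b ≠ 0) (h : κ = b + T ^ 2) :
    ∃ C : ℝ, ∀ m : ℚ, |logHeight₁ (e * (m ^ 2 - κ) ^ 2 / ((m ^ 2 + κ) ^ 2 - 4 * T ^ 2 * m ^ 2)) -
      4 * logHeight₁ m| ≤ C := by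
  obtain ⟨pp, hpp⟩ : ∃ pp : Fin 2 → MvPolynomial (Fin 2) ℚ, pp =
    ![MvPolynomial.C e * (MvPolynomial.C 1 * MvPolynomial.X 0 ^ 2 +
      MvPolynomial.C (-κ) * MvPolynomial.X 1 ^ 2) ^ 2,
      (MvPolynomial.C 1 * MvPolynomial.X 0 ^ 2 +
      MvPolynomial.C κ * MvPolynomial.X 1 ^ 2) ^ 2 +
      MvPolynomial.C (-(4 * T ^ 2)) * (MvPolynomial.X 0 * MvPolynomial.X 1) ^ 2] := ⟨_, rfl⟩
  obtain ⟨qq, hqq⟩ : ∃ qq : Fin 2 × Fin 2 → MvPolynomial (Fin 2) ℚ, qq =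
    fun ij => ![![MvPolynomial.C (1 / e - 2 * κ / (4 * b * e)) * MvPolynomial.X 0 ^ 2 +
      MvPolynomial.C (κ ^ 2 / (4 * b * e)) * MvPolynomial.X 1 ^ 2,
      MvPolynomial.C (2 * κ / (4 * b)) * MvPolynomial.X 0 ^ 2 +
      MvPolynomial.C (- κ ^ 2 / (4 * b)) * MvPolynomial.X 1 ^ 2],
      ![MvPolynomial.C (1 / (4 * b * κ ^ 2 * e)) * MvPolynomial.X 0 ^ 2 +
      MvPolynomial.C (1 / (κ ^ 2 * e) - 2 * κ / (4 * b * κ ^ 2 * e)) * MvPolynomial.X 1 ^ 2,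
      MvPolynomial.C (-1 / (4 * b * κ ^ 2)) * MvPolynomial.X 0 ^ 2 +
      MvPolynomial.C (2 * κ / (4 * b * κ ^ 2)) * MvPolynomial.X 1 ^ 2]] ij.1 ij.2 := ⟨_, rfl⟩
  have h1 : ∀ i, (pp i).IsHomogeneous 4 := by
    intro i
    rw [hpp]
    fin_cases i
    · exact ((hom_c _ _).pow 2).C_mul e
    · refine ((hom_c _ _).pow 2).add (MvPolynomial.IsHomogeneous.C_mul (m := 4) ?_ _)
      exact (((MvPolynomial.isHomogeneous_X ℚ 0).mul (MvPolynomial.isHomogeneous_X ℚ 1)).pow 2)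
  have h2 : ∀ i, (qq i).IsHomogeneous 2 := by
    rintro ⟨i, j⟩
    rw [hqq]
    fin_cases i <;> fin_cases j <;> exact hom_c _ _
  obtain ⟨C1, hC1⟩ := logHeight_eval_le' h1
  obtain ⟨C2, hC2⟩ := logHeight_eval_ge' (N := 4) h2
  refine ⟨max C1 (-C2), fun m => ?_⟩
  have e1 : (fun j => (pp j).eval ![m, 1]) =
      ![e * (m ^ 2 - κ) ^ 2, (m ^ 2 + κ) ^ 2 - 4 * T ^ 2 * m ^ 2] := by
    funext j
    rw [hpp]
    fin_cases j <;> simp <;> first | (left; ring) | ring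
  have a1 := hC1 ![m, 1]
  have a2 := hC2 pp (x := ![m, 1]) (by
    intro k
    rw [Fin.sum_univ_two]
    have f0 := congrFun e1 0
    have f1 := congrFun e1 1
    simp only [Matrix.cons_val_zero, Matrix.cons_val_one] at f0 f1
    rw [f0, f1, hqq]
    have hT : T ^ 2 = κ - b := by rw [h]; ring
    rw [hT]
    fin_cases k <;> simp <;> field_simp <;> ring)
  rw [e1, ← logHeight₁_div_eq_logHeight, ← logHeight₁_div_eq_logHeight, div_one] at a1 a2
  rw [abs_le]
  push_cast at a1 a2
  constructor <;> linarith [le_max_left C1 (-C2), le_max_right C1 (-C2)]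

lemma height_shift (c : ℚ) : ∃ C : ℝ, ∀ x : ℚ, |logHeight₁ (x - c) - logHeight₁ x| ≤ C := by
  refine ⟨totalWeight ℚ * Real.log 2 + logHeight₁ c, fun x => abs_le.2 ⟨?_, ?_⟩⟩
  · have := logHeight₁_add_le (x - c) c
    rw [sub_add_cancel] at this
    linarith
  · have := logHeight₁_sub_le x c
    linarith

lemma height_s0 (p : Prm) (hb : 0 < p.b) (hδ : p.δ ≠ 0) (hT : p.t ≠ p.t') :
    ∃ C : ℝ, ∀ x : ℚ, |logHeight₁ ((p.s0 x).1 / (p.s0 x).2.1) - 4 * logHeight₁ x| ≤ C := by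
  have hT0 := T_ne p hT
  have hκ : p.κ ≠ 0 := by
    have : 0 < p.κ := by unfold Prm.κ; positivity
    omega
  obtain ⟨C1, h1⟩ := height_m ((p.δ : ℚ) * p.T ^ 2) p.κ p.b p.T
    (mul_ne_zero (by exact_mod_cast hδ) (pow_ne_zero _ (by exact_mod_cast hT0)))
    (by exact_mod_cast hκ) (by exact_mod_cast hb.ne') (by unfold Prm.κ; push_cast; ring)
  obtain ⟨C2, h2⟩ := height_shift ((p.t : ℚ) + p.t')
  refine ⟨C1 + 4 * C2, fun x => ?_⟩
  have a1 := h1 (x - (p.t + p.t'))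
  have a2 := h2 x
  have e1 : (p.s0 x).1 = (p.δ : ℚ) * p.T ^ 2 * ((x - (p.t + p.t')) ^ 2 - p.κ) ^ 2 := by
    simp only [Prm.s0, Prm.m]; ring
  have e2 : (p.s0 x).2.1 = ((x - (p.t + p.t')) ^ 2 + (p.κ : ℚ)) ^ 2 -
      4 * (p.T : ℚ) ^ 2 * (x - (p.t + p.t')) ^ 2 := by
    simp only [Prm.s0, Prm.q1, Prm.q2, Prm.κ, Prm.T]; push_cast; ring
  rw [e1, e2]
  rw [abs_le] at *
  constructor <;> linarith [a1.1, a1.2, a2.1, a2.2]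

/-- the point with parameters `(ξ, ω)` multiplied by `2 ^ k` -/
def PtR (p : Prm) (ξ ω : ℚ) (k : ℕ) (P : (EC (p.a2 : ℚ) (p.a4 : ℚ)).Point) : Prop :=
  (p.sk k ξ).2.1 ≠ 0 ∧ ∃ h, P = Affine.Point.some ((p.sk k ξ).1 / (p.sk k ξ).2.1)
    (ω * (p.sk k ξ).2.2 / (p.sk k ξ).2.1 ^ 2) h

lemma PtR_zero (p : Prm) (hb : 0 < p.b) (hδ : p.δ ≠ 0) (hT : p.t ≠ p.t') (ξ ω : ℚ)
    (hω : ω ^ 2 = p.F ξ) : ∃ P, PtR p ξ ω 0 P := by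
  have hb' : (0 : ℚ) < p.b := by exact_mod_cast hb
  have hβ : (p.sk 0 ξ).2.1 ≠ 0 := by
    have : 0 < (p.sk 0 ξ).2.1 := by
      change 0 < p.q1 ξ * p.q2 ξ
      simp only [Prm.q1, Prm.q2]
      positivity
    exact this.ne'
  have hi := p.sk_inv 0 ξ
  rw [← hω] at hi
  unfold PtR
  generalize p.sk 0 ξ = s at *
  have hns : (EC (p.a2 : ℚ) (p.a4 : ℚ)).Nonsingular (s.1 / s.2.1) (ω * s.2.2 / s.2.1 ^ 2) := by
    apply EC_nonsingular (by exact_mod_cast a4_ne p hb hδ hT) (by exact_mod_cast disc_ne p hb hδ)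
    unfold cub at hi
    field_simp
    linear_combination hi
  exact ⟨_, hβ, hns, rfl⟩

lemma PtR_succ (p : Prm) (ξ ω : ℚ) (hω : ω ^ 2 = p.F ξ) (k : ℕ) (P) (hP : PtR p ξ ω k P)
    (h0 : P + P ≠ 0) : PtR p ξ ω (k + 1) (P + P) := by
  obtain ⟨hβ, h, rfl⟩ := hP
  have hi := p.sk_inv k ξ
  rw [← hω] at hi
  have es : p.sk (k + 1) ξ = dup (p.a2 : ℚ) (p.a4 : ℚ) (p.sk k ξ) := by
    simp only [Prm.sk, Function.iterate_succ_apply']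
  unfold PtR
  rw [es]
  generalize p.sk k ξ = s at *
  have hy : ω * s.2.2 / s.2.1 ^ 2 ≠ 0 := by
    intro hy
    apply h0
    obtain ⟨h', e⟩ := some_congr h rfl hy
    rw [e, EC_dbl_zero]
  have hωρ : ω * s.2.2 ≠ 0 := fun h => hy (by rw [h, zero_div])
  have hω0 : ω ≠ 0 := left_ne_zero_of_mul hωρ
  have hρ0 : s.2.2 ≠ 0 := right_ne_zero_of_mul hωρ
  have hd : (dup (p.a2 : ℚ) (p.a4 : ℚ) s).2.1 = 4 * ω ^ 2 * s.2.2 ^ 2 := by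
    simp only [dup, cub] at *
    linear_combination -4 * hi
  refine ⟨by rw [hd]; positivity, ?_⟩
  obtain ⟨h3, e3⟩ := EC_dbl h hy
  rw [e3]
  apply some_congr
  · rw [hd]
    simp only [dup]
    field_simp
  · rw [hd]
    simp only [dup]
    field_simp
    ring

lemma PtR_pow (p : Prm) (ξ ω : ℚ) (hω : ω ^ 2 = p.F ξ) (P) (hP : PtR p ξ ω 0 P) (k : ℕ)
    (h0 : ∀ j ≤ k, 2 ^ j • P ≠ 0) : PtR p ξ ω k (2 ^ k • P) := by
  induction k with
  | zero => simpa using hP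
  | succ k ih =>
    have e : 2 ^ (k + 1) • P = 2 ^ k • P + 2 ^ k • P := by rw [pow_succ, mul_two, add_nsmul]
    have := h0 (k + 1) le_rfl
    rw [e] at *
    exact PtR_succ p ξ ω hω k _ (ih fun j hj => h0 j (by omega)) this

lemma PtR_Kr (p : Prm) (ξ1 ξ2 ω1 ω2 : ℚ) (k : ℕ) (P Q) (hP : PtR p ξ1 ω1 k P)
    (hQ : PtR p ξ2 ω2 0 Q) (hPQ : P ≠ -Q) :
    ∃ u, Kr p k ξ1 ξ2 (ω1 * ω2) u ∧ nh (P + Q) = logHeight₁ u := by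
  obtain ⟨hβ, h, rfl⟩ := hP
  obtain ⟨hβ', h', rfl⟩ := hQ
  simp only [Kr, Ap, Am, Prm.B, Prm.C, Prm.S, Prm.R, KB, KC, KS]
  generalize p.sk k ξ1 = s at *
  generalize p.sk 0 ξ2 = s' at *
  by_cases hX : s.1 / s.2.1 = s'.1 / s'.2.1
  · rcases Affine.Point.X_eq_iff (h₁ := h) (h₂ := h') |>.1 hX with e | e
    · have hy : ω2 * s'.2.2 / s'.2.1 ^ 2 ≠ 0 := by
        intro hy
        apply hPQ
        obtain ⟨h'', e'⟩ := some_congr h' rfl hy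
        rw [e, eq_neg_iff_add_eq_zero, e', EC_dbl_zero]
      obtain ⟨h3, e3⟩ := EC_dbl h' hy
      have hE := EC_eq h'
      rw [e, e3, nh_some]
      refine ⟨_, Or.inr ?_, rfl⟩
      have e4 := e
      simp only [Affine.Point.some.injEq] at e4
      obtain ⟨hx, hyy⟩ := e4
      obtain ⟨X, hXd⟩ : ∃ X, X = s'.1 / s'.2.1 := ⟨_, rfl⟩
      obtain ⟨Y, hYd⟩ : ∃ Y, Y = ω2 * s'.2.2 / s'.2.1 ^ 2 := ⟨_, rfl⟩
      rw [← hXd] at hx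
      rw [← hYd] at hyy
      rw [← hXd, ← hYd] at hE
      rw [← hYd] at hy
      rw [← hXd, ← hYd]
      have g1 : s.1 = X * s.2.1 := by rw [← hx]; field_simp
      have g2 : s'.1 = X * s'.2.1 := by rw [hXd]; field_simp
      have g3 : ω1 * s.2.2 = Y * s.2.1 ^ 2 := by rw [← hyy]; field_simp
      have g4 : ω2 * s'.2.2 = Y * s'.2.1 ^ 2 := by rw [hYd]; field_simp
      have hAm : (s.1 * s'.1 + (p.a4 : ℚ) * s.2.1 * s'.2.1) * (s.1 * s'.2.1 + s'.1 * s.2.1) +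
          2 * (p.a2 : ℚ) * s.1 * s'.1 * s.2.1 * s'.2.1 + 2 * s.2.2 * s'.2.2 * (ω1 * ω2) =
          4 * Y ^ 2 * (s.2.1 ^ 2 * s'.2.1 ^ 2) := by
        have : 2 * s.2.2 * s'.2.2 * (ω1 * ω2) = 2 * (ω1 * s.2.2) * (ω2 * s'.2.2) := by ring
        rw [this, g1, g2, g3, g4]
        linear_combination -2 * (s.2.1 ^ 2 * s'.2.1 ^ 2) * hE
      rw [hAm]
      refine ⟨by positivity, ?_⟩
      rw [g1, g2]
      field_simp
    · exact absurd e hPQ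
  · obtain ⟨y3, h3, e3⟩ := EC_add h h' hX
    rw [e3, nh_some]
    refine ⟨_, Or.inl ?_, rfl⟩
    have hne : s.1 * s'.2.1 - s'.1 * s.2.1 ≠ 0 := by
      intro h
      apply hX
      field_simp
      linear_combination h
    refine ⟨pow_ne_zero 2 hne, ?_⟩
    have e5 : s.1 / s.2.1 - s'.1 / s'.2.1 = (s.1 * s'.2.1 - s'.1 * s.2.1) / (s.2.1 * s'.2.1) := by
      field_simp
    rw [e5]
    generalize s.1 * s'.2.1 - s'.1 * s.2.1 = D at *
    field_simp

end P7f

end PartP7f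

section PartP8a

section P8a
open WeierstrassCurve Height

lemma Hq_pos (u : ℚ) : 0 < Hq u := lt_of_lt_of_le one_pos (Hq_one u)

/-- all height data of one curve -/
lemma curve_data (p : Prm) (hb : 0 < p.b) (hδ : p.δ ≠ 0) (hT : p.t ≠ p.t') :
    ∃ hh : (EC (p.a2 : ℚ) (p.a4 : ℚ)).Point → ℝ,
    (∀ P Q, hh (P + Q) + hh (P - Q) = 2 * hh P + 2 * hh Q) ∧
    (∀ P, 0 ≤ hh P) ∧ (∀ B : ℝ, {P | hh P ≤ B}.Finite) ∧
    (∃ R : Set (EC (p.a2 : ℚ) (p.a4 : ℚ)).Point, R.Finite ∧ ∀ P, ∃ r ∈ R, ∃ z, P = r + 2 • z) ∧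
    ∃ C : ℝ, (∀ P, |hh P - nh P| ≤ C) ∧
      ∀ ξ ω P, PtR p ξ ω 0 P → |hh P - 4 * logHeight₁ ξ| ≤ C := by
  obtain ⟨hh, ⟨C1, h1⟩, hpar, hnn, hN⟩ := exists_hhat (a2 := (p.a2 : ℚ)) (a4 := (p.a4 : ℚ))
    (by exact_mod_cast a4_ne p hb hδ hT) (by exact_mod_cast disc_ne p hb hδ)
  obtain ⟨C2, h2⟩ := height_s0 p hb hδ hT
  have hT0 := T_ne p hT
  have hκ : 0 < p.κ := by unfold Prm.κ; positivity
  refine ⟨hh, hpar, hnn, hN, ?_, ?_⟩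
  · refine EC_weakMW (e2 := p.δ * p.T ^ 2) (e3 := p.δ * p.κ) (mul_ne_zero hδ (pow_ne_zero _ hT0))
      (mul_ne_zero hδ hκ.ne') ?_ ?_ ?_
    · intro h
      have := mul_left_cancel₀ hδ h
      unfold Prm.κ at this
      omega
    · simp only [Prm.a2]; push_cast; ring
    · simp only [Prm.a4]; push_cast; ring
  · have c1 : 0 ≤ C1 := (abs_nonneg _).trans (h1 0)
    have c2 : 0 ≤ C2 := (abs_nonneg _).trans (h2 0)
    refine ⟨C1 + C2, fun P => (h1 P).trans (by linarith), ?_⟩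
    rintro ξ ω P ⟨hβ, h, rfl⟩
    have a1 := h1 (Affine.Point.some _ _ h)
    have a2 := h2 ξ
    rw [nh_some] at a1
    change |logHeight₁ ((p.sk 0 ξ).1 / (p.sk 0 ξ).2.1) - _| ≤ _ at a2
    rw [abs_le] at *
    constructor <;> linarith [a1.1, a1.2, a2.1, a2.2]

/-- one curve: the Kummer coordinate of `2 ^ k P + Q` -/
lemma curve_Kr (p : Prm) (hh : (EC (p.a2 : ℚ) (p.a4 : ℚ)).Point → ℝ)
    (hpar : ∀ P Q, hh (P + Q) + hh (P - Q) = 2 * hh P + 2 * hh Q)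
    (ξ1 ξ2 ω1 ω2 : ℚ) (hω : ω1 ^ 2 = p.F ξ1) (P Q) (hP : PtR p ξ1 ω1 0 P) (hQ : PtR p ξ2 ω2 0 Q)
    (k : ℕ) (h0 : 0 < hh P) (hlt : hh (2 ^ k • P - Q) < 4 * (4 ^ k * hh P)) :
    ∃ u, Kr p k ξ1 ξ2 (ω1 * ω2) u ∧ nh (2 ^ k • P + Q) = logHeight₁ u := by
  refine PtR_Kr p ξ1 ξ2 ω1 ω2 k _ _ (PtR_pow p ξ1 ω1 hω P hP k ?_) hQ ?_
  · intro j _ hj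
    have := par_two_pow hpar j P
    rw [hj, par_zero hpar] at this
    have : 0 < (4 : ℝ) ^ j * hh P := by positivity
    linarith
  · intro h
    have e : Q = -(2 ^ k • P) := by rw [h, neg_neg]
    rw [e, sub_neg_eq_add, ← two_nsmul, par_two hpar, par_two_pow hpar] at hlt
    exact lt_irrefl _ hlt

lemma numeric (A C L h1 h2 g gQ D E l : ℝ) (hA : 1 ≤ A) (hC : 0 ≤ C) (hL : 0 ≤ L)
    (hbig : 200000 * C + 20 * L + 1 ≤ h1) (g1 : |g - 8 * h1| ≤ 2 * C) (g2 : |gQ - 8 * h2| ≤ 2 * C)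
    (hE : E + D = 2 * (A * g) + 2 * gQ) (hD : D ≤ 1 / 88008 * A * g)
    (hQ : gQ ≤ 2 * (A * g) + 2 * D) (hl : E - 2 * C ≤ l)
    (hm : 11000 * l ≤ A * L + (16 * 10999 + 4) * (A * h1) + (16 * 11000 + 4) * h2) : False := by
  rw [abs_le] at g1 g2
  have b1 : A * (200000 * C + 20 * L + 1) ≤ A * h1 := by gcongr
  have b2 : A * g ≤ A * (8 * h1 + 2 * C) := by gcongr; linarith [g1.2]
  have b3 : A * (8 * h1 - 2 * C) ≤ A * g := by gcongr; linarith [g1.1]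
  have b4 : C ≤ A * C := by nlinarith
  have b5 : 0 ≤ A * L := by positivity
  obtain ⟨Ag, hAg⟩ : ∃ x, x = A * g := ⟨_, rfl⟩
  obtain ⟨a1, ha1⟩ : ∃ x, x = A * h1 := ⟨_, rfl⟩
  obtain ⟨ac, hac⟩ : ∃ x, x = A * C := ⟨_, rfl⟩
  obtain ⟨al, hal⟩ : ∃ x, x = A * L := ⟨_, rfl⟩
  have b1' : 200000 * ac + 20 * al + A ≤ a1 := by rw [ha1, hac, hal]; linarith
  have b2' : Ag ≤ 8 * a1 + 2 * ac := by rw [ha1, hac, hAg]; linarith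
  have b3' : 8 * a1 - 2 * ac ≤ Ag := by rw [ha1, hac, hAg]; linarith
  rw [← hac] at b4
  rw [← hal] at b5 hm
  rw [← ha1] at hm
  rw [← hAg] at hE hQ
  have hD' : D ≤ 1 / 88008 * Ag := by rw [hAg]; linarith
  linarith [g2.1, g2.2]

lemma numeric2 (A C L h1 h2 g gQ D : ℝ) (hA : 1 ≤ A) (hC : 0 ≤ C) (hL : 0 ≤ L)
    (hbig : 200000 * C + 20 * L + 1 ≤ h1) (g1 : |g - 8 * h1| ≤ 2 * C) (g2 : |gQ - 8 * h2| ≤ 2 * C)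
    (hD : D ≤ 1 / 88008 * A * g) (hQ : A * g ≤ 2 * gQ + 2 * D) : A * L < h2 := by
  rw [abs_le] at g1 g2
  have b1 : A * (200000 * C + 20 * L + 1) ≤ A * h1 := by gcongr
  have b2 : A * g ≤ A * (8 * h1 + 2 * C) := by gcongr; linarith [g1.2]
  have b3 : A * (8 * h1 - 2 * C) ≤ A * g := by gcongr; linarith [g1.1]
  have b4 : C ≤ A * C := by nlinarith
  have b5 : 0 ≤ A * L := by positivity
  linarith [g2.1, g2.2]

lemma numeric3 (A C L h1 g x D d : ℝ) (hA : 1 ≤ A) (hC : 0 ≤ C) (hL : 0 ≤ L)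
    (hbig : 200000 * C + 20 * L + 1 ≤ h1) (g1 : |g - 8 * h1| ≤ 2 * C) (g2 : |x - 4 * h1| ≤ C)
    (hD : D ≤ 1 / 88008 * A * g) (hd : d ≤ D) : 0 < x ∧ d < 4 * (A * x) := by
  rw [abs_le] at g1 g2
  have b1 : A * (200000 * C + 20 * L + 1) ≤ A * h1 := by gcongr
  have b2 : A * g ≤ A * (8 * h1 + 2 * C) := by gcongr; linarith [g1.2]
  have b3 : A * (4 * h1 - C) ≤ A * x := by gcongr; linarith [g2.1]
  have b4 : C ≤ A * C := by nlinarith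
  have b5 : 0 ≤ A * L := by positivity
  constructor <;> linarith [g2.1, g2.2]

theorem core (p p' : Prm) (hb : 0 < p.b) (hb' : p'.b = p.b) (ht : p'.t = p.t) (hδ : p.δ ≠ 0)
    (hδ' : p'.δ ≠ 0) (hT : p.t ≠ p.t') (hT1 : p'.t ≠ p'.t') (hT' : p.t' ≠ p'.t') :
    {x : ℚ | ∃ ω θ : ℚ, ω ^ 2 = p.F x ∧ θ ^ 2 = p'.F x}.Finite := by
  obtain ⟨hh1, par1, nn1, N1, ⟨R1, R1f, hR1⟩, C1, cn1, cx1⟩ := curve_data p hb hδ hT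
  obtain ⟨hh2, par2, nn2, N2, ⟨R2, R2f, hR2⟩, C2, cn2, cx2⟩ := curve_data p' (by omega) hδ' hT1
  obtain ⟨K, hK, hmain⟩ := main_ineq p p' hb hb' ht hδ hδ' hT hT1 hT' 11000 le_rfl
  obtain ⟨C, hC⟩ : ∃ C, C = max C1 C2 := ⟨_, rfl⟩
  have hC1 : C1 ≤ C := hC ▸ le_max_left _ _
  have hC2 : C2 ≤ C := hC ▸ le_max_right _ _
  have hC0 : 0 ≤ C := ((abs_nonneg _).trans (cn1 0)).trans hC1
  have hL0 : 0 ≤ Real.log K := Real.log_nonneg hK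
  by_contra hinf
  obtain ⟨Z, hZ⟩ : ∃ Z : Set ((EC (p.a2 : ℚ) (p.a4 : ℚ)).Point × (EC (p'.a2 : ℚ) (p'.a4 : ℚ)).Point),
    Z = {P | ∃ ξ ω θ : ℚ, ω ^ 2 = p.F ξ ∧ θ ^ 2 = p'.F ξ ∧ PtR p ξ ω 0 P.1 ∧ PtR p' ξ θ 0 P.2} :=
    ⟨_, rfl⟩
  have hZi : Z.Infinite := by
    intro hZf
    apply hinf
    obtain ⟨m, hm⟩ := (hZf.image (fun P => hh1 P.1)).bddAbove
    refine (NumberField.finite_setOfPred_logHeight₁_le ℚ ((m + C) / 4)).subset ?_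
    rintro ξ ⟨ω, θ, hω, hθ⟩
    obtain ⟨P, hP⟩ := PtR_zero p hb hδ hT ξ ω hω
    obtain ⟨P', hP'⟩ := PtR_zero p' (by omega) hδ' hT1 ξ θ hθ
    have hmem : (P, P') ∈ Z := by rw [hZ]; exact ⟨ξ, ω, θ, hω, hθ, hP, hP'⟩
    have h1 : hh1 P ≤ m := hm ⟨_, hmem, rfl⟩
    have h2 := abs_le.1 (cx1 ξ ω P hP)
    change logHeight₁ ξ ≤ _
    linarith [h2.1]
  obtain ⟨hh, hhd⟩ : ∃ hh : (EC (p.a2 : ℚ) (p.a4 : ℚ)).Point × (EC (p'.a2 : ℚ) (p'.a4 : ℚ)).Point → ℝ,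
    ∀ P, hh P = hh1 P.1 + hh2 P.2 := ⟨_, fun P => rfl⟩
  have hpar : ∀ P Q, hh (P + Q) + hh (P - Q) = 2 * hh P + 2 * hh Q := by
    intro P Q
    simp only [hhd, Prod.fst_add, Prod.snd_add, Prod.fst_sub, Prod.snd_sub]
    linarith [par1 P.1 Q.1, par2 P.2 Q.2]
  have hnn : ∀ P, 0 ≤ hh P := fun P => by rw [hhd]; exact add_nonneg (nn1 _) (nn2 _)
  obtain ⟨P, hPZ, Q, hQZ, k, hk, hM, hclose⟩ := descent_pair hpar hnn (by
      intro B
      refine ((N1 B).prod (N2 B)).subset ?_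
      intro P hP
      change hh P ≤ B at hP
      rw [hhd] at hP
      exact ⟨by change hh1 P.1 ≤ B; linarith [nn2 P.2], by change hh2 P.2 ≤ B; linarith [nn1 P.1]⟩)
    (R1 ×ˢ R2) (R1f.prod R2f) (by
      intro P
      obtain ⟨r, hr, z, h⟩ := hR1 P.1
      obtain ⟨r', hr', z', h'⟩ := hR2 P.2
      exact ⟨(r, r'), ⟨hr, hr'⟩, (z, z'), Prod.ext h h'⟩) Z hZi (1 / 88008) (by norm_num)
      (8 * (200000 * C + 20 * Real.log K + 1) + 2 * C) 12
  rw [hZ] at hPZ hQZ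
  obtain ⟨ξ1, ω1, θ1, hω1, hθ1, hP1, hP2⟩ := hPZ
  obtain ⟨ξ2, ω2, θ2, hω2, hθ2, hQ1, hQ2⟩ := hQZ
  have x1 := (cx1 _ _ _ hP1).trans hC1
  have x2 := (cx2 _ _ _ hP2).trans hC2
  have x3 := (cx1 _ _ _ hQ1).trans hC1
  have x4 := (cx2 _ _ _ hQ2).trans hC2
  have g1 : |hh P - 8 * logHeight₁ ξ1| ≤ 2 * C := by
    rw [hhd]; rw [abs_le] at *; constructor <;> linarith [x1.1, x1.2, x2.1, x2.2]
  have g2 : |hh Q - 8 * logHeight₁ ξ2| ≤ 2 * C := by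
    rw [hhd]; rw [abs_le] at *; constructor <;> linarith [x3.1, x3.2, x4.1, x4.2]
  have hbig : 200000 * C + 20 * Real.log K + 1 ≤ logHeight₁ ξ1 := by
    have := (abs_le.1 g1).2
    linarith
  have hA : (1 : ℝ) ≤ 4 ^ k := one_le_pow₀ (by norm_num)
  have hD : hh (2 ^ k • P - Q) = hh1 (2 ^ k • P.1 - Q.1) + hh2 (2 ^ k • P.2 - Q.2) := by
    rw [hhd]; simp
  have hE : hh (2 ^ k • P + Q) = hh1 (2 ^ k • P.1 + Q.1) + hh2 (2 ^ k • P.2 + Q.2) := by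
    rw [hhd]; simp
  have hPk := par_two_pow hpar k P
  have p1 := hpar (2 ^ k • P) Q
  rw [hPk] at p1
  have p2 := hpar (2 ^ k • P) (2 ^ k • P - Q)
  rw [sub_sub_cancel, hPk] at p2
  have p3 := hpar Q (2 ^ k • P - Q)
  rw [add_sub_cancel, hPk] at p3
  obtain ⟨n1, n1'⟩ := numeric3 (4 ^ k) C (Real.log K) (logHeight₁ ξ1) (hh P) (hh1 P.1) _
    (hh1 (2 ^ k • P.1 - Q.1)) hA hC0 hL0 hbig g1 x1 hclose (by rw [hD]; linarith [nn2 (2 ^ k • P.2 - Q.2)])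
  obtain ⟨n2, n2'⟩ := numeric3 (4 ^ k) C (Real.log K) (logHeight₁ ξ1) (hh P) (hh2 P.2) _
    (hh2 (2 ^ k • P.2 - Q.2)) hA hC0 hL0 hbig g1 x2 hclose (by rw [hD]; linarith [nn1 (2 ^ k • P.1 - Q.1)])
  obtain ⟨u, hu, hu'⟩ := curve_Kr p hh1 par1 ξ1 ξ2 ω1 ω2 hω1 P.1 Q.1 hP1 hQ1 k n1 n1'
  obtain ⟨v, hv, hv'⟩ := curve_Kr p' hh2 par2 ξ1 ξ2 θ1 θ2 hθ1 P.2 Q.2 hP2 hQ2 k n2 n2'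
  have hK0 : 0 < K := by linarith
  have m1 := hmain k (by
      have : (4 : ℕ) ^ 12 ≤ 4 ^ k := Nat.pow_le_pow_right (by norm_num) hk
      norm_num at this ⊢
      omega) (by omega) ξ1 ξ2 ω1 ω2 θ1 θ2 u v hω1 hω2 hθ1 hθ2
    (by
      rw [← Real.log_le_log_iff hK0 (Hq_pos _), Hq_log]
      linarith)
    (by
      rw [← Real.log_lt_log_iff (pow_pos hK0 _) (Hq_pos _), Hq_log, Real.log_pow]
      push_cast
      exact numeric2 (4 ^ k) C (Real.log K) (logHeight₁ ξ1) (logHeight₁ ξ2) (hh P) (hh Q) _ hA hC0 hL0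
        hbig g1 g2 hclose (by linarith [hnn (Q - (2 ^ k • P - Q))]))
    hu hv
  have hp1 := Hq_pos u
  have hp2 := Hq_pos v
  have hp3 := Hq_pos ξ1
  have hp4 := Hq_pos ξ2
  have m2 := Real.log_le_log (by positivity) m1
  rw [Real.log_pow, Real.log_mul hp1.ne' hp2.ne', Real.log_mul (by positivity) (by positivity),
    Real.log_mul (by positivity) (by positivity), Real.log_pow, Real.log_pow, Real.log_pow,
    Hq_log, Hq_log, Hq_log, Hq_log] at m2
  have c1 := (cn1 (2 ^ k • P.1 + Q.1)).trans hC1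
  have c2 := (cn2 (2 ^ k • P.2 + Q.2)).trans hC2
  rw [hu', abs_le] at c1
  rw [hv', abs_le] at c2
  refine numeric (4 ^ k) C (Real.log K) (logHeight₁ ξ1) (logHeight₁ ξ2) (hh P) (hh Q) _ _
    (logHeight₁ u + logHeight₁ v) hA hC0 hL0 hbig g1 g2 p1 hclose
    (by linarith [hnn (2 ^ k • P + (2 ^ k • P - Q))]) ?_ ?_
  · rw [hE]; linarith [c1.2, c2.2]
  · norm_num at m2 ⊢
    linarith

end P8a

end PartP8a


section P8b

lemma exists_int_mul (r : ℚ) (n : ℤ) (h : (r.den : ℤ) ∣ n) : ∃ t : ℤ, (n : ℚ) * r = t := by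
  obtain ⟨c, rfl⟩ := h
  refine ⟨c * r.num, ?_⟩
  have h1 : (r.den : ℚ) * r = r.num := Rat.den_mul_eq_num r
  push_cast
  linear_combination (c : ℚ) * h1

lemma gcd_quad (m d t t' b : ℤ) (hc : IsCoprime m d) :
    (Int.gcd ((m - 2 * t * d) ^ 2 + b * d ^ 2) ((m - 2 * t' * d) ^ 2 + b * d ^ 2) : ℤ) ∣
      4 * (t - t') * (b + (t - t') ^ 2) := by
  have hc1 : IsCoprime (m - (t + t') * d) d := by
    have := hc.add_mul_right_left (-(t + t'))
    have e : m + d * -(t + t') = m - (t + t') * d := by ring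
    rwa [mul_comm, e] at this
  refine gcd_dvd_of_two (p := (m - (t + t') * d) ^ 3) (d := d ^ 3) (hc1.pow) ?_ ?_
  · refine gcd_dvd_of_comb
      ((b + (t - t') ^ 2) * (2 * (t - t') * (m - (t + t') * d) + (b + (t - t') ^ 2) * d))
      ((b + (t - t') ^ 2) * (2 * (t - t') * (m - (t + t') * d) - (b + (t - t') ^ 2) * d)) ?_
    ring
  · refine gcd_dvd_of_comb (2 * (t - t') * d + (m - (t + t') * d))
      (2 * (t - t') * d - (m - (t + t') * d)) ?_
    ring

lemma int_model (t1 t2 t3 b : ℤ) (hb : 0 < b) (h12 : t1 ≠ t2) (h13 : t1 ≠ t3) (h23 : t2 ≠ t3) :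
    {x : ℚ | ∃ y : ℚ, y ^ 2 = ((x - 2 * t1) ^ 2 + b) * ((x - 2 * t2) ^ 2 + b) *
      ((x - 2 * t3) ^ 2 + b)}.Finite := by
  obtain ⟨N, hN⟩ : ∃ N : ℤ → ℤ → ℤ, ∀ t t', N t t' = 4 * (t - t') * (b + (t - t') ^ 2) :=
    ⟨_, fun _ _ => rfl⟩
  have hN0 : ∀ t t', t ≠ t' → N t t' ≠ 0 := by
    intro t t' h
    rw [hN]
    have h1 : t - t' ≠ 0 := sub_ne_zero.2 h
    have h2 : 0 < b + (t - t') ^ 2 := by positivity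
    exact mul_ne_zero (mul_ne_zero (by norm_num) h1) h2.ne'
  have f1 := int_finite_dvd (mul_ne_zero (hN0 _ _ h12) (hN0 _ _ h13))
  have f2 := int_finite_dvd (mul_ne_zero (hN0 _ _ h12.symm) (hN0 _ _ h23))
  have f3 := int_finite_dvd (mul_ne_zero (hN0 _ _ h13.symm) (hN0 _ _ h23.symm))
  refine Set.Finite.subset ((f1.prod (f2.prod f3)).biUnion (t := fun s =>
    {x : ℚ | s.1 ≠ 0 ∧ s.2.1 ≠ 0 ∧ s.2.2 ≠ 0 ∧ ∃ ω θ : ℚ, ω ^ 2 = (Prm.mk t1 t2 b (s.1 * s.2.1)).F x ∧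
      θ ^ 2 = (Prm.mk t1 t3 b (s.1 * s.2.2)).F x}) ?_) ?_
  · rintro ⟨s1, s2, s3⟩ _
    by_cases g1 : s1 = 0
    · simp [g1]
    by_cases g2 : s2 = 0
    · simp [g2]
    by_cases g3 : s3 = 0
    · simp [g3]
    refine (core (Prm.mk t1 t2 b (s1 * s2)) (Prm.mk t1 t3 b (s1 * s3)) hb rfl rfl
      (mul_ne_zero g1 g2) (mul_ne_zero g1 g3) h12 h13 h23).subset ?_
    rintro x ⟨_, _, _, h⟩
    exact h
  · rintro x ⟨y, hy⟩
    have hd0 : (x.den : ℚ) ≠ 0 := by exact_mod_cast x.den_nz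
    have hx : x = x.num / x.den := (Rat.num_div_den x).symm
    have hc : IsCoprime x.num (x.den : ℤ) := by
      rw [Int.isCoprime_iff_gcd_eq_one]
      exact x.reduced
    obtain ⟨m, hm⟩ : ∃ m : ℤ, m = x.num := ⟨_, rfl⟩
    obtain ⟨d, hd⟩ : ∃ d : ℤ, d = (x.den : ℤ) := ⟨_, rfl⟩
    have hdd : (d : ℚ) = x.den := by rw [hd]; push_cast; rfl
    rw [← hm, ← hd] at hc
    rw [← hm, ← hdd] at hx
    rw [← hdd] at hd0
    obtain ⟨Q, hQ⟩ : ∃ Q : ℤ → ℤ, ∀ t, Q t = (m - 2 * t * d) ^ 2 + b * d ^ 2 := ⟨_, fun _ => rfl⟩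
    have hdz : d ≠ 0 := by exact_mod_cast hd0
    have hQ0 : ∀ t, Q t ≠ 0 := by
      intro t
      have : 0 < Q t := by rw [hQ]; positivity
      exact this.ne'
    have hg : ∀ t t', (Int.gcd (Q t) (Q t') : ℤ) ∣ N t t' := by
      intro t t'
      rw [hQ, hQ, hN]
      exact gcd_quad m d t t' b hc
    have hq : ∀ t : ℤ, (x - 2 * t) ^ 2 + b = (Q t : ℚ) / d ^ 2 := by
      intro t
      rw [hQ, hx]
      push_cast
      field_simp
    obtain ⟨z, -, hz⟩ := rat_int_of_sq (x := y * d ^ 3) (z := Q t1 * Q t2 * Q t3) (by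
      rw [mul_pow, hy, hq, hq, hq]
      push_cast
      field_simp)
    obtain ⟨s1, w1, d1, e1⟩ := int_mul_sq (hQ0 t1) (show Q t1 * (Q t2 * Q t3) = z ^ 2 by
      rw [hz]; ring) (int_gcd_mul_dvd (hg t1 t2) (hg t1 t3))
    obtain ⟨s2, w2, d2, e2⟩ := int_mul_sq (hQ0 t2) (show Q t2 * (Q t1 * Q t3) = z ^ 2 by
      rw [hz]; ring) (int_gcd_mul_dvd (hg t2 t1) (hg t2 t3))
    obtain ⟨s3, w3, d3, e3⟩ := int_mul_sq (hQ0 t3) (show Q t3 * (Q t1 * Q t2) = z ^ 2 by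
      rw [hz]; ring) (int_gcd_mul_dvd (hg t3 t1) (hg t3 t2))
    refine Set.mem_biUnion (x := (s1, s2, s3)) ⟨d1, d2, d3⟩ ?_
    refine ⟨?_, ?_, ?_, s1 * s2 * w1 * w2 / d ^ 2, s1 * s3 * w1 * w3 / d ^ 2, ?_, ?_⟩
    · intro h; apply hQ0 t1; rw [e1]; simp only at h; rw [h, zero_mul]
    · intro h; apply hQ0 t2; rw [e2]; simp only at h; rw [h, zero_mul]
    · intro h; apply hQ0 t3; rw [e3]; simp only at h; rw [h, zero_mul]
    · simp only [Prm.F, Prm.q1, Prm.q2]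
      rw [hq, hq, e1, e2]
      push_cast
      field_simp
    · simp only [Prm.F, Prm.q1, Prm.q2]
      rw [hq, hq, e1, e3]
      push_cast
      field_simp

end P8b

/-- The genus-two hyperelliptic curve `y² = ∏ᵢ [(x − (a + cᵢ)/2)² + B/4]` with
`B > 0` and `c₁, c₂, c₃` pairwise distinct rationals has only finitely many
rational points. -/
theorem finitely_many_rational_points_on_median_curve
    (a B : ℚ) (hB : 0 < B) (c₁ c₂ c₃ : ℚ)
    (h₁₂ : c₁ ≠ c₂) (h₁₃ : c₁ ≠ c₃) (h₂₃ : c₂ ≠ c₃) :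
    {p : ℚ × ℚ | p.2 ^ 2 =
      ((p.1 - (a + c₁) / 2) ^ 2 + B / 4) *
      ((p.1 - (a + c₂) / 2) ^ 2 + B / 4) *
      ((p.1 - (a + c₃) / 2) ^ 2 + B / 4)}.Finite := by
  obtain ⟨L, hL⟩ : ∃ L : ℤ, L = (a + c₁).den * (a + c₂).den * (a + c₃).den * B.den := ⟨_, rfl⟩
  have hL0 : 0 < L := by
    rw [hL]
    have i1 := (a + c₁).den_pos
    have i2 := (a + c₂).den_pos
    have i3 := (a + c₃).den_pos
    have i4 := B.den_pos
    positivity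
  have hLq : (0 : ℚ) < L := by exact_mod_cast hL0
  obtain ⟨t1, e1⟩ := exists_int_mul (a + c₁) L ⟨(a + c₂).den * (a + c₃).den * B.den, by rw [hL]; ring⟩
  obtain ⟨t2, e2⟩ := exists_int_mul (a + c₂) L ⟨(a + c₁).den * (a + c₃).den * B.den, by rw [hL]; ring⟩
  obtain ⟨t3, e3⟩ := exists_int_mul (a + c₃) L ⟨(a + c₁).den * (a + c₂).den * B.den, by rw [hL]; ring⟩
  obtain ⟨b0, e4⟩ := exists_int_mul B L ⟨(a + c₁).den * (a + c₂).den * (a + c₃).den, by rw [hL]; ring⟩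
  have hb0 : 0 < b0 := by
    have : (0 : ℚ) < b0 := by rw [← e4]; positivity
    exact_mod_cast this
  have hne : ∀ (c c' : ℚ) (t t' : ℤ), c ≠ c' → (L : ℚ) * (a + c) = t → (L : ℚ) * (a + c') = t' → t ≠ t' := by
    intro c c' t t' hcc h h' htt
    apply hcc
    rw [htt, ← h'] at h
    have := mul_left_cancel₀ hLq.ne' h
    linarith
  have hf := int_model t1 t2 t3 (4 * L * b0) (by positivity) (hne _ _ _ _ h₁₂ e1 e2)
    (hne _ _ _ _ h₁₃ e1 e3) (hne _ _ _ _ h₂₃ e2 e3)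
  refine Set.Finite.of_finite_fibers (fun p => 4 * (L : ℚ) * p.1) (hf.subset ?_) ?_
  · rintro _ ⟨⟨x, y⟩, hxy, rfl⟩
    refine ⟨64 * L ^ 3 * y, ?_⟩
    change y ^ 2 = _ at hxy
    simp only at hxy
    simp only
    rw [← e1, ← e2, ← e3]
    push_cast
    rw [← e4, mul_pow, hxy]
    ring
  · intro w _
    by_cases hne : ({p : ℚ × ℚ | p.2 ^ 2 =
      ((p.1 - (a + c₁) / 2) ^ 2 + B / 4) *
      ((p.1 - (a + c₂) / 2) ^ 2 + B / 4) *
      ((p.1 - (a + c₃) / 2) ^ 2 + B / 4)} ∩ (fun p => 4 * (L : ℚ) * p.1) ⁻¹' {w}).Nonempty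
    · obtain ⟨⟨x, y⟩, hxy, hw⟩ := hne
      refine (Set.toFinite {(x, y), (x, -y)}).subset ?_
      rintro ⟨x', y'⟩ ⟨hxy', hw'⟩
      change 4 * (L : ℚ) * x = w at hw
      change 4 * (L : ℚ) * x' = w at hw'
      have hx : x' = x := by
        apply mul_left_cancel₀ (show 4 * (L : ℚ) ≠ 0 by positivity)
        rw [hw, hw']
      subst hx
      change y ^ 2 = _ at hxy
      change y' ^ 2 = _ at hxy'
      have : y' ^ 2 = y ^ 2 := by rw [hxy, hxy']
      rcases sq_eq_sq_iff_eq_or_eq_neg.1 this with h | h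
      · left; rw [h]
      · right; rw [h]; rfl
    · rw [Set.not_nonempty_iff_eq_empty.1 hne]
      exact Set.finite_empty
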